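/- Trichotomy theorem for vector-valued intersections. Let D,C,k ∈ ℕ and ε ∈ (0,1). There is θ₁ > 0 such that for all γ₂,γ₂' ∈ (0,θ₁) there is θ₂ > 0 such that for all γ₁,γ₁' ∈ (0,θ₂) there is δ₀ > 0 such that for all δ ∈ (0,δ₀) there is n₀ such that the following holds for all n ≥ n₀. Let R ∈ ℝ^D with 0 < R_d ≤ n^C for all d, and let 𝒱 = (v_i : i∈[n]) with every v_i ∈ ℤ^D and ‖v_i‖_R ≤ 1, such that 𝒱 is γᵢ'-robustly (γᵢ,R)-generic and γᵢ-robustly (R,k)-generating for i = 1,2. Let z,w ∈ ℤ^D with z ≠ w and 𝒳 = ({0,1}ⁿ)^𝒱_z. Then at least one of the following holds: (i) every 𝒜 ⊆ 𝒳 with |𝒜| ≥ (1−δ)ⁿ|𝒳| satisfies |(𝒜×𝒜)^{𝒱_∩}_w| ≥ (1−ε)ⁿ|(𝒳×𝒳)^{𝒱_∩}_w|; (ii) there exists ℬ_full ⊆ 𝒳 with |ℬ_full| ≤ (1−δ)ⁿ|𝒳| such that |(𝒳×𝒳)^{𝒱_∩}_w ∖ (ℬ_full×ℬ_full)^{𝒱_∩}_w|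 ≤ (1−δ)ⁿ|(𝒳×𝒳)^{𝒱_∩}_w|; (iii) there exists ℬ_empty ⊆ 𝒳 with |ℬ_empty| ≥ ⌊(1−ε)ⁿ|𝒳|⌋ and (ℬ_empty×ℬ_empty)^{𝒱_∩}_w = ∅. Moreover, if (ii) holds and (iii) does not, then ℬ_full can be chosen so that in addition every ℬ ⊆ ℬ_full with |ℬ| ≥ (1−δ)ⁿ|ℬ_full| satisfies |(ℬ×ℬ)^{𝒱_∩}_w| ≥ (1−ε)ⁿ|(𝒳×𝒳)^{𝒱_∩}_w|. -/

import Mathlib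

open Finset

noncomputable section

/-- The `R`-scaled sup-norm `max_d |v d| / R d`. -/
noncomputable def rnorm {D : ℕ} (R : Fin D → ℝ) (v : Fin D → ℝ) : ℝ :=
  ⨆ d, |v d| / R d

/-- Evaluation of a family of vectors at a 0/1 vector. -/
def bEval {n D : ℕ} (v : Fin n → Fin D → ℤ) (a : Fin n → Bool) (d : Fin D) : ℤ :=
  ∑ i, if a i then v i d else 0

/-- Intersection evaluation `𝒱_∩(a,b) d = Σ_{i ∈ a ∩ b} v i d`. -/
def bCap {n D : ℕ} (v : Fin n → Fin D → ℤ) (a b : Fin n → Bool) (d : Fin D) : ℤ :=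
  ∑ i, if a i ∧ b i then v i d else 0

/-- The set of pairs `(A,B) ∈ 𝒜 × ℬ` with `𝒱_∩(A,B) = w`. -/
def capPairs {n D : ℕ} (v : Fin n → Fin D → ℤ) (A B : Set (Fin n → Bool))
    (w : Fin D → ℤ) : Set ((Fin n → Bool) × (Fin n → Bool)) :=
  {z | z.1 ∈ A ∧ z.2 ∈ B ∧ ∀ d, bCap v z.1 z.2 d = w d}

/-- `v` is `γ`-robustly `(R,k)`-generating. -/
def RobustlyGenerating {n D : ℕ} (γ : ℝ) (R : Fin D → ℝ) (k : ℕ)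
    (v : Fin n → Fin D → ℤ) : Prop :=
  ∀ u : Fin D → ℤ, rnorm R (fun d => (u d : ℝ)) ≤ 1 →
    ∀ T : Finset (Fin n), (T.card : ℝ) ≤ γ * n →
      ∃ S S' : Finset (Fin n), Disjoint S S' ∧ Disjoint S T ∧ Disjoint S' T ∧
        S.card + S'.card ≤ k ∧ ∀ d, u d = ∑ i ∈ S, v i d - ∑ i ∈ S', v i d

/-- `v` is `γ'`-robustly `(γ,R)`-generic. -/
def RobustlyGeneric {n D : ℕ} (γ' γ : ℝ) (R : Fin D → ℝ) (v : Fin n → Fin D → ℤ) : Prop :=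
  ∀ X : Finset (Fin n), γ' * n < (X.card : ℝ) →
    ∃ e : Fin D → Fin n, Function.Injective e ∧ (∀ d, e d ∈ X) ∧
      γ * ∏ d, R d ≤ |(Matrix.of fun d d' : Fin D => ((v (e d) d' : ℝ))).det|

/-- Case (ii) of the trichotomy, for a given set `B = ℬ_full`. -/
def CaseFull {n D : ℕ} (v : Fin n → Fin D → ℤ) (X : Set (Fin n → Bool))
    (w : Fin D → ℤ) (δ : ℝ) (B : Set (Fin n → Bool)) : Prop :=
  B ⊆ X ∧ (B.ncard : ℝ) ≤ (1 - δ) ^ n * (X.ncard : ℝ) ∧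
    ((capPairs v X X w \ capPairs v B B w).ncard : ℝ) ≤
      (1 - δ) ^ n * ((capPairs v X X w).ncard : ℝ)

/-- Case (iii) of the trichotomy. -/
def CaseEmpty {n D : ℕ} (v : Fin n → Fin D → ℤ) (X : Set (Fin n → Bool))
    (w : Fin D → ℤ) (ε : ℝ) : Prop :=
  ∃ B : Set (Fin n → Bool), B ⊆ X ∧
    ⌊(1 - ε) ^ n * (X.ncard : ℝ)⌋ ≤ (B.ncard : ℤ) ∧
    capPairs v B B w = ∅

/-- The weight of a point under the product of the weights `p i`. -/
def prodWt {n : ℕ} {J : Type*} (p : Fin n → J → ℝ) (x : Fin n → J) : ℝ := ∏ i, p i (x i)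

/-- The measure of a set under the product of the weights `p i`. -/
def prodPr {n : ℕ} {J : Type*} [Fintype J] (p : Fin n → J → ℝ) (S : Set (Fin n → J)) : ℝ :=
  ∑ x, S.indicator (prodWt p) x

/-- The expectation of a function under the product of the weights `p i`. -/
def prodEx {n : ℕ} {J : Type*} [Fintype J] (p : Fin n → J → ℝ) (f : (Fin n → J) → ℝ) : ℝ :=
  ∑ x, prodWt p x * f x

/-- Every `p i` is a probability weight. -/
structure IsWeights {n : ℕ} {J : Type*} [Fintype J] (p : Fin n → J → ℝ) : Prop where
  nonneg : ∀ i j, 0 ≤ p i j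
  sum_one : ∀ i, ∑ j, p i j = 1

namespace IsWeights

variable {n : ℕ} {J : Type*} [Fintype J] {p : Fin n → J → ℝ}

lemma prodWt_nonneg (hp : IsWeights p) (x : Fin n → J) : 0 ≤ prodWt p x :=
  Finset.prod_nonneg fun i _ => hp.nonneg i _

lemma sum_prodWt (hp : IsWeights p) : ∑ x, prodWt p x = 1 := by
  classical
  have := Finset.prod_univ_sum (fun _ : Fin n => (univ : Finset J)) (fun i j => p i j)
  simp only [hp.sum_one, Finset.prod_const_one, Fintype.piFinset_univ] at this
  exact this.symm

lemma prodPr_univ (hp : IsWeights p) : prodPr p Set.univ = 1 := by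
  simp [prodPr, hp.sum_prodWt]

lemma prodPr_mono (hp : IsWeights p) {S T : Set (Fin n → J)} (h : S ⊆ T) :
    prodPr p S ≤ prodPr p T :=
  Finset.sum_le_sum fun x _ =>
    Set.indicator_le_indicator_of_subset h (fun x => hp.prodWt_nonneg x) x

lemma prodPr_nonneg (hp : IsWeights p) (S : Set (Fin n → J)) : 0 ≤ prodPr p S :=
  Finset.sum_nonneg fun x _ => Set.indicator_nonneg (fun x _ => hp.prodWt_nonneg x) x

lemma prodPr_le_one (hp : IsWeights p) (S : Set (Fin n → J)) : prodPr p S ≤ 1 :=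
  (hp.prodPr_mono (Set.subset_univ S)).trans hp.prodPr_univ.le

lemma prodPr_union_le (hp : IsWeights p) (S T : Set (Fin n → J)) :
    prodPr p (S ∪ T) ≤ prodPr p S + prodPr p T := by
  rw [prodPr, prodPr, prodPr, ← Finset.sum_add_distrib]
  refine Finset.sum_le_sum fun x _ => ?_
  have := hp.prodWt_nonneg x
  by_cases h1 : x ∈ S <;> by_cases h2 : x ∈ T <;> simp [Set.indicator, h1, h2, this]

end IsWeights

lemma prodWt_cons {n : ℕ} {J : Type*} (p : Fin (n + 1) → J → ℝ) (j : J) (y : Fin n → J) :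
    prodWt p (Fin.cons j y : Fin (n + 1) → J) = p 0 j * prodWt (fun i => p i.succ) y := by
  simp [prodWt, Fin.prod_univ_succ]

section

variable {n : ℕ} {J : Type*} [Fintype J]

lemma prodPr_empty (p : Fin n → J → ℝ) : prodPr p ∅ = 0 := by
  simp [prodPr]

lemma prodPr_union_add_inter (p : Fin n → J → ℝ) (S T : Set (Fin n → J)) :
    prodPr p (S ∪ T) + prodPr p (S ∩ T) = prodPr p S + prodPr p T := by
  simp only [prodPr, ← Finset.sum_add_distrib]
  exact Finset.sum_congr rfl fun x _ => Set.indicator_union_add_inter_apply _ _ _ _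

lemma prodPr_compl {p : Fin n → J → ℝ} (hp : IsWeights p) (S : Set (Fin n → J)) :
    prodPr p Sᶜ = 1 - prodPr p S := by
  have := prodPr_union_add_inter p S Sᶜ
  rw [Set.union_compl_self, Set.inter_compl_self, prodPr_empty, hp.prodPr_univ] at this
  linarith

lemma exists_mem_of_prodPr_pos {p : Fin n → J → ℝ} {S : Set (Fin n → J)}
    (h : 0 < prodPr p S) : S.Nonempty := by
  by_contra hS
  rw [Set.not_nonempty_iff_eq_empty] at hS
  rw [hS, prodPr_empty] at h
  exact lt_irrefl _ h

lemma prodPr_biUnion_le {p : Fin n → J → ℝ} (hp : IsWeights p) {ι : Type*} (s : Finset ι)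
    (S : ι → Set (Fin n → J)) : prodPr p (⋃ i ∈ s, S i) ≤ ∑ i ∈ s, prodPr p (S i) := by
  classical
  induction s using Finset.induction with
  | empty => simp [prodPr_empty]
  | insert a s ha ih =>
    rw [Finset.sum_insert ha, Finset.set_biUnion_insert]
    exact (hp.prodPr_union_le _ _).trans (by gcongr)

/-- Markov's inequality. -/
lemma prodPr_mul_le_prodEx {p : Fin n → J → ℝ} (hp : IsWeights p) {f : (Fin n → J) → ℝ}
    (hf : ∀ x, 0 ≤ f x) {S : Set (Fin n → J)} {c : ℝ} (hS : ∀ x ∈ S, c ≤ f x) :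
    prodPr p S * c ≤ prodEx p f := by
  rw [prodPr, prodEx, Finset.sum_mul]
  refine Finset.sum_le_sum fun x _ => ?_
  by_cases hx : x ∈ S
  · rw [Set.indicator_of_mem hx]
    exact mul_le_mul_of_nonneg_left (hS x hx) (hp.prodWt_nonneg x)
  · rw [Set.indicator_of_notMem hx, zero_mul]
    exact mul_nonneg (hp.prodWt_nonneg x) (hf x)

lemma sum_fin_succ_fun {n : ℕ} (F : (Fin (n + 1) → J) → ℝ) :
    ∑ x, F x = ∑ y : Fin n → J, ∑ j, F (Fin.cons j y) := by
  rw [← (Fin.consEquiv fun _ : Fin (n + 1) => J).sum_comp, Fintype.sum_prod_type,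
    Finset.sum_comm]
  rfl

lemma prodEx_succ {n : ℕ} (p : Fin (n + 1) → J → ℝ) (f : (Fin (n + 1) → J) → ℝ) :
    prodEx p f = prodEx (fun i => p i.succ) fun y => ∑ j, p 0 j * f (Fin.cons j y) := by
  rw [prodEx, sum_fin_succ_fun, prodEx]
  refine Finset.sum_congr rfl fun y _ => ?_
  rw [Finset.mul_sum]
  refine Finset.sum_congr rfl fun j _ => ?_
  rw [prodWt_cons]; ring

lemma exp_le_add_exp_sq (x : ℝ) : Real.exp x ≤ x + Real.exp (x ^ 2) := by
  have hsq : 1 + x ^ 2 ≤ Real.exp (x ^ 2) := by linarith [Real.add_one_le_exp (x ^ 2)]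
  rcases le_or_gt |x| 1 with h | h
  · have := (abs_le.1 (Real.abs_exp_sub_one_sub_id_le h)).2
    linarith
  · rcases lt_abs.1 h with h | h
    · have : Real.exp x ≤ Real.exp (x ^ 2) := Real.exp_le_exp.2 (by nlinarith)
      linarith
    · have : Real.exp x ≤ 1 := Real.exp_le_one_iff.2 (by linarith)
      nlinarith

lemma sum_weights_exp_le (w : J → ℝ) (hw : ∀ j, 0 ≤ w j) (hw1 : ∑ j, w j = 1) (g : J → ℝ)
    (hg : ∀ i j, |g i - g j| ≤ 1) (t : ℝ) :
    ∑ j, w j * Real.exp (t * g j) ≤ Real.exp (t ^ 2) * Real.exp (t * ∑ j, w j * g j) := by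
  set M := ∑ j, w j * g j with hM
  have hdev : ∀ j, |g j - M| ≤ 1 := fun j => by
    have : g j - M = ∑ i, w i * (g j - g i) := by
      simp only [mul_sub, Finset.sum_sub_distrib, ← Finset.sum_mul, hw1, one_mul, hM]
    rw [this]
    calc |∑ i, w i * (g j - g i)| ≤ ∑ i, |w i * (g j - g i)| := Finset.abs_sum_le_sum_abs _ _
      _ ≤ ∑ i, w i := Finset.sum_le_sum fun i _ => by
        rw [abs_mul, abs_of_nonneg (hw i)]
        exact mul_le_of_le_one_right (hw i) (hg j i)
      _ = 1 := hw1
  have key : ∀ j, w j * Real.exp (t * g j) ≤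
      Real.exp (t * M) * (w j * (t * (g j - M)) + w j * Real.exp (t ^ 2)) := fun j => by
    have h1 : Real.exp (t * g j) = Real.exp (t * M) * Real.exp (t * (g j - M)) := by
      rw [← Real.exp_add]; ring_nf
    have h2 : Real.exp (t * (g j - M)) ≤ t * (g j - M) + Real.exp (t ^ 2) := by
      refine (exp_le_add_exp_sq _).trans (add_le_add le_rfl (Real.exp_le_exp.2 ?_))
      rw [mul_pow]
      have : (g j - M) ^ 2 ≤ 1 := by
        rw [← sq_abs]; exact pow_le_one₀ (abs_nonneg _) (hdev j)
      nlinarith [sq_nonneg t]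
    rw [h1]
    have := mul_le_mul_of_nonneg_left h2 (mul_nonneg (hw j) (Real.exp_pos (t * M)).le)
    linarith
  refine (Finset.sum_le_sum fun j _ => key j).trans (le_of_eq ?_)
  rw [← Finset.mul_sum, Finset.sum_add_distrib, ← Finset.sum_mul, hw1]
  have : ∑ j, w j * (t * (g j - M)) = 0 := by
    have : ∀ j, w j * (t * (g j - M)) = t * (w j * g j) - t * M * w j := fun j => by ring
    simp only [this, Finset.sum_sub_distrib, ← Finset.mul_sum, hw1, ← hM]; ring
  rw [this]; ring

/-- Changing one coordinate changes the value by at most one. -/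
def HammingLipschitz {n : ℕ} {J : Type*} (f : (Fin n → J) → ℝ) : Prop :=
  ∀ x i j, |f (Function.update x i j) - f x| ≤ 1

lemma HammingLipschitz.neg {n : ℕ} {J : Type*} {f : (Fin n → J) → ℝ} (hf : HammingLipschitz f) :
    HammingLipschitz fun x => - f x := fun x i j => by
  have := hf x i j
  rwa [neg_sub_neg, abs_sub_comm]

/-- The bounded differences inequality, exponential form. -/
theorem prodEx_exp_le {n : ℕ} {p : Fin n → J → ℝ} (hp : IsWeights p) {f : (Fin n → J) → ℝ}
    (hf : HammingLipschitz f) (t : ℝ) :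
    prodEx p (fun x => Real.exp (t * f x)) ≤ Real.exp (t ^ 2 * n + t * prodEx p f) := by
  induction n with
  | zero => simp [prodEx, prodWt]
  | succ n ih =>
    have hp' : IsWeights fun i : Fin n => p i.succ :=
      ⟨fun i j => hp.nonneg _ _, fun i => hp.sum_one _⟩
    set f' : (Fin n → J) → ℝ := fun y => ∑ j, p 0 j * f (Fin.cons j y) with hf'
    have hlip : HammingLipschitz f' := fun y i j => by
      rw [hf']
      simp only [← Finset.sum_sub_distrib, ← mul_sub]
      calc _ ≤ ∑ l, |p 0 l * (f (Fin.cons l (Function.update y i j)) - f (Fin.cons l y))| :=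
            Finset.abs_sum_le_sum_abs _ _
        _ ≤ ∑ l, p 0 l := Finset.sum_le_sum fun l _ => by
          rw [abs_mul, abs_of_nonneg (hp.nonneg _ _), Fin.cons_update]
          exact mul_le_of_le_one_right (hp.nonneg _ _) (hf _ _ _)
        _ = 1 := hp.sum_one 0
    rw [prodEx_succ, prodEx_succ p f]
    have h1 : ∀ y : Fin n → J, ∑ j, p 0 j * Real.exp (t * f (Fin.cons j y)) ≤
        Real.exp (t ^ 2) * Real.exp (t * f' y) := fun y =>
      sum_weights_exp_le _ (hp.nonneg 0) (hp.sum_one 0) (fun j => f (Fin.cons j y))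
        (fun a b => by
          have := hf (Fin.cons b y) 0 a
          rwa [Fin.update_cons_zero] at this) t
    calc _ ≤ prodEx (fun i : Fin n => p i.succ)
          (fun y => Real.exp (t ^ 2) * Real.exp (t * f' y)) :=
          Finset.sum_le_sum fun y _ => mul_le_mul_of_nonneg_left (h1 y) (hp'.prodWt_nonneg y)
      _ = Real.exp (t ^ 2) * prodEx (fun i : Fin n => p i.succ)
          (fun y => Real.exp (t * f' y)) := by
          rw [prodEx, prodEx, Finset.mul_sum]
          exact Finset.sum_congr rfl fun y _ => by ring
      _ ≤ Real.exp (t ^ 2) * _ := mul_le_mul_of_nonneg_left (ih hp' hlip) (Real.exp_pos _).le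
      _ = _ := by
          rw [← Real.exp_add]; congr 1; push_cast; ring

lemma prodEx_neg (p : Fin n → J → ℝ) (f : (Fin n → J) → ℝ) :
    prodEx p (fun x => - f x) = - prodEx p f := by
  simp [prodEx]

/-- Upper tail of the bounded differences inequality. -/
theorem prodPr_upper_tail {p : Fin n → J → ℝ} (hp : IsWeights p) {f : (Fin n → J) → ℝ}
    (hf : HammingLipschitz f) {s : ℝ} (hs : 0 ≤ s) :
    prodPr p {x | prodEx p f + s * n ≤ f x} ≤ Real.exp (-(s ^ 2 / 4 * n)) := by
  have h1 := prodPr_mul_le_prodEx hp (f := fun x => Real.exp (s / 2 * f x))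
    (S := {x | prodEx p f + s * n ≤ f x}) (c := Real.exp (s / 2 * (prodEx p f + s * n)))
    (fun x => (Real.exp_pos _).le)
    (fun x hx => Real.exp_le_exp.2 (mul_le_mul_of_nonneg_left hx (by positivity)))
  have h2 := h1.trans (prodEx_exp_le hp hf (s / 2))
  rw [← le_div_iff₀ (Real.exp_pos _), ← Real.exp_sub] at h2
  refine h2.trans (Real.exp_le_exp.2 (le_of_eq ?_))
  ring

/-- Lower tail of the bounded differences inequality. -/
theorem prodPr_lower_tail {p : Fin n → J → ℝ} (hp : IsWeights p) {f : (Fin n → J) → ℝ}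
    (hf : HammingLipschitz f) {s : ℝ} (hs : 0 ≤ s) :
    prodPr p {x | f x ≤ prodEx p f - s * n} ≤ Real.exp (-(s ^ 2 / 4 * n)) := by
  have := prodPr_upper_tail hp hf.neg hs
  rw [prodEx_neg] at this
  refine le_trans (hp.prodPr_mono fun x hx => ?_) this
  have hx : f x ≤ prodEx p f - s * n := hx
  show -prodEx p f + s * n ≤ -f x
  linarith

end

lemma hammingDist_update_le {n : ℕ} {J : Type*} [DecidableEq J] (x : Fin n → J) (i : Fin n)
    (j : J) : hammingDist (Function.update x i j) x ≤ 1 := by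
  rw [hammingDist]
  calc _ ≤ ({i} : Finset (Fin n)).card := Finset.card_le_card fun l hl => by
        rw [Finset.mem_filter] at hl
        by_contra h
        rw [Finset.mem_singleton] at h
        exact hl.2 (Function.update_of_ne h _ _)
    _ = 1 := Finset.card_singleton i

section

variable {n : ℕ} {J : Type*} [Fintype J] [DecidableEq J]

/-- A set that is not too small has a large Hamming neighbourhood. -/
theorem prodPr_far_le {p : Fin n → J → ℝ} (hp : IsWeights p) {s : ℝ} (hs : 0 ≤ s)
    {A : Set (Fin n → J)} (hA : Real.exp (-(s ^ 2 / 4 * n)) < prodPr p A) :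
    prodPr p {x | ∀ y ∈ A, 2 * s * n ≤ hammingDist x y} ≤ Real.exp (-(s ^ 2 / 4 * n)) := by
  classical
  have hne : A.toFinset.Nonempty := by
    rw [Set.toFinset_nonempty]
    exact exists_mem_of_prodPr_pos ((Real.exp_pos _).trans hA)
  set f : (Fin n → J) → ℝ := fun x => A.toFinset.inf' hne fun y => (hammingDist x y : ℝ) with hf
  have hle : ∀ x x' : Fin n → J, f x ≤ f x' + hammingDist x x' := fun x x' => by
    obtain ⟨y, hy, hy'⟩ := Finset.exists_mem_eq_inf' hne fun y => (hammingDist x' y : ℝ)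
    have h1 : f x ≤ hammingDist x y := Finset.inf'_le _ hy
    have h2 : f x' = hammingDist x' y := hy'
    have h3 : (hammingDist x y : ℝ) ≤ hammingDist x x' + hammingDist x' y := by
      exact_mod_cast hammingDist_triangle x x' y
    linarith
  have hlip : HammingLipschitz f := fun x i j => by
    have h0 : (hammingDist (Function.update x i j) x : ℝ) ≤ 1 := by
      exact_mod_cast hammingDist_update_le x i j
    have h1 := hle (Function.update x i j) x
    have h2 := hle x (Function.update x i j)
    rw [hammingDist_comm] at h2
    rw [abs_le]; constructor <;> linarith
  have hE : prodEx p f ≤ s * n := by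
    by_contra hcon
    rw [not_le] at hcon
    refine absurd hA (not_lt.2 (le_trans (hp.prodPr_mono fun x hx => ?_)
      (prodPr_lower_tail hp hlip hs)))
    have h1 : f x ≤ hammingDist x x := Finset.inf'_le _ (Set.mem_toFinset.2 hx)
    rw [hammingDist_self, Nat.cast_zero] at h1
    show f x ≤ _
    linarith
  refine le_trans (hp.prodPr_mono fun x hx => ?_) (prodPr_upper_tail hp hlip hs)
  have : 2 * s * n ≤ f x := (Finset.le_inf'_iff _ _).2 fun y hy => hx y (Set.mem_toFinset.1 hy)
  show _ ≤ f x
  linarith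

lemma sum_pow_hammingDist_le (y : Fin n → J) {z : ℝ} (hz : 0 ≤ z) :
    ∑ x : Fin n → J, z ^ hammingDist x y ≤ (1 + Fintype.card J * z) ^ n := by
  have h1 : ∀ x : Fin n → J, z ^ hammingDist x y = ∏ i, if x i ≠ y i then z else 1 := fun x => by
    rw [hammingDist, Finset.prod_ite, Finset.prod_const, Finset.prod_const_one, mul_one]
  simp only [h1]
  have h2 := Finset.prod_univ_sum (fun _ : Fin n => (univ : Finset J))
    (fun i j => if j ≠ y i then z else 1)
  rw [Fintype.piFinset_univ] at h2
  rw [← h2]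
  calc _ ≤ ∏ _i : Fin n, (1 + Fintype.card J * z) := by
        refine Finset.prod_le_prod (fun i _ => Finset.sum_nonneg fun j _ => ?_) fun i _ => ?_
        · split_ifs <;> positivity
        · calc _ ≤ ∑ j, ((if j = y i then 1 else 0) + z) := Finset.sum_le_sum fun j _ => by
                by_cases h : j = y i <;> simp [h, hz]
            _ = _ := by simp [Finset.sum_add_distrib]
    _ = _ := by simp

lemma prodWt_mul_pow_le {q : Fin n → J → ℝ} (hq : IsWeights q) {κ : ℝ} (hκ : 0 ≤ κ)
    (hκq : ∀ i j, κ ≤ q i j) (x y : Fin n → J) :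
    prodWt q x * κ ^ hammingDist x y ≤ prodWt q y := by
  have h1 : κ ^ hammingDist x y = ∏ i, if x i ≠ y i then κ else 1 := by
    rw [hammingDist, Finset.prod_ite, Finset.prod_const, Finset.prod_const_one, mul_one]
  rw [h1, prodWt, prodWt, ← Finset.prod_mul_distrib]
  refine Finset.prod_le_prod (fun i _ => mul_nonneg (hq.nonneg _ _) ?_) fun i _ => ?_
  · split_ifs <;> linarith
  · by_cases h : x i = y i
    · simp [h]
    · have hq1 : q i (x i) ≤ 1 := by
        rw [← hq.sum_one i]
        exact Finset.single_le_sum (fun j _ => hq.nonneg i j) (mem_univ _)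
      simp only [ne_eq, h, not_false_eq_true, if_true]
      exact (mul_le_of_le_one_left hκ hq1).trans (hκq i _)

/-- The neighbourhood of a set is not much larger than the set itself. -/
theorem prodPr_nhds_le {q : Fin n → J → ℝ} (hq : IsWeights q) {κ z : ℝ} (hκ : 0 < κ)
    (hκq : ∀ i j, κ ≤ q i j) (hz : 0 < z) (hκz : κ * z ≤ 1) (Q : Set (Fin n → J)) (r : ℕ) :
    prodPr q {x | ∃ y ∈ Q, hammingDist x y ≤ r} * (κ * z) ^ r ≤
      prodPr q Q * (1 + Fintype.card J * z) ^ n := by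
  classical
  have h1 : prodPr q {x | ∃ y ∈ Q, hammingDist x y ≤ r} * (κ * z) ^ r ≤
      ∑ y, Q.indicator (fun y => ∑ x, prodWt q x * (κ * z) ^ hammingDist x y) y := by
    have : ∑ y, Q.indicator (fun y => ∑ x, prodWt q x * (κ * z) ^ hammingDist x y) y =
        ∑ x, ∑ y, Q.indicator (fun y => prodWt q x * (κ * z) ^ hammingDist x y) y := by
      rw [Finset.sum_comm]
      refine Finset.sum_congr rfl fun y _ => ?_
      by_cases hy : y ∈ Q <;> simp [hy]
    rw [this, prodPr, Finset.sum_mul]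
    refine Finset.sum_le_sum fun x _ => ?_
    have hnn : ∀ y, 0 ≤ Q.indicator (fun y => prodWt q x * (κ * z) ^ hammingDist x y) y :=
      fun y => Set.indicator_nonneg (fun y _ => mul_nonneg (hq.prodWt_nonneg x) (by positivity)) y
    by_cases hx : ∃ y ∈ Q, hammingDist x y ≤ r
    · obtain ⟨y, hy, hr⟩ := hx
      rw [Set.indicator_of_mem (show x ∈ {x | ∃ y ∈ Q, hammingDist x y ≤ r} from ⟨y, hy, hr⟩)]
      refine le_trans ?_ (Finset.single_le_sum (fun y _ => hnn y) (mem_univ y))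
      rw [Set.indicator_of_mem hy]
      exact mul_le_mul_of_nonneg_left (pow_le_pow_of_le_one (by positivity) hκz hr)
        (hq.prodWt_nonneg x)
    · rw [Set.indicator_of_notMem (show x ∉ {x | ∃ y ∈ Q, hammingDist x y ≤ r} from hx), zero_mul]
      exact Finset.sum_nonneg fun y _ => hnn y
  refine h1.trans ?_
  rw [prodPr, Finset.sum_mul]
  refine Finset.sum_le_sum fun y _ => ?_
  by_cases hy : y ∈ Q
  · rw [Set.indicator_of_mem hy, Set.indicator_of_mem hy]
    calc _ ≤ ∑ x, prodWt q y * z ^ hammingDist x y := Finset.sum_le_sum fun x _ => by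
          rw [mul_pow, ← mul_assoc]
          exact mul_le_mul_of_nonneg_right (prodWt_mul_pow_le hq hκ.le hκq x y) (by positivity)
      _ ≤ _ := by
          rw [← Finset.mul_sum]
          exact mul_le_mul_of_nonneg_left (sum_pow_hammingDist_le y hz.le) (hq.prodWt_nonneg y)
  · simp [hy]

/-- Hamming balls are small. -/
theorem card_ball_mul_pow_le (y : Fin n → J) {z : ℝ} (hz : 0 < z) (hz1 : z ≤ 1) (r : ℕ) :
    (((univ : Finset (Fin n → J)).filter fun x => hammingDist x y ≤ r).card : ℝ) * z ^ r ≤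
      (1 + Fintype.card J * z) ^ n := by
  refine le_trans ?_ (sum_pow_hammingDist_le y hz.le)
  rw [← nsmul_eq_mul, ← Finset.sum_const]
  calc _ ≤ ∑ x ∈ (univ : Finset (Fin n → J)).filter fun x => hammingDist x y ≤ r,
        z ^ hammingDist x y := Finset.sum_le_sum fun x hx =>
          pow_le_pow_of_le_one hz.le hz1 (Finset.mem_filter.1 hx).2
    _ ≤ _ := Finset.sum_le_sum_of_subset_of_nonneg (Finset.subset_univ _)
        fun x _ _ => by positivity

end

section

variable {n : ℕ} {J : Type*} [Fintype J]

lemma prodWt_le_pow_mul {q q' : Fin n → J → ℝ} (hq' : IsWeights q') {c : ℝ}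
    (h : ∀ i j, q' i j ≤ c * q i j) (x : Fin n → J) : prodWt q' x ≤ c ^ n * prodWt q x := by
  calc prodWt q' x ≤ ∏ i, (c * q i (x i)) :=
        Finset.prod_le_prod (fun i _ => hq'.nonneg _ _) fun i _ => h _ _
    _ = _ := by rw [Finset.prod_mul_distrib]; simp [prodWt]

lemma prodPr_le_pow_mul {q q' : Fin n → J → ℝ} (hq' : IsWeights q') {c : ℝ}
    (h : ∀ i j, q' i j ≤ c * q i j) (S : Set (Fin n → J)) :
    prodPr q' S ≤ c ^ n * prodPr q S := by
  rw [prodPr, prodPr, Finset.mul_sum]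
  refine Finset.sum_le_sum fun x _ => ?_
  by_cases hx : x ∈ S
  · simpa [hx] using prodWt_le_pow_mul hq' h x
  · simp [hx]

lemma prodPr_eq_sum_prodPr_piecewise {p : Fin n → J → ℝ} (hp : IsWeights p)
    (U : Finset (Fin n)) (A : Set (Fin n → J)) :
    prodPr p A = ∑ s, prodWt p s * prodPr p {a | U.piecewise s a ∈ A} := by
  classical
  set e : (Fin n → J) × (Fin n → J) → (Fin n → J) × (Fin n → J) :=
    fun x => (U.piecewise x.2 x.1, U.piecewise x.1 x.2) with he
  have hinv : Function.Involutive e := fun x => by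
    ext i <;> by_cases hi : i ∈ U <;> simp [he, Finset.piecewise, hi]
  have hwt : ∀ x, prodWt p (e x).1 * prodWt p (e x).2 = prodWt p x.1 * prodWt p x.2 := fun x => by
    simp only [prodWt, ← Finset.prod_mul_distrib]
    refine Finset.prod_congr rfl fun i _ => ?_
    by_cases hi : i ∈ U
    · simp [he, Finset.piecewise, hi, mul_comm]
    · simp [he, Finset.piecewise, hi]
  have h1 : prodPr p A =
      ∑ x : (Fin n → J) × (Fin n → J), prodWt p x.1 * prodWt p x.2 * A.indicator 1 x.1 := by
    rw [Fintype.sum_prod_type, prodPr]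
    refine Finset.sum_congr rfl fun a _ => ?_
    simp only [← Finset.sum_mul, ← Finset.mul_sum, hp.sum_prodWt]
    by_cases ha : a ∈ A <;> simp [ha]
  have h2 : ∑ s, prodWt p s * prodPr p {a | U.piecewise s a ∈ A} =
      ∑ x : (Fin n → J) × (Fin n → J), prodWt p x.1 * prodWt p x.2 * A.indicator 1 (e x).1 := by
    rw [Fintype.sum_prod_type_right]
    refine Finset.sum_congr rfl fun s _ => ?_
    rw [prodPr, Finset.mul_sum]
    refine Finset.sum_congr rfl fun a _ => ?_
    by_cases ha : U.piecewise s a ∈ A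
    · rw [Set.indicator_of_mem (show a ∈ {a | U.piecewise s a ∈ A} from ha),
        Set.indicator_of_mem (show (e (a, s)).1 ∈ A from ha)]
      simp [mul_comm]
    · rw [Set.indicator_of_notMem (show a ∉ {a | U.piecewise s a ∈ A} from ha),
        Set.indicator_of_notMem (show (e (a, s)).1 ∉ A from ha)]
      simp
  rw [h1, h2, ← Equiv.sum_comp (hinv.toPerm e) fun x : (Fin n → J) × (Fin n → J) =>
    prodWt p x.1 * prodWt p x.2 * A.indicator 1 x.1]
  refine Finset.sum_congr rfl fun x _ => ?_
  simp only [Function.Involutive.coe_toPerm, hwt]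

lemma prodPr_agree [DecidableEq J] {p : Fin n → J → ℝ} (hp : IsWeights p)
    (U : Finset (Fin n)) (s₀ : Fin n → J) :
    prodPr p {s | ∀ i ∈ U, s i = s₀ i} = ∏ i ∈ U, p i (s₀ i) := by
  classical
  have h1 : ∀ s : Fin n → J, ({s | ∀ i ∈ U, s i = s₀ i} : Set (Fin n → J)).indicator (prodWt p) s =
      ∏ i, if i ∈ U → s i = s₀ i then p i (s i) else 0 := fun s => by
    by_cases hs : ∀ i ∈ U, s i = s₀ i
    · rw [Set.indicator_of_mem (show s ∈ {s | ∀ i ∈ U, s i = s₀ i} from hs)]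
      exact Finset.prod_congr rfl fun i _ => (if_pos (hs i)).symm
    · rw [Set.indicator_of_notMem (show s ∉ {s | ∀ i ∈ U, s i = s₀ i} from hs)]
      push Not at hs
      obtain ⟨i, hi, hne⟩ := hs
      exact (Finset.prod_eq_zero (mem_univ i) (if_neg fun h => hne (h hi))).symm
  rw [prodPr]
  simp only [h1]
  have h2 := Finset.prod_univ_sum (fun _ : Fin n => (univ : Finset J))
    (fun i j => if i ∈ U → j = s₀ i then p i j else 0)
  rw [Fintype.piFinset_univ] at h2
  rw [← h2, ← Finset.prod_subset (Finset.subset_univ U)]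
  · refine Finset.prod_congr rfl fun i hi => ?_
    simp [hi]
  · intro i _ hi
    simp [hi, hp.sum_one]

end

section

variable {n D : ℕ}

/-- The contribution of the coordinates in `U` to the intersection `bCap v a b`. -/
def capOn (v : Fin n → Fin D → ℤ) (U : Finset (Fin n)) (a b : Fin n → Bool) : Fin D → ℤ :=
  fun d => ∑ i ∈ U, if a i ∧ b i then v i d else 0

/-- Every pair from `A' × B'` can be modified on `U` to a pair from `A × B` so that
the contribution of `U` to the intersection is any prescribed element of `Y`. -/
def Reach (v : Fin n → Fin D → ℤ) (A B : Set (Fin n → Bool)) (U : Finset (Fin n))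
    (A' B' : Set (Fin n → Bool)) (Y : Set (Fin D → ℤ)) : Prop :=
  ∀ a ∈ A', ∀ b ∈ B', ∀ y ∈ Y, ∃ a₁ ∈ A, ∃ b₁ ∈ B,
    (∀ i ∉ U, a₁ i = a i ∧ b₁ i = b i) ∧ capOn v U a₁ b₁ = y

variable {v : Fin n → Fin D → ℤ} {A B : Set (Fin n → Bool)}

lemma Reach.comp {U U₁ : Finset (Fin n)} {A₁ B₁ A₂ B₂ : Set (Fin n → Bool)}
    {Y Y₁ Y₂ : Set (Fin D → ℤ)} (h : Reach v A B U A₁ B₁ Y) (h₁ : Reach v A₁ B₁ U₁ A₂ B₂ Y₁)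
    (hU : Disjoint U U₁) (hY : ∀ y ∈ Y₂, ∃ y₀ ∈ Y, ∃ y₁ ∈ Y₁, y = y₀ + y₁) :
    Reach v A B (U ∪ U₁) A₂ B₂ Y₂ := by
  intro a ha b hb y hy
  obtain ⟨y₀, hy₀, y₁, hy₁, rfl⟩ := hY y hy
  obtain ⟨a₁, ha₁, b₁, hb₁, heq₁, hc₁⟩ := h₁ a ha b hb y₁ hy₁
  obtain ⟨a₀, ha₀, b₀, hb₀, heq₀, hc₀⟩ := h a₁ ha₁ b₁ hb₁ y₀ hy₀
  refine ⟨a₀, ha₀, b₀, hb₀, fun i hi => ?_, ?_⟩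
  · rw [Finset.mem_union, not_or] at hi
    exact ⟨(heq₀ i hi.1).1.trans (heq₁ i hi.2).1, (heq₀ i hi.1).2.trans (heq₁ i hi.2).2⟩
  · rw [← hc₀, ← hc₁]
    funext d
    simp only [capOn, Pi.add_apply]
    rw [Finset.sum_union hU]
    congr 1
    refine Finset.sum_congr rfl fun i hi => ?_
    have hi' : i ∉ U := Finset.disjoint_right.1 hU hi
    rw [(heq₀ i hi').1, (heq₀ i hi').2]

lemma prodPr_section_ge {p : Fin n → Bool → ℝ} (hp : IsWeights p) {κ : ℝ} (hκ : 0 < κ)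
    (hκ1 : κ ≤ 1) (hκp : ∀ i j, κ ≤ p i j) {k : ℕ} {U : Finset (Fin n)} (hU : U.card ≤ k) {β : ℝ}
    (h : ∀ s, prodPr p {a | U.piecewise s a ∈ A} ≤ (1 + β) * prodPr p A) (hβ : 0 ≤ β)
    (s₀ : Fin n → Bool) :
    (1 - β / κ ^ k) * prodPr p A ≤ prodPr p {a | U.piecewise s₀ a ∈ A} := by
  set x := prodPr p {a | U.piecewise s₀ a ∈ A} with hx
  set G : Set (Fin n → Bool) := {s | ∀ i ∈ U, s i = s₀ i} with hG
  have hπ : κ ^ k ≤ prodPr p G := by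
    rw [hG, prodPr_agree hp]
    calc κ ^ k ≤ κ ^ U.card := pow_le_pow_of_le_one hκ.le hκ1 hU
      _ = ∏ _i ∈ U, κ := (Finset.prod_const κ).symm
      _ ≤ _ := Finset.prod_le_prod (fun _ _ => hκ.le) fun i _ => hκp _ _
  have hsum : prodPr p A ≤ (1 + β) * prodPr p A - prodPr p G * ((1 + β) * prodPr p A - x) := by
    have h1 : prodPr p A ≤ ∑ s, (prodWt p s * ((1 + β) * prodPr p A) -
        G.indicator (prodWt p) s * ((1 + β) * prodPr p A - x)) := by
      conv_lhs => rw [prodPr_eq_sum_prodPr_piecewise hp U A]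
      refine Finset.sum_le_sum fun s _ => ?_
      by_cases hs : s ∈ G
      · have : ∀ a : Fin n → Bool, U.piecewise s a = U.piecewise s₀ a := fun a => by
          funext i
          by_cases hi : i ∈ U
          · simp [hi, hs i hi]
          · simp [hi]
        simp only [this]
        rw [Set.indicator_of_mem hs, ← hx]
        linarith
      · rw [Set.indicator_of_notMem hs, zero_mul, sub_zero]
        exact mul_le_mul_of_nonneg_left (h s) (hp.prodWt_nonneg s)
    rwa [Finset.sum_sub_distrib, ← Finset.sum_mul, ← Finset.sum_mul, hp.sum_prodWt,
      one_mul] at h1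
  have hc : 0 < κ ^ k := by positivity
  have h2 : κ ^ k * ((1 + β) * prodPr p A - x) ≤ β * prodPr p A := by
    have := mul_le_mul_of_nonneg_right hπ (sub_nonneg.2 (h s₀))
    linarith
  have h3 : (1 + β) * prodPr p A - x ≤ β / κ ^ k * prodPr p A := by
    rw [div_mul_eq_mul_div, le_div_iff₀ hc]; linarith
  have := mul_nonneg hβ (hp.prodPr_nonneg A)
  linarith

lemma exists_prodPr_section_ge {p : Fin n → Bool → ℝ} (hp : IsWeights p) {κ : ℝ} (hκ : 0 < κ)
    (hκp : ∀ i j, κ ≤ p i j) (U : Finset (Fin n)) (A : Set (Fin n → Bool)) :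
    ∃ s, prodPr p A ≤ prodPr p {a | U.piecewise s a ∈ A} := by
  have h : ∑ s, prodWt p s * prodPr p A ≤
      ∑ s, prodWt p s * prodPr p {a | U.piecewise s a ∈ A} := by
    rw [← prodPr_eq_sum_prodPr_piecewise hp, ← Finset.sum_mul, hp.sum_prodWt, one_mul]
  obtain ⟨s, -, hs⟩ := Finset.exists_le_of_sum_le Finset.univ_nonempty h
  exact ⟨s, le_of_mul_le_mul_left hs (Finset.prod_pos fun i _ => hκ.trans_le (hκp _ _))⟩

lemma reach_piecewise (U : Finset (Fin n)) (s s' : Fin n → Bool) :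
    Reach v A B U {a | U.piecewise s a ∈ A} {b | U.piecewise s' b ∈ B} {capOn v U s s'} := by
  intro a ha b hb y hy
  refine ⟨_, ha, _, hb, fun i hi => by simp [hi], ?_⟩
  rw [Set.mem_singleton_iff] at hy
  rw [hy]
  funext d
  exact Finset.sum_congr rfl fun i hi => by simp [hi]

/-- One step of the density increment argument. -/
lemma reach_step {p : Fin n → Bool → ℝ} (hp : IsWeights p) {κ : ℝ} (hκ : 0 < κ)
    (hκ1 : κ ≤ 1) (hκp : ∀ i j, κ ≤ p i j) {k : ℕ} {β : ℝ} (hβ : 0 < β)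
    (hβκ : 6 * β ≤ κ ^ k) {S S' : Finset (Fin n)}
    (hk : (S ∪ S').card ≤ k) {u : Fin D → ℤ} (hu : ∀ d, u d = ∑ i ∈ S, v i d - ∑ i ∈ S', v i d) :
    (∃ A' B' y, Reach v A B (S ∪ S') A' B' {y} ∧
      (1 + β) * (prodPr p A * prodPr p B) ≤ prodPr p A' * prodPr p B') ∨
    (∃ A' B' y, Reach v A B (S ∪ S') A' B' {y, y + u} ∧
      (1 - 6 * β / κ ^ k) * (prodPr p A * prodPr p B) ≤ prodPr p A' * prodPr p B') := by
  set U := S ∪ S' with hU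
  have hA0 := hp.prodPr_nonneg A
  have hB0 := hp.prodPr_nonneg B
  by_cases hincA : ∃ s, (1 + β) * prodPr p A ≤ prodPr p {a | U.piecewise s a ∈ A}
  · left
    obtain ⟨s, hs⟩ := hincA
    obtain ⟨s', hs'⟩ := exists_prodPr_section_ge hp hκ hκp U B
    refine ⟨_, _, _, reach_piecewise U s s', ?_⟩
    rw [← mul_assoc]
    exact mul_le_mul hs hs' hB0 (hp.prodPr_nonneg _)
  by_cases hincB : ∃ s, (1 + β) * prodPr p B ≤ prodPr p {a | U.piecewise s a ∈ B}
  · left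
    obtain ⟨s', hs'⟩ := hincB
    obtain ⟨s, hs⟩ := exists_prodPr_section_ge hp hκ hκp U A
    refine ⟨_, _, _, reach_piecewise U s s', ?_⟩
    rw [mul_left_comm]
    exact mul_le_mul hs hs' (by positivity) (hp.prodPr_nonneg _)
  push Not at hincA hincB
  have hA := prodPr_section_ge hp hκ hκ1 hκp hk (fun s => (hincA s).le) hβ.le
  have hB := prodPr_section_ge hp hκ hκ1 hκp hk (fun s => (hincB s).le) hβ.le
  have hc : 0 < κ ^ k := by positivity
  have hc1 : κ ^ k ≤ 1 := pow_le_one₀ hκ.le hκ1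
  set η := β / κ ^ k with hη
  have hη0 : 0 < η := by positivity
  have hβη : β ≤ η := by
    rw [hη, le_div_iff₀ hc]; nlinarith
  have hη6 : 6 * η ≤ 1 := by
    rw [hη, ← mul_div_assoc, div_le_one hc]; exact hβκ
  have h6 : 6 * β / κ ^ k = 6 * η := by rw [hη, mul_div_assoc]
  set A₁ : Set (Fin n → Bool) := {a | U.piecewise (fun i => decide (i ∈ S)) a ∈ A} with hA₁
  set A₀ : Set (Fin n → Bool) := {a | U.piecewise (fun i => decide (i ∈ S')) a ∈ A} with hA₀
  have hui := prodPr_union_add_inter p A₁ A₀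
  have h1 := hA fun i => decide (i ∈ S)
  have h0 := hA fun i => decide (i ∈ S')
  rw [← hA₁] at h1
  rw [← hA₀] at h0
  rw [h6]
  by_cases hun : (1 + 3 * η) * prodPr p A ≤ prodPr p (A₁ ∪ A₀)
  · left
    refine ⟨A₁ ∪ A₀, {b | U.piecewise (fun _ => false) b ∈ B}, 0, ?_, ?_⟩
    · intro a ha b hb y hy
      rw [Set.mem_singleton_iff] at hy
      subst hy
      have hz : ∀ s, capOn v U (U.piecewise s a) (U.piecewise (fun _ => false) b) = 0 := fun s => by
        funext d
        exact Finset.sum_eq_zero fun i hi => by simp [hi]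
      rcases ha with ha | ha
      · exact ⟨_, ha, _, hb, fun i hi => by simp [hi], hz _⟩
      · exact ⟨_, ha, _, hb, fun i hi => by simp [hi], hz _⟩
    · have h2 := mul_le_mul hun (hB fun _ => false) (mul_nonneg (by linarith) hB0)
        (hp.prodPr_nonneg _)
      refine le_trans ?_ h2
      have : (1 + β) ≤ (1 + 3 * η) * (1 - η) := by nlinarith
      calc _ ≤ ((1 + 3 * η) * (1 - η)) * (prodPr p A * prodPr p B) :=
            mul_le_mul_of_nonneg_right this (mul_nonneg hA0 hB0)
        _ = _ := by ring
  · right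
    rw [not_le] at hun
    have hin : (1 - 5 * η) * prodPr p A ≤ prodPr p (A₁ ∩ A₀) := by linarith
    have hcap : ∀ (T : Finset (Fin n)) (_ : T ⊆ U) (a b : Fin n → Bool),
        capOn v U (U.piecewise (fun i => decide (i ∈ T)) a) (U.piecewise (fun _ => true) b) =
          fun d => ∑ i ∈ T, v i d := fun T hT a b => by
      funext d
      rw [capOn, ← Finset.sum_subset hT]
      · exact Finset.sum_congr rfl fun i hi => by simp [hi, hT hi]
      · intro i hi hiT
        simp [hi, hiT]
    refine ⟨A₁ ∩ A₀, {b | U.piecewise (fun _ => true) b ∈ B}, fun d => ∑ i ∈ S', v i d, ?_, ?_⟩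
    · intro a ha b hb y hy
      rcases hy with hy | hy
      · refine ⟨_, ha.2, _, hb, fun i hi => by simp [hi], ?_⟩
        rw [hcap S' Finset.subset_union_right, hy]
      · refine ⟨_, ha.1, _, hb, fun i hi => by simp [hi], ?_⟩
        rw [hcap S Finset.subset_union_left, hy]
        funext d
        rw [Pi.add_apply, hu d]; ring
    · have h2 := mul_le_mul hin (hB fun _ => true) (mul_nonneg (by linarith) hB0)
        (hp.prodPr_nonneg _)
      refine le_trans ?_ h2
      have : (1 - 6 * η) ≤ (1 - 5 * η) * (1 - η) := by nlinarith
      calc _ ≤ ((1 - 5 * η) * (1 - η)) * (prodPr p A * prodPr p B) :=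
            mul_le_mul_of_nonneg_right this (mul_nonneg hA0 hB0)
        _ = _ := by ring

lemma reach_refl : Reach v A B ∅ A B {0} := fun a ha b hb y hy =>
  ⟨a, ha, b, hb, fun _ _ => ⟨rfl, rfl⟩, by
    rw [Set.mem_singleton_iff.1 hy]; funext d; simp [capOn]⟩

/-- The density increment argument for many blocks of the same type. -/
lemma reach_blocks {p : Fin n → Bool → ℝ} (hp : IsWeights p) {κ : ℝ} (hκ : 0 < κ)
    (hκ1 : κ ≤ 1) (hκp : ∀ i j, κ ≤ p i j) {k : ℕ} {β : ℝ} (hβ : 0 < β)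
    (hβκ : 6 * β ≤ κ ^ k) {L m : ℕ} {S S' : ℕ → Finset (Fin n)}
    (hk : ∀ j < L, (S j ∪ S' j).card ≤ k) {u : Fin D → ℤ}
    (hu : ∀ j < L, ∀ d, u d = ∑ i ∈ S j, v i d - ∑ i ∈ S' j, v i d)
    (hdis : ∀ j < L, ∀ j' < L, j ≠ j' → Disjoint (S j ∪ S' j) (S j' ∪ S' j'))
    (hbig : 1 < (1 + β) ^ (L - m) *
      ((1 - 6 * β / κ ^ k) ^ m * (prodPr p A * prodPr p B))) :
    ∃ A' B' U c, U ⊆ (range L).biUnion (fun j => S j ∪ S' j) ∧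
      Reach v A B U A' B' {y | ∃ f ≤ m, y = c + (f : ℤ) • u} ∧
      (1 - 6 * β / κ ^ k) ^ m * (prodPr p A * prodPr p B) ≤ prodPr p A' * prodPr p B' := by
  set φ := prodPr p A * prodPr p B with hφ
  set b := 1 - 6 * β / κ ^ k with hb
  have hc : 0 < κ ^ k := by positivity
  have hb0 : 0 ≤ b := by
    rw [hb, sub_nonneg, div_le_one hc]; exact hβκ
  have hb1 : b ≤ 1 := by
    rw [hb]; linarith [show 0 ≤ 6 * β / κ ^ k by positivity]
  have hφ0 : 0 ≤ φ := mul_nonneg (hp.prodPr_nonneg _) (hp.prodPr_nonneg _)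
  have main : ∀ J ≤ L, ∃ A' B' U c, ∃ g : ℕ, U ⊆ (range J).biUnion (fun j => S j ∪ S' j) ∧
      Reach v A B U A' B' {y | ∃ f ≤ g, y = c + (f : ℤ) • u} ∧
      ((g = m ∧ b ^ m * φ ≤ prodPr p A' * prodPr p B') ∨
       (g < m ∧ g ≤ J ∧ (1 + β) ^ (J - g) * (b ^ g * φ) ≤ prodPr p A' * prodPr p B')) := by
    intro J
    induction J with
    | zero =>
      intro _
      refine ⟨A, B, ∅, 0, 0, Finset.empty_subset _, ?_, ?_⟩
      · convert reach_refl using 1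
        ext y; simp
      · rcases Nat.eq_zero_or_pos m with h | h
        · left; simp [h, hφ]
        · right; simp [h, hφ]
    | succ J ih =>
      intro hJ
      obtain ⟨A₁, B₁, U, c, g, hU, hR, hcase⟩ := ih (by omega)
      have hsub : (range J).biUnion (fun j => S j ∪ S' j) ⊆
          (range (J + 1)).biUnion (fun j => S j ∪ S' j) :=
        Finset.biUnion_subset_biUnion_of_subset_left _ (Finset.range_mono (by omega))
      have hsub' : S J ∪ S' J ⊆ (range (J + 1)).biUnion (fun j => S j ∪ S' j) :=
        Finset.subset_biUnion_of_mem (fun j => S j ∪ S' j) (Finset.self_mem_range_succ J)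
      rcases hcase with ⟨rfl, h⟩ | ⟨hgm, hgJ, h⟩
      · exact ⟨A₁, B₁, U, c, g, hU.trans hsub, hR, Or.inl ⟨rfl, h⟩⟩
      have hUd : Disjoint U (S J ∪ S' J) := by
        refine Finset.disjoint_of_subset_left hU ?_
        rw [Finset.disjoint_biUnion_left]
        intro j hj
        rw [Finset.mem_range] at hj
        exact hdis j (by omega) J (by omega) (by omega)
      have hJL : J < L := by omega
      rcases reach_step (v := v) (A := A₁) (B := B₁) hp hκ hκ1 hκp hβ hβκ (hk J hJL)
        (hu J hJL) with ⟨A₂, B₂, y, hR₂, hφ₂⟩ | ⟨A₂, B₂, y, hR₂, hφ₂⟩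
      · refine ⟨A₂, B₂, U ∪ (S J ∪ S' J), c + y, g,
          Finset.union_subset (hU.trans hsub) hsub', hR.comp hR₂ hUd ?_, Or.inr ⟨hgm, by omega, ?_⟩⟩
        · rintro _ ⟨f, hf, rfl⟩
          exact ⟨_, ⟨f, hf, rfl⟩, y, rfl, by abel⟩
        · refine le_trans ?_ hφ₂
          rw [show J + 1 - g = (J - g) + 1 by omega, pow_succ' (1 + β), mul_assoc]
          exact mul_le_mul_of_nonneg_left h (by linarith)
      · have h3 : (1 + β) ^ (J - g) * (b ^ (g + 1) * φ) ≤ prodPr p A₂ * prodPr p B₂ := by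
          refine le_trans ?_ hφ₂
          calc _ = b * ((1 + β) ^ (J - g) * (b ^ g * φ)) := by ring
            _ ≤ _ := mul_le_mul_of_nonneg_left h hb0
        refine ⟨A₂, B₂, U ∪ (S J ∪ S' J), c + y, g + 1,
          Finset.union_subset (hU.trans hsub) hsub', hR.comp hR₂ hUd ?_, ?_⟩
        · rintro _ ⟨f, hf, rfl⟩
          rcases Nat.lt_or_ge g f with hgf | hgf
          · refine ⟨_, ⟨g, le_rfl, rfl⟩, y + u, Or.inr rfl, ?_⟩
            obtain rfl : f = g + 1 := by omega
            push_cast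
            rw [add_smul, one_smul]; abel
          · exact ⟨_, ⟨f, hgf, rfl⟩, y, Or.inl rfl, by abel⟩
        · rcases Nat.lt_or_ge (g + 1) m with hm | hm
          · right
            refine ⟨hm, by omega, ?_⟩
            rwa [show J + 1 - (g + 1) = J - g by omega]
          · left
            obtain rfl : g + 1 = m := by omega
            refine ⟨rfl, le_trans ?_ h3⟩
            exact le_mul_of_one_le_left (by positivity) (one_le_pow₀ (by linarith))
  obtain ⟨A', B', U, c, g, hU, hR, ⟨rfl, h⟩ | ⟨hgm, hgL, h⟩⟩ := main L le_rfl
  · exact ⟨A', B', U, c, hU, hR, h⟩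
  · exfalso
    have h1 : prodPr p A' * prodPr p B' ≤ 1 :=
      mul_le_one₀ (hp.prodPr_le_one _) (hp.prodPr_nonneg _) (hp.prodPr_le_one _)
    have h2 : (1 + β) ^ (L - m) * (b ^ m * φ) ≤ (1 + β) ^ (L - g) * (b ^ g * φ) := by
      refine mul_le_mul (pow_le_pow_right₀ (by linarith) (by omega))
        (mul_le_mul_of_nonneg_right (pow_le_pow_of_le_one hb0 hb1 hgm.le) hφ0)
        (by positivity) (by positivity)
    linarith

/-- The density increment argument for blocks of several types. -/
theorem reach_types {p : Fin n → Bool → ℝ} (hp : IsWeights p) {κ : ℝ} (hκ : 0 < κ)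
    (hκ1 : κ ≤ 1) (hκp : ∀ i j, κ ≤ p i j) {k : ℕ} {β : ℝ} (hβ : 0 < β)
    (hβκ : 6 * β ≤ κ ^ k) {τ : Type*} [Fintype τ] {L m : ℕ} {S S' : τ → ℕ → Finset (Fin n)}
    (hk : ∀ t, ∀ j < L, (S t j ∪ S' t j).card ≤ k) {u : τ → Fin D → ℤ}
    (hu : ∀ t, ∀ j < L, ∀ d, u t d = ∑ i ∈ S t j, v i d - ∑ i ∈ S' t j, v i d)
    (hdis : ∀ t, ∀ j < L, ∀ t', ∀ j' < L, (t, j) ≠ (t', j') →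
      Disjoint (S t j ∪ S' t j) (S t' j' ∪ S' t' j'))
    (hbig : 1 < (1 + β) ^ (L - m) *
      ((1 - 6 * β / κ ^ k) ^ (m * Fintype.card τ) * (prodPr p A * prodPr p B))) :
    ∃ A' B' U c, U ⊆ (univ : Finset τ).biUnion (fun t => (range L).biUnion
        (fun j => S t j ∪ S' t j)) ∧
      Reach v A B U A' B' {y | ∃ f : τ → ℕ, (∀ t, f t ≤ m) ∧ y = c + ∑ t, (f t : ℤ) • u t} ∧
      (1 - 6 * β / κ ^ k) ^ (m * Fintype.card τ) * (prodPr p A * prodPr p B) ≤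
        prodPr p A' * prodPr p B' := by
  classical
  set φ := prodPr p A * prodPr p B with hφ
  set b := 1 - 6 * β / κ ^ k with hb
  have hc : 0 < κ ^ k := by positivity
  have hb0 : 0 ≤ b := by
    rw [hb, sub_nonneg, div_le_one hc]; exact hβκ
  have hb1 : b ≤ 1 := by
    rw [hb]; linarith [show 0 ≤ 6 * β / κ ^ k by positivity]
  have hφ0 : 0 ≤ φ := mul_nonneg (hp.prodPr_nonneg _) (hp.prodPr_nonneg _)
  have main : ∀ Θ : Finset τ, ∃ A' B' U c, U ⊆ Θ.biUnion (fun t => (range L).biUnion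
        (fun j => S t j ∪ S' t j)) ∧
      Reach v A B U A' B' {y | ∃ f : τ → ℕ, (∀ t, f t ≤ m) ∧ y = c + ∑ t ∈ Θ, (f t : ℤ) • u t} ∧
      b ^ (m * Θ.card) * φ ≤ prodPr p A' * prodPr p B' := by
    intro Θ
    induction Θ using Finset.induction with
    | empty =>
      refine ⟨A, B, ∅, 0, Finset.empty_subset _, ?_, by simp [hφ]⟩
      intro a ha b hb y hy
      refine reach_refl a ha b hb y ?_
      obtain ⟨f, -, rfl⟩ := hy
      simp
    | insert t Θ ht ih =>
      obtain ⟨A₁, B₁, U, c, hU, hR, h⟩ := ih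
      have hpow : b ^ (m * Fintype.card τ) * φ ≤ b ^ m * (prodPr p A₁ * prodPr p B₁) := by
        calc b ^ (m * Fintype.card τ) * φ ≤ b ^ (m + m * Θ.card) * φ := by
              refine mul_le_mul_of_nonneg_right (pow_le_pow_of_le_one hb0 hb1 ?_) hφ0
              have : (insert t Θ).card ≤ Fintype.card τ := Finset.card_le_univ _
              rw [Finset.card_insert_of_notMem ht] at this
              nlinarith
          _ = b ^ m * (b ^ (m * Θ.card) * φ) := by ring
          _ ≤ _ := mul_le_mul_of_nonneg_left h (by positivity)
      obtain ⟨A₂, B₂, U₂, c₂, hU₂, hR₂, h₂⟩ := reach_blocks (v := v) (A := A₁) (B := B₁)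
        hp hκ hκ1 hκp hβ hβκ (m := m) (hk t) (hu t)
        (fun j hj j' hj' hne => hdis t j hj t j' hj' fun h => hne (Prod.ext_iff.1 h).2)
        (hbig.trans_le (mul_le_mul_of_nonneg_left hpow (by positivity)))
      have hUd : Disjoint U U₂ := by
        refine Finset.disjoint_of_subset_left hU (Finset.disjoint_of_subset_right hU₂ ?_)
        rw [Finset.disjoint_biUnion_left]
        intro t' ht'
        rw [Finset.disjoint_biUnion_left]
        intro j hj
        rw [Finset.disjoint_biUnion_right]
        intro j' hj'
        refine hdis t' j (Finset.mem_range.1 hj) t j' (Finset.mem_range.1 hj') fun h => ?_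
        have h' : t' = t := (Prod.ext_iff.1 h).1
        exact ht (h' ▸ ht')
      refine ⟨A₂, B₂, U ∪ U₂, c + c₂, ?_, hR.comp hR₂ hUd ?_, ?_⟩
      · rw [Finset.biUnion_insert]
        exact Finset.union_subset (hU.trans Finset.subset_union_right)
          (hU₂.trans Finset.subset_union_left)
      · rintro _ ⟨f, hf, rfl⟩
        refine ⟨_, ⟨f, hf, rfl⟩, _, ⟨f t, hf t, rfl⟩, ?_⟩
        rw [Finset.sum_insert ht]; abel
      · refine le_trans ?_ h₂
        rw [Finset.card_insert_of_notMem ht]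
        calc b ^ (m * (Θ.card + 1)) * φ = b ^ m * (b ^ (m * Θ.card) * φ) := by ring
          _ ≤ _ := mul_le_mul_of_nonneg_left h (by positivity)
  exact main univ

end

section

variable {n D : ℕ} {R : Fin D → ℝ} {v : Fin n → Fin D → ℤ} {γ : ℝ} {k : ℕ}

lemma rnorm_le_one_iff (hR : ∀ d, 0 < R d) (x : Fin D → ℝ) : rnorm R x ≤ 1 ↔ ∀ d, |x d| ≤ R d := by
  unfold rnorm
  constructor
  · intro h d
    have := (le_ciSup (f := fun d => |x d| / R d) (Set.finite_range _).bddAbove d).trans h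
    rwa [div_le_one (hR d)] at this
  · intro h
    rcases isEmpty_or_nonempty (Fin D) with hD | hD
    · rw [Real.iSup_of_isEmpty]; norm_num
    · exact ciSup_le fun d => (div_le_one (hR d)).2 (h d)

lemma RobustlyGenerating.exists_blocks (hgen : RobustlyGenerating γ R k v) (hR : ∀ d, 0 < R d)
    {ι : Type*} (s : Finset ι) (u : ι → Fin D → ℤ) (hu : ∀ i d, |(u i d : ℝ)| ≤ R d)
    (T : Finset (Fin n)) (hT : (T.card : ℝ) + k * s.card ≤ γ * n) :
    ∃ S S' : ι → Finset (Fin n), (∀ i ∈ s, Disjoint (S i) (S' i) ∧ Disjoint (S i ∪ S' i) T ∧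
        (S i ∪ S' i).card ≤ k ∧ ∀ d, u i d = ∑ j ∈ S i, v j d - ∑ j ∈ S' i, v j d) ∧
      ∀ i ∈ s, ∀ j ∈ s, i ≠ j → Disjoint (S i ∪ S' i) (S j ∪ S' j) := by
  classical
  induction s using Finset.induction with
  | empty => exact ⟨fun _ => ∅, fun _ => ∅, by simp, by simp⟩
  | insert i s hi ih =>
    rw [Finset.card_insert_of_notMem hi] at hT
    push_cast at hT
    have hk0 : (0 : ℝ) ≤ k := Nat.cast_nonneg k
    obtain ⟨S, S', h₁, h₂⟩ := ih (by linarith)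
    set T' := T ∪ s.biUnion fun j => S j ∪ S' j with hT'
    have hcard : (T'.card : ℝ) ≤ γ * n := by
      have h3 : T'.card ≤ T.card + s.card * k :=
        (Finset.card_union_le _ _).trans (Nat.add_le_add_left
          (Finset.card_biUnion_le_card_mul _ _ _ fun j hj => (h₁ j hj).2.2.1) _)
      have h4 : (T'.card : ℝ) ≤ T.card + s.card * k := by exact_mod_cast h3
      linarith
    obtain ⟨V, V', hd, hdV, hdV', hc, hsum⟩ :=
      hgen (u i) ((rnorm_le_one_iff hR _).2 (hu i)) T' hcard
    have hVT : Disjoint (V ∪ V') T' := Finset.disjoint_union_left.2 ⟨hdV, hdV'⟩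
    have hVT₁ : Disjoint (V ∪ V') T := Finset.disjoint_of_subset_right Finset.subset_union_left hVT
    have hVS : ∀ j ∈ s, Disjoint (V ∪ V') (S j ∪ S' j) := fun j hj =>
      Finset.disjoint_of_subset_right ((Finset.subset_biUnion_of_mem
        (fun j => S j ∪ S' j) hj).trans Finset.subset_union_right) hVT
    have hne : ∀ j ∈ s, j ≠ i := fun j hj h => hi (h ▸ hj)
    refine ⟨Function.update S i V, Function.update S' i V', ?_, ?_⟩
    · intro j hj
      rcases Finset.mem_insert.1 hj with rfl | hj
      · simp only [Function.update_self]
        exact ⟨hd, hVT₁, (Finset.card_union_le _ _).trans hc, hsum⟩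
      · simp only [Function.update_of_ne (hne j hj)]
        exact h₁ j hj
    · intro j hj l hl hjl
      rcases Finset.mem_insert.1 hj with rfl | hj' <;> rcases Finset.mem_insert.1 hl with rfl | hl'
      · exact absurd rfl hjl
      · simp only [Function.update_self, Function.update_of_ne (hne l hl')]
        exact hVS l hl'
      · simp only [Function.update_self, Function.update_of_ne (hne j hj')]
        exact (hVS j hj').symm
      · simp only [Function.update_of_ne (hne l hl'), Function.update_of_ne (hne j hj')]
        exact h₂ j hj' l hl' hjl

/-- Greedy representation of a natural number in the scales `min (m ^ s) ρ`. -/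
lemma exists_sum_min_pow {m ρ : ℕ} (hρ : 1 ≤ ρ) (s u : ℕ) (hu : u ≤ m * min (m ^ s) ρ) :
    ∃ y : ℕ → ℕ, (∀ t, y t ≤ m) ∧ u = ∑ t ∈ range (s + 1), y t * min (m ^ t) ρ := by
  induction s generalizing u with
  | zero =>
    have h1 : min (m ^ 0) ρ = 1 := by simp [hρ]
    rw [h1, mul_one] at hu
    exact ⟨fun _ => u, fun _ => hu, by simp [hρ]⟩
  | succ s ih =>
    set r := min (m ^ (s + 1)) ρ with hr
    have hrle : r ≤ m * min (m ^ s) ρ := by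
      rcases Nat.eq_zero_or_pos m with rfl | hm
      · simp [hr]
      rw [← Nat.mul_min_mul_left, hr, pow_succ']
      exact min_le_min le_rfl (Nat.le_mul_of_pos_left _ hm)
    obtain ⟨q, hqm, hq, hrest⟩ : ∃ q ≤ m, q * r ≤ u ∧ u - q * r ≤ r := by
      rcases Nat.lt_or_ge (u / r) m with h | h
      · refine ⟨u / r, h.le, Nat.div_mul_le_self u r, ?_⟩
        rcases Nat.eq_zero_or_pos r with h0 | h0
        · rw [h0] at hu ⊢; omega
        · have := Nat.mod_lt u h0
          have h2 := Nat.div_add_mod u r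
          rw [mul_comm] at h2
          omega
      · have : m * r ≤ u := (Nat.mul_le_mul_right r h).trans (Nat.div_mul_le_self u r)
        exact ⟨m, le_rfl, this, by omega⟩
    obtain ⟨y, hy, hsum⟩ := ih (u - q * r) (hrest.trans hrle)
    refine ⟨Function.update y (s + 1) q, fun t => ?_, ?_⟩
    · by_cases ht : t = s + 1
      · subst ht; simpa using hqm
      · rw [Function.update_of_ne ht]; exact hy t
    · rw [Finset.sum_range_succ, Function.update_self, ← hr]
      have : ∑ t ∈ range (s + 1), Function.update y (s + 1) q t * min (m ^ t) ρ =
          ∑ t ∈ range (s + 1), y t * min (m ^ t) ρ :=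
        Finset.sum_congr rfl fun t ht => by
          rw [Function.update_of_ne (by have := Finset.mem_range.1 ht; omega)]
      rw [this, ← hsum]; omega

/-- The scaled coordinate vectors whose small multiples sum to every vector of a box. -/
def boxVec (R : Fin D → ℝ) (m C : ℕ) (t : Fin D × Fin (2 * C + 1)) : Fin D → ℤ :=
  Pi.single t.1 ((min (m ^ (t.2 : ℕ)) ⌊R t.1⌋₊ : ℕ) : ℤ)

lemma abs_boxVec_le (hR : ∀ d, 0 < R d) (m C : ℕ) (t : Fin D × Fin (2 * C + 1)) (d : Fin D) :
    |(boxVec R m C t d : ℝ)| ≤ R d := by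
  unfold boxVec
  by_cases h : d = t.1
  · subst h
    rw [Pi.single_eq_same, Int.cast_natCast, Nat.abs_cast]
    exact (Nat.cast_le.2 (min_le_right _ _)).trans (Nat.floor_le (hR _).le)
  · rw [Pi.single_eq_of_ne h]; simpa using (hR d).le

lemma exists_sum_boxVec {m C : ℕ} (hR1 : ∀ d, 1 ≤ R d) (hRn : ∀ d, R d ≤ (n : ℝ) ^ C)
    (hm : n ≤ m ^ 2) (x : Fin D → ℤ) (hx0 : ∀ d, 0 ≤ x d)
    (hx : ∀ d, x d ≤ m * ⌊R d⌋₊) :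
    ∃ f : Fin D × Fin (2 * C + 1) → ℕ, (∀ t, f t ≤ m) ∧
      x = ∑ t, (f t : ℤ) • boxVec R m C t := by
  have h : ∀ d, ∃ y : ℕ → ℕ, (∀ t, y t ≤ m) ∧
      (x d).toNat = ∑ t ∈ range (2 * C + 1), y t * min (m ^ t) ⌊R d⌋₊ := by
    intro d
    refine exists_sum_min_pow (Nat.one_le_floor_iff _ |>.2 (hR1 d)) (2 * C) _ ?_
    have h1 : ⌊R d⌋₊ ≤ m ^ (2 * C) := by
      have h2 : (⌊R d⌋₊ : ℝ) ≤ (n : ℝ) ^ C := (Nat.floor_le (by linarith [hR1 d])).trans (hRn d)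
      have h3 : ⌊R d⌋₊ ≤ n ^ C := by exact_mod_cast h2
      calc _ ≤ n ^ C := h3
        _ ≤ (m ^ 2) ^ C := Nat.pow_le_pow_left hm C
        _ = _ := by rw [pow_mul]
    rw [min_eq_right h1]
    have := hx d
    rw [Int.toNat_le]; push_cast; exact this
  choose y hy hsum using h
  refine ⟨fun t => y t.1 t.2, fun t => hy _ _, ?_⟩
  funext d
  rw [Finset.sum_apply, Fintype.sum_prod_type, Finset.sum_eq_single d]
  · rw [← Int.toNat_of_nonneg (hx0 d), hsum d, Finset.sum_range]
    push_cast
    exact Finset.sum_congr rfl fun s _ => by simp [boxVec]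
  · intro d' _ hd'
    exact Finset.sum_eq_zero fun s _ => by simp [boxVec, Pi.single_eq_of_ne hd'.symm]
  · simp

lemma half_le_floor {x : ℝ} (hx : 1 ≤ x) : x / 2 ≤ ⌊x⌋₊ := by
  have h1 := Nat.lt_floor_add_one x
  have h2 : (1 : ℝ) ≤ ⌊x⌋₊ := by exact_mod_cast (Nat.one_le_floor_iff _).2 hx
  linarith

/-- A prescribed real vector is a combination of the `v i`, `i ∉ U`, with small coefficients. -/
lemma RobustlyGenerating.exists_tilt (hgen : RobustlyGenerating γ R k v) (hR1 : ∀ d, 1 ≤ R d)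
    (U : Finset (Fin n)) {N : ℕ} (hN : 1 ≤ N) (hU : (U.card : ℝ) + k * (D * N) ≤ γ * n) {τ : ℝ}
    (hτ : 0 ≤ τ) (s : Fin D → ℝ) (hs : ∀ d, |s d| ≤ τ * N * R d / 2) :
    ∃ t : Fin n → ℝ, (∀ i, |t i| ≤ τ) ∧ (∀ i ∈ U, t i = 0) ∧
      ∀ d, ∑ i, t i * v i d = s d := by
  classical
  have hR : ∀ d, 0 < R d := fun d => by linarith [hR1 d]
  obtain ⟨S, S', h₁, h₂⟩ := hgen.exists_blocks hR (univ : Finset (Fin D × Fin N))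
    (fun t => Pi.single t.1 (⌊R t.1⌋₊ : ℤ))
    (fun t d => by
      by_cases h : d = t.1
      · subst h
        rw [Pi.single_eq_same, Int.cast_natCast, Nat.abs_cast]
        exact Nat.floor_le (hR _).le
      · rw [Pi.single_eq_of_ne h]; simpa using (hR d).le) U (by simpa using hU)
  have hN0 : (0 : ℝ) < N := by exact_mod_cast hN
  have hfl : ∀ d, (0 : ℝ) < ⌊R d⌋₊ := fun d => by
    linarith [half_le_floor (hR1 d), hR1 d]
  set c : Fin D → ℝ := fun d => s d / (N * ⌊R d⌋₊) with hc
  have hcτ : ∀ d, |c d| ≤ τ := fun d => by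
    rw [hc]
    simp only
    rw [abs_div, abs_of_pos (mul_pos hN0 (hfl d)), div_le_iff₀ (mul_pos hN0 (hfl d))]
    refine (hs d).trans ?_
    have := mul_le_mul_of_nonneg_left (half_le_floor (hR1 d)) (mul_nonneg hτ hN0.le)
    linarith
  set χ : Fin D × Fin N → Fin n → ℝ := fun x i =>
    (if i ∈ S x then 1 else 0) - (if i ∈ S' x then 1 else 0) with hχ
  have hχ1 : ∀ x i, |χ x i| ≤ 1 := fun x i => by
    simp only [hχ]; split_ifs <;> simp
  have hχ0 : ∀ x i, i ∉ S x ∪ S' x → χ x i = 0 := fun x i hi => by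
    rw [Finset.mem_union, not_or] at hi
    simp [hχ, hi.1, hi.2]
  refine ⟨fun i => ∑ x, c x.1 * χ x i, fun i => ?_, fun i hi => ?_, fun d => ?_⟩
  · by_cases h : ∃ x, i ∈ S x ∪ S' x
    · obtain ⟨x, hx⟩ := h
      simp only
      rw [Finset.sum_eq_single x]
      · rw [abs_mul]
        calc _ ≤ τ * 1 := mul_le_mul (hcτ _) (hχ1 _ _) (abs_nonneg _) hτ
          _ = τ := mul_one τ
      · intro y _ hy
        rw [hχ0, mul_zero]
        exact Finset.disjoint_left.1 (h₂ x (mem_univ _) y (mem_univ _) hy.symm) hx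
      · simp
    · push Not at h
      simp only
      rw [Finset.sum_eq_zero fun x _ => by rw [hχ0 x i (h x), mul_zero], abs_zero]
      exact hτ
  · refine Finset.sum_eq_zero fun x _ => ?_
    rw [hχ0, mul_zero]
    exact Finset.disjoint_right.1 (h₁ x (mem_univ _)).2.1 hi
  · have hblock : ∀ x : Fin D × Fin N, ∑ i, χ x i * v i d =
        ((Pi.single x.1 (⌊R x.1⌋₊ : ℤ) : Fin D → ℤ) d : ℝ) := fun x => by
      rw [(h₁ x (mem_univ _)).2.2.2 d]
      push_cast
      simp only [hχ, sub_mul, Finset.sum_sub_distrib, ite_mul, one_mul, zero_mul,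
        Finset.sum_ite_mem, Finset.univ_inter]
    calc ∑ i, (∑ x, c x.1 * χ x i) * v i d
        = ∑ x : Fin D × Fin N, c x.1 * ∑ i, χ x i * v i d := by
          simp only [Finset.sum_mul, Finset.mul_sum]
          rw [Finset.sum_comm]
          simp only [mul_assoc]
      _ = ∑ j : Fin N, c d * ⌊R d⌋₊ := by
          simp only [hblock]
          rw [Fintype.sum_prod_type, Finset.sum_eq_single d]
          · simp
          · intro d' _ hd'
            simp [Pi.single_eq_of_ne hd'.symm]
          · simp
      _ = s d := by
          rw [Finset.sum_const, Finset.card_univ, Fintype.card_fin, nsmul_eq_mul, hc]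
          have := hfl d
          field_simp

end

section

variable {J : Type*} [Fintype J]

lemma prodEx_add {n : ℕ} (p : Fin n → J → ℝ) (f g : (Fin n → J) → ℝ) :
    prodEx p (fun x => f x + g x) = prodEx p f + prodEx p g := by
  simp [prodEx, mul_add, Finset.sum_add_distrib]

lemma prodEx_const {n : ℕ} {p : Fin n → J → ℝ} (hp : IsWeights p) (c : ℝ) :
    prodEx p (fun _ => c) = c := by
  rw [prodEx, ← Finset.sum_mul, hp.sum_prodWt, one_mul]

lemma prodEx_sum {n : ℕ} {p : Fin n → J → ℝ} (hp : IsWeights p) (h : Fin n → J → ℝ) :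
    prodEx p (fun x => ∑ i, h i (x i)) = ∑ i, ∑ j, p i j * h i j := by
  induction n with
  | zero => simp [prodEx]
  | succ n ih =>
    have hp' : IsWeights fun i : Fin n => p i.succ := ⟨fun i j => hp.nonneg _ _, fun i => hp.sum_one _⟩
    rw [prodEx_succ, Fin.sum_univ_succ, ← ih hp' fun i => h i.succ,
      ← prodEx_const hp' (∑ j, p 0 j * h 0 j), ← prodEx_add]
    congr 1
    funext y
    simp only [Fin.sum_univ_succ, Fin.cons_zero, Fin.cons_succ, mul_add, Finset.sum_add_distrib]
    rw [← Finset.sum_mul, hp.sum_one, one_mul]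

variable {n : ℕ}

lemma abs_sum_sub_sum_le_hammingDist {J : Type*} [DecidableEq J] {h : Fin n → J → ℝ}
    (hh : ∀ i j j', |h i j - h i j'| ≤ 1) (x y : Fin n → J) :
    |∑ i, h i (x i) - ∑ i, h i (y i)| ≤ hammingDist x y := by
  rw [← Finset.sum_sub_distrib]
  refine (Finset.abs_sum_le_sum_abs _ _).trans ?_
  rw [hammingDist, Finset.card_filter]
  push_cast
  refine Finset.sum_le_sum fun i _ => ?_
  split_ifs with hi
  · exact hh _ _ _
  · rw [not_not.1 hi]; simp

lemma hammingLipschitz_sum {J : Type*} {h : Fin n → J → ℝ}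
    (hh : ∀ i j j', |h i j - h i j'| ≤ 1) :
    HammingLipschitz fun x : Fin n → J => ∑ i, h i (x i) := fun x i j => by
  classical
  refine (abs_sum_sub_sum_le_hammingDist hh _ _).trans ?_
  exact_mod_cast hammingDist_update_le x i j

lemma prodPr_dev_le {p : Fin n → J → ℝ} (hp : IsWeights p) {f : (Fin n → J) → ℝ}
    (hf : HammingLipschitz f) {s : ℝ} (hs : 0 ≤ s) :
    prodPr p {x | s * n ≤ |f x - prodEx p f|} ≤ 2 * Real.exp (-(s ^ 2 / 4 * n)) := by
  refine (hp.prodPr_mono (T := {x | prodEx p f + s * n ≤ f x} ∪ {x | f x ≤ prodEx p f - s * n})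
    fun x hx => ?_).trans ((hp.prodPr_union_le _ _).trans ?_)
  · have hx' : s * n ≤ |f x - prodEx p f| := hx
    rcases le_abs.1 hx' with h | h
    · exact Or.inl (show prodEx p f + s * n ≤ f x by linarith)
    · exact Or.inr (show f x ≤ prodEx p f - s * n by linarith)
  · linarith [prodPr_upper_tail hp hf hs, prodPr_lower_tail hp hf hs]

lemma prodPr_comp {K : Type*} [Fintype K] [DecidableEq K] (q : Fin n → J → ℝ) (π : J → K)
    (S : Set (Fin n → K)) :
    prodPr q {x | (fun i => π (x i)) ∈ S} =
      prodPr (fun i b => ∑ j, if π j = b then q i j else 0) S := by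
  classical
  have h2 : ∀ y : Fin n → K, prodWt (fun i b => ∑ j, if π j = b then q i j else 0) y =
      ∑ x : Fin n → J, if (fun i => π (x i)) = y then prodWt q x else 0 := fun y => by
    rw [prodWt, Finset.prod_univ_sum, Fintype.piFinset_univ]
    refine Finset.sum_congr rfl fun x _ => ?_
    split_ifs with h
    · subst h; simp [prodWt]
    · obtain ⟨i, hi⟩ := Function.ne_iff.1 h
      exact Finset.prod_eq_zero (mem_univ i) (by simp [hi])
  simp only [prodPr, Set.indicator_apply]
  simp only [h2]
  have : ∀ y : Fin n → K, (if y ∈ S then ∑ x : Fin n → J,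
      (if (fun i => π (x i)) = y then prodWt q x else 0) else 0) =
      ∑ x : Fin n → J, if (fun i => π (x i)) = y then (if y ∈ S then prodWt q x else 0) else 0 :=
    fun y => by
      split_ifs <;> simp
  simp only [this]
  rw [Finset.sum_comm]
  refine Finset.sum_congr rfl fun x _ => ?_
  rw [Finset.sum_ite_eq]
  simp

end

section

variable {n D : ℕ} {R : Fin D → ℝ} {v : Fin n → Fin D → ℤ} {γ : ℝ} {k : ℕ}
variable {J : Type*}

/-- The contribution of the coordinates in `U` to the sum of the `v i` with `e (x i)` true. -/
def selOn (e : J → Bool) (v : Fin n → Fin D → ℤ) (U : Finset (Fin n)) (x : Fin n → J)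
    (d : Fin D) : ℤ := ∑ i ∈ U, if e (x i) then v i d else 0

variable [Fintype J]

/-- The probability that `e` is true under the weight `q`. -/
def selPr (e : J → Bool) (q : J → ℝ) : ℝ := ∑ j, if e j then q j else 0

/-- A set that can be corrected on few coordinates to hit a given sum is hit with probability that
is not too small. -/
theorem landing [DecidableEq J] {e : J → Bool} {χ : J → ℝ} (hχ1 : ∀ j, |χ j| ≤ 1)
    (hχ0 : ∑ j, χ j = 0) (hχe : selPr e χ = 1) {q : Fin n → J → ℝ} (hq : IsWeights q) {κ : ℝ}
    (hκ : 0 < κ) (hκq : ∀ i j, κ ≤ q i j) {w : Fin D → ℤ}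
    (hw : ∀ d, ∑ i, selPr e (q i) * v i d = w d) (hR1 : ∀ d, 1 ≤ R d)
    (hv : ∀ i d, |(v i d : ℝ)| ≤ R d) (hgen : RobustlyGenerating γ R k v) {U : Finset (Fin n)}
    {N : ℕ} (hN : 1 ≤ N) (hU : (U.card : ℝ) + k * (D * N) ≤ γ * n) {c : Fin D → ℤ}
    (hc : ∀ d, |(c d : ℝ)| ≤ U.card * R d) {m r₀ : ℕ} {τ s : ℝ} (hτ : 0 ≤ τ) (hτκ : τ ≤ κ)
    (hs : 0 ≤ s) (hsD : 2 * D * Real.exp (-(s ^ 2 / 4 * n)) ≤ 1 / 4)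
    (hsm : s * n + r₀ ≤ m / 4) (hτN : 2 * U.card + m / 2 ≤ τ * N / 2)
    {A Q : Set (Fin n → J)}
    (hfar : ∀ q' : Fin n → J → ℝ, IsWeights q' → (∃ t : Fin n → ℝ, (∀ i, |t i| ≤ τ) ∧
      ∀ i j, q' i j = q i j + t i * χ j) →
      prodPr q' {x | ∀ y ∈ A, (r₀ : ℝ) ≤ hammingDist x y} ≤ 1 / 4)
    (hreach : ∀ x ∈ A, ∀ y : Fin D → ℤ, (∀ d, c d ≤ y d ∧ y d ≤ c d + m * ⌊R d⌋₊) →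
      ∃ x' ∈ Q, (∀ i ∉ U, x' i = x i) ∧ ∀ d, selOn e v U x' d = y d)
    {ζ : ℝ} (hζ : 0 < ζ) (hκζ : κ * ζ ≤ 1) :
    1 / 2 * (κ * ζ) ^ (r₀ + U.card) ≤ prodPr q {x ∈ Q | ∀ d, selOn e v univ x d = w d} *
      ((1 + τ / κ) * (1 + Fintype.card J * ζ)) ^ n := by
  classical
  -- the tilt
  have hsel : ∀ i, 0 ≤ selPr e (q i) ∧ selPr e (q i) ≤ 1 := fun i => by
    refine ⟨Finset.sum_nonneg fun j _ => by split_ifs; exacts [hq.nonneg _ _, le_rfl], ?_⟩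
    rw [← hq.sum_one i]
    exact Finset.sum_le_sum fun j _ => by split_ifs; exacts [le_rfl, hq.nonneg _ _]
  have hR0 : ∀ d, 0 < R d := fun d => by linarith [hR1 d]
  have hfloor : ∀ d, (⌊R d⌋₊ : ℝ) ≤ R d := fun d => Nat.floor_le (hR0 d).le
  set S : Fin D → ℝ := fun d =>
    ∑ i ∈ U, selPr e (q i) * v i d - c d - m * ⌊R d⌋₊ / 2 with hS
  obtain ⟨t, htτ, htU, htS⟩ := hgen.exists_tilt hR1 U hN hU hτ S fun d => by
    have h1 : |∑ i ∈ U, selPr e (q i) * v i d| ≤ U.card * R d := by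
      refine (Finset.abs_sum_le_sum_abs _ _).trans ?_
      rw [← nsmul_eq_mul]
      refine Finset.sum_le_card_nsmul _ _ _ fun i _ => ?_
      rw [abs_mul, abs_of_nonneg (hsel i).1]
      calc _ ≤ 1 * R d := mul_le_mul (hsel i).2 (hv i d) (abs_nonneg _) zero_le_one
        _ = R d := one_mul _
    have h2 := mul_le_mul_of_nonneg_right hτN (hR0 d).le
    have h3 := mul_le_mul_of_nonneg_left (hfloor d) (Nat.cast_nonneg (α := ℝ) m)
    have h4 : (0 : ℝ) ≤ m * ⌊R d⌋₊ := by positivity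
    have h5 := hc d
    rw [abs_le] at h1 h5 ⊢
    simp only [hS]
    constructor <;> linarith [h1.1, h1.2, h5.1, h5.2]
  set q' : Fin n → J → ℝ := fun i j => q i j + t i * χ j with hq'
  have htχ : ∀ i j, |t i * χ j| ≤ τ := fun i j => by
    rw [abs_mul]
    calc _ ≤ τ * 1 := mul_le_mul (htτ i) (hχ1 j) (abs_nonneg _) hτ
      _ = τ := mul_one τ
  have hwq' : IsWeights q' := by
    refine ⟨fun i j => ?_, fun i => ?_⟩
    · have := (abs_le.1 (htχ i j)).1
      have := hκq i j
      simp only [hq']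
      linarith
    · simp only [hq', Finset.sum_add_distrib, hq.sum_one, ← Finset.mul_sum, hχ0]; simp
  have hq'le : ∀ i j, q' i j ≤ (1 + τ / κ) * q i j := fun i j => by
    have h1 := (abs_le.1 (htχ i j)).2
    have h2 := mul_le_mul_of_nonneg_left (hκq i j) (div_nonneg hτ hκ.le)
    rw [div_mul_cancel₀ _ hκ.ne'] at h2
    simp only [hq']
    linarith
  have hselq' : ∀ i, selPr e (q' i) = selPr e (q i) + t i := fun i => by
    have : selPr e (q' i) = selPr e (q i) + t i * selPr e χ := by
      simp only [selPr, hq', Finset.mul_sum, ← Finset.sum_add_distrib]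
      exact Finset.sum_congr rfl fun j _ => by split_ifs <;> simp
    rw [this, hχe, mul_one]
  -- the off-`U` part
  set h : Fin D → Fin n → J → ℝ := fun d i j =>
    if i ∈ U then 0 else (if e j then (v i d : ℝ) / R d else 0) with hh
  have hh1 : ∀ d i j j', |h d i j - h d i j'| ≤ 1 := fun d i j j' => by
    have hvR : |(v i d : ℝ) / R d| ≤ 1 := by
      rw [abs_div, abs_of_pos (hR0 d), div_le_one (hR0 d)]; exact hv i d
    simp only [hh]
    split_ifs <;> simp [hvR]
  set f : Fin D → (Fin n → J) → ℝ := fun d x => ∑ i, h d i (x i) with hf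
  have hfval : ∀ d x, f d x * R d = ((selOn e v univ x d - selOn e v U x d : ℤ) : ℝ) := by
    intro d x
    have h1 : selOn e v univ x d = selOn e v U x d + selOn e v Uᶜ x d := by
      simp only [selOn]
      exact (Finset.sum_add_sum_compl U _).symm
    have h2 : f d x = ∑ i ∈ Uᶜ, (if e (x i) then (v i d : ℝ) / R d else 0) := by
      simp only [hf, hh]
      rw [← Finset.sum_add_sum_compl U, Finset.sum_eq_zero (s := U) fun i hi => by simp [hi],
        zero_add]
      exact Finset.sum_congr rfl fun i hi => by simp [Finset.mem_compl.1 hi]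
    rw [h1, h2, add_sub_cancel_left, selOn, Finset.sum_mul]
    push_cast
    refine Finset.sum_congr rfl fun i _ => ?_
    have := (hR0 d).ne'
    split_ifs
    · field_simp
    · simp
  have hmean : ∀ d, prodEx q' (f d) * R d = w d - c d - m * ⌊R d⌋₊ / 2 := by
    intro d
    have h1 : prodEx q' (f d) = ∑ i, if i ∈ U then 0 else selPr e (q' i) * v i d / R d := by
      rw [prodEx_sum hwq']
      refine Finset.sum_congr rfl fun i _ => ?_
      simp only [hh]
      split_ifs with hi
      · simp
      · rw [mul_div_assoc, selPr, Finset.sum_mul]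
        exact Finset.sum_congr rfl fun j _ => by split_ifs <;> simp
    have h2 : ∀ i, (if i ∈ U then 0 else selPr e (q' i) * v i d / R d) * R d =
        selPr e (q i) * v i d + t i * v i d - if i ∈ U then selPr e (q i) * v i d else 0 := by
      intro i
      have := (hR0 d).ne'
      split_ifs with hi
      · rw [htU i hi]; ring
      · rw [hselq']; field_simp; ring
    rw [h1, Finset.sum_mul]
    simp only [h2]
    rw [Finset.sum_sub_distrib, Finset.sum_add_distrib, hw, htS, Finset.sum_ite_mem,
      Finset.univ_inter, hS]
    ring
  -- the good event
  set Q' : Set (Fin n → J) := {x ∈ Q | ∀ d, selOn e v univ x d = w d} with hQ'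
  set bad₁ : Set (Fin n → J) := ⋃ d ∈ (univ : Finset (Fin D)),
    {x | s * n ≤ |f d x - prodEx q' (f d)|} with hbad₁
  set bad₂ : Set (Fin n → J) := {x | ∀ y ∈ A, (r₀ : ℝ) ≤ hammingDist x y} with hbad₂
  have hb₁ : prodPr q' bad₁ ≤ 1 / 4 := by
    refine (prodPr_biUnion_le hwq' _ _).trans (le_trans ?_ hsD)
    calc _ ≤ (univ : Finset (Fin D)).card • (2 * Real.exp (-(s ^ 2 / 4 * n))) :=
          Finset.sum_le_card_nsmul _ _ _ fun d _ =>
            prodPr_dev_le hwq' (hammingLipschitz_sum (hh1 d)) hs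
      _ = _ := by rw [Finset.card_univ, Fintype.card_fin, nsmul_eq_mul]; ring
  have hb₂ : prodPr q' bad₂ ≤ 1 / 4 := hfar q' hwq' ⟨t, htτ, fun _ _ => rfl⟩
  have hgood : (bad₁ ∪ bad₂)ᶜ ⊆ {x | ∃ y ∈ Q', hammingDist x y ≤ r₀ + U.card} := by
    intro x hx
    rw [Set.mem_compl_iff, Set.mem_union, not_or] at hx
    obtain ⟨hx1, hx2⟩ := hx
    have hx1' : ∀ d, |f d x - prodEx q' (f d)| < s * n := fun d => by
      by_contra hcon
      exact hx1 (Set.mem_biUnion (mem_univ d) (not_lt.1 hcon))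
    obtain ⟨x₁, hx₁A, hx₁⟩ : ∃ y ∈ A, (hammingDist x y : ℝ) < r₀ := by
      by_contra! hcon
      exact hx2 hcon
    have hdev : ∀ d, |f d x₁ * R d - (w d - c d - m * ⌊R d⌋₊ / 2)| ≤ m * ⌊R d⌋₊ / 2 := by
      intro d
      rw [← hmean d, ← sub_mul, abs_mul, abs_of_pos (hR0 d)]
      have h1 := abs_sum_sub_sum_le_hammingDist (hh1 d) x x₁
      have h2 : |f d x₁ - prodEx q' (f d)| ≤ m / 4 := by
        have h3 : |f d x - f d x₁| ≤ hammingDist x x₁ := h1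
        have h4 := hx1' d
        rw [abs_le] at h3 ⊢
        rw [abs_lt] at h4
        constructor <;> linarith [h3.1, h3.2, h4.1, h4.2]
      calc _ ≤ m / 4 * R d := mul_le_mul_of_nonneg_right h2 (hR0 d).le
        _ ≤ m / 2 * ⌊R d⌋₊ := by
          have := mul_le_mul_of_nonneg_left (half_le_floor (hR1 d)) (Nat.cast_nonneg (α := ℝ) m)
          linarith
        _ = _ := by ring
    obtain ⟨x₂, hx₂Q, hx₂U, hx₂⟩ := hreach x₁ hx₁A
      (fun d => w d - (selOn e v univ x₁ d - selOn e v U x₁ d)) fun d => by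
        have h1 := hdev d
        rw [hfval, abs_le] at h1
        push_cast at h1
        constructor
        · have : (c d : ℝ) ≤ w d - (selOn e v univ x₁ d - selOn e v U x₁ d) := by linarith [h1.2]
          exact_mod_cast this
        · have : (w d : ℝ) - (selOn e v univ x₁ d - selOn e v U x₁ d) ≤ c d + m * ⌊R d⌋₊ := by
            linarith [h1.1]
          exact_mod_cast this
    refine ⟨x₂, ⟨hx₂Q, fun d => ?_⟩, ?_⟩
    · have h1 : selOn e v univ x₂ d - selOn e v U x₂ d =
          selOn e v univ x₁ d - selOn e v U x₁ d := by
        have hsplit : ∀ x : Fin n → J,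
            selOn e v univ x d - selOn e v U x d = selOn e v Uᶜ x d := fun x => by
          simp only [selOn]
          rw [← Finset.sum_add_sum_compl U]; ring
        rw [hsplit, hsplit]
        exact Finset.sum_congr rfl fun i hi => by rw [hx₂U i (Finset.mem_compl.1 hi)]
      have h2 := hx₂ d
      linarith
    · have h1 : hammingDist x₁ x₂ ≤ U.card := by
        refine Finset.card_le_card fun i hi => ?_
        by_contra hiU
        simp [hx₂U i hiU] at hi
      have h2 : hammingDist x x₁ < r₀ := by exact_mod_cast hx₁
      exact (hammingDist_triangle x x₁ x₂).trans (add_le_add h2.le h1)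
  have hhalf : 1 / 2 ≤ prodPr q' {x | ∃ y ∈ Q', hammingDist x y ≤ r₀ + U.card} := by
    refine le_trans ?_ (hwq'.prodPr_mono hgood)
    rw [prodPr_compl hwq']
    linarith [hwq'.prodPr_union_le bad₁ bad₂]
  have h1 := hhalf.trans (prodPr_le_pow_mul hwq' hq'le _)
  have h2 := prodPr_nhds_le hq hκ hκq hζ hκζ Q' (r₀ + U.card)
  have h3 : (0 : ℝ) ≤ (κ * ζ) ^ (r₀ + U.card) := by positivity
  have h4 : (0 : ℝ) ≤ (1 + τ / κ) ^ n := by positivity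
  rw [mul_pow (1 + τ / κ)]
  calc _ ≤ (1 + τ / κ) ^ n * prodPr q {x | ∃ y ∈ Q', hammingDist x y ≤ r₀ + U.card} *
        (κ * ζ) ^ (r₀ + U.card) := mul_le_mul_of_nonneg_right h1 h3
    _ = (1 + τ / κ) ^ n * (prodPr q {x | ∃ y ∈ Q', hammingDist x y ≤ r₀ + U.card} *
        (κ * ζ) ^ (r₀ + U.card)) := by ring
    _ ≤ (1 + τ / κ) ^ n * (prodPr q Q' * (1 + Fintype.card J * ζ) ^ n) :=
        mul_le_mul_of_nonneg_left h2 h4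
    _ = _ := by ring

end

section

/-- The standing assumptions on a family of vectors. -/
structure Tame {n D : ℕ} (γ : ℝ) (C k : ℕ) (R : Fin D → ℝ) (v : Fin n → Fin D → ℤ) : Prop where
  one_le : ∀ d, 1 ≤ R d
  le_pow : ∀ d, R d ≤ (n : ℝ) ^ C
  abs_le : ∀ i d, |(v i d : ℝ)| ≤ R d
  gen : RobustlyGenerating γ R k v

lemma exists_forall_le_mul {c : ℝ} (hc : 0 < c) (B : ℝ) : ∃ n₀ : ℕ, ∀ n : ℕ, n₀ ≤ n → B ≤ c * n := by
  obtain ⟨n₀, h⟩ := exists_nat_ge (B / c)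
  refine ⟨n₀, fun n hn => ?_⟩
  rw [div_le_iff₀ hc] at h
  have : (n₀ : ℝ) ≤ n := by exact_mod_cast hn
  nlinarith

lemma mul_exp_neg_le {B x : ℝ} (h : B ≤ x) : B * Real.exp (-x) ≤ 1 := by
  rw [Real.exp_neg, ← div_eq_mul_inv, div_le_one (Real.exp_pos _)]
  linarith [Real.add_one_le_exp x]

lemma one_add_pow_le_exp {x : ℝ} (hx : 0 ≤ x) (n : ℕ) : (1 + x) ^ n ≤ Real.exp (x * n) := by
  rw [mul_comm, Real.exp_nat_mul]
  exact pow_le_pow_left₀ (by linarith) (by linarith [Real.add_one_le_exp x]) n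

lemma exp_le_one_sub_pow {x : ℝ} (hx : 0 ≤ x) (hx1 : x ≤ 1 / 2) (n : ℕ) :
    Real.exp (-(2 * x * n)) ≤ (1 - x) ^ n := by
  have h : Real.exp (-(2 * x)) ≤ 1 - x := by
    have h1 := Real.add_one_le_exp (2 * x)
    rw [Real.exp_neg, inv_le_comm₀ (Real.exp_pos _) (by linarith)]
    refine le_trans ?_ h1
    rw [inv_le_iff_one_le_mul₀ (by linarith)]
    nlinarith
  calc _ = Real.exp (-(2 * x)) ^ n := by rw [← Real.exp_nat_mul]; ring_nf
    _ ≤ _ := pow_le_pow_left₀ (Real.exp_pos _).le h n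

lemma exp_half_le_one_add_pow {x : ℝ} (hx : 0 ≤ x) (hx1 : x ≤ 1) (n : ℕ) :
    Real.exp (x / 2 * n) ≤ (1 + x) ^ n := by
  have h : Real.exp (x / 2) ≤ 1 + x := by
    have h1 := Real.add_one_le_exp (-(x / 2))
    rw [Real.exp_neg] at h1
    have h2 := Real.exp_pos (x / 2)
    have h3 : (-(x / 2) + 1) * Real.exp (x / 2) ≤ 1 := by
      calc _ ≤ (Real.exp (x / 2))⁻¹ * Real.exp (x / 2) := mul_le_mul_of_nonneg_right h1 h2.le
        _ = 1 := inv_mul_cancel₀ h2.ne'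
    nlinarith
  calc _ = Real.exp (x / 2) ^ n := by rw [← Real.exp_nat_mul]; ring_nf
    _ ≤ _ := pow_le_pow_left₀ (Real.exp_pos _).le h n

/-- Asymptotic form of `landing`. -/
theorem landing_asymptotic {J : Type*} [Fintype J] [DecidableEq J] {e : J → Bool} {χ : J → ℝ}
    (hχ1 : ∀ j, |χ j| ≤ 1) (hχ0 : ∑ j, χ j = 0) (hχe : selPr e χ = 1) (D C k : ℕ) {γ κ ε : ℝ}
    (hγ : 0 < γ) (hκ : 0 < κ) (hκ1 : κ ≤ 1) (hε : 0 < ε) :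
    ∃ η > 0, η ≤ γ / 2 ∧ η ≤ 1 ∧ ∃ τ > 0, τ ≤ κ ∧ ∀ c₁ > 0, c₁ ≤ η → ∃ n₀ : ℕ, ∀ n : ℕ, n₀ ≤ n →
      ∀ (R : Fin D → ℝ) (v : Fin n → Fin D → ℤ), Tame γ C k R v →
      ∀ q : Fin n → J → ℝ, IsWeights q → (∀ i j, κ ≤ q i j) →
      ∀ w : Fin D → ℤ, (∀ d, ∑ i, selPr e (q i) * v i d = w d) →
      ∀ (U : Finset (Fin n)) (c : Fin D → ℤ) (A Q : Set (Fin n → J)) (r₀ : ℕ),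
        (U.card : ℝ) ≤ η * n → (∀ d, |(c d : ℝ)| ≤ U.card * R d) → r₀ ≤ 4 * (c₁ / 50) * n + 2 →
        (∀ q' : Fin n → J → ℝ, IsWeights q' → (∃ t : Fin n → ℝ, (∀ i, |t i| ≤ τ) ∧
          ∀ i j, q' i j = q i j + t i * χ j) →
          prodPr q' {x | ∀ y ∈ A, (r₀ : ℝ) ≤ hammingDist x y} ≤ 1 / 4) →
        (∀ x ∈ A, ∀ y : Fin D → ℤ, (∀ d, c d ≤ y d ∧ y d ≤ c d + ⌊c₁ * n⌋₊ * ⌊R d⌋₊) →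
          ∃ x' ∈ Q, (∀ i ∉ U, x' i = x i) ∧ ∀ d, selOn e v U x' d = y d) →
        Real.exp (-(ε * n)) ≤ prodPr q {x ∈ Q | ∀ d, selOn e v univ x d = w d} := by
  set ζ : ℝ := min (1 / 2) (ε / (8 * (Fintype.card J + 1))) with hζ
  have hζ0 : 0 < ζ := by positivity
  have hζ2 : ζ ≤ 1 / 2 := min_le_left _ _
  have hζε : Fintype.card J * ζ ≤ ε / 8 := by
    have h1 : ζ ≤ ε / (8 * (Fintype.card J + 1)) := min_le_right _ _
    rw [le_div_iff₀ (by positivity)] at h1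
    have : (0 : ℝ) ≤ Fintype.card J := Nat.cast_nonneg _
    nlinarith
  set τ : ℝ := κ * min 1 (ε / 8) with hτ
  have hτ0 : 0 < τ := by positivity
  have hτκ : τ ≤ κ := mul_le_of_le_one_right hκ.le (min_le_left _ _)
  have hτκε : τ / κ ≤ ε / 8 := by
    rw [hτ, mul_div_cancel_left₀ _ hκ.ne']; exact min_le_right _ _
  have hκζ0 : 0 < κ * ζ := mul_pos hκ hζ0
  have hκζ1 : κ * ζ < 1 := by nlinarith
  set l : ℝ := -Real.log (κ * ζ) with hl
  have hl0 : 0 < l := neg_pos.2 (Real.log_neg hκζ0 hκζ1)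
  set ν : ℝ := γ / (4 * (k * D + 1)) with hν
  have hν0 : 0 < ν := by positivity
  set η : ℝ := min (min (γ / 2) 1) (min (τ * ν / 8) (ε / (16 * l))) with hη
  have hη0 : 0 < η := by positivity
  have hηγ : η ≤ γ / 2 := (min_le_left _ _).trans (min_le_left _ _)
  have hη1 : η ≤ 1 := (min_le_left _ _).trans (min_le_right _ _)
  have hητ : η ≤ τ * ν / 8 := (min_le_right _ _).trans (min_le_left _ _)
  have hηl : 2 * η * l ≤ ε / 8 := by
    have h1 : η ≤ ε / (16 * l) := (min_le_right _ _).trans (min_le_right _ _)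
    rw [le_div_iff₀ (by positivity)] at h1
    linarith
  refine ⟨η, hη0, hηγ, hη1, τ, hτ0, hτκ, fun c₁ hc₁ hc₁η => ?_⟩
  set s : ℝ := c₁ / 50 with hs
  have hs0 : 0 < s := by positivity
  obtain ⟨n₁, hn₁⟩ := exists_forall_le_mul (show 0 < s ^ 2 / 4 by positivity) (8 * D)
  obtain ⟨n₂, hn₂⟩ := exists_forall_le_mul hν0 1
  obtain ⟨n₃, hn₃⟩ := exists_forall_le_mul (show 0 < c₁ / 40 by positivity) 3
  obtain ⟨n₄, hn₄⟩ := exists_forall_le_mul (show 0 < ε / 8 by positivity) 2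
  refine ⟨n₁ + n₂ + n₃ + n₄, fun n hn R v hT q hq hκq w hw U c A Q r₀ hU hc hr₀ hfar hreach => ?_⟩
  replace hn₁ := hn₁ n (by omega)
  replace hn₂ := hn₂ n (by omega)
  replace hn₃ := hn₃ n (by omega)
  replace hn₄ := hn₄ n (by omega)
  have hn0 : (0 : ℝ) ≤ n := Nat.cast_nonneg n
  set m := ⌊c₁ * n⌋₊ with hm
  have hm1 : (m : ℝ) ≤ c₁ * n := Nat.floor_le (by positivity)
  have hm2 : c₁ * n < m + 1 := Nat.lt_floor_add_one _
  have hmη : (m : ℝ) ≤ η * n := hm1.trans (mul_le_mul_of_nonneg_right hc₁η hn0)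
  have hsm : s * n + r₀ ≤ m / 4 := by rw [hs] at *; linarith
  set N := ⌊2 * ν * n⌋₊ with hN
  have hN1 : (N : ℝ) ≤ 2 * ν * n := Nat.floor_le (by positivity)
  have hN2 : 2 * ν * n < N + 1 := Nat.lt_floor_add_one _
  have hN3 : ν * n ≤ N := by linarith
  have hN4 : 1 ≤ N := by
    have : (1 : ℝ) ≤ N := hn₂.trans hN3
    exact_mod_cast this
  have hkDN : (k : ℝ) * (D * N) ≤ γ * n / 2 := by
    have h1 : (k : ℝ) * D * N ≤ (k * D + 1) * (2 * ν * n) := by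
      refine mul_le_mul (by linarith) hN1 (Nat.cast_nonneg _) (by positivity)
    have h2 : ((k : ℝ) * D + 1) * (2 * ν * n) = γ * n / 2 := by
      rw [hν]; field_simp; ring
    linarith
  have hland := landing hχ1 hχ0 hχe hq hκ hκq hw hT.one_le hT.abs_le hT.gen (U := U) (N := N) hN4
    (by
      have := mul_le_mul_of_nonneg_right hηγ hn0
      linarith) hc (m := m) (r₀ := r₀) hτ0.le hτκ hs0.le (by
        have := mul_exp_neg_le hn₁
        linarith) hsm (by
        have h1 := mul_le_mul_of_nonneg_right hητ hn0
        have h2 := mul_le_mul_of_nonneg_left hN3 hτ0.le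
        linarith) hfar hreach hζ0 hκζ1.le
  have h1 : ((1 + τ / κ) * (1 + Fintype.card J * ζ)) ^ n ≤ Real.exp (ε / 4 * n) := by
    rw [mul_pow]
    calc _ ≤ Real.exp (τ / κ * n) * Real.exp (Fintype.card J * ζ * n) :=
          mul_le_mul (one_add_pow_le_exp (by positivity) n) (one_add_pow_le_exp (by positivity) n)
            (by positivity) (by positivity)
      _ ≤ _ := by
          rw [← Real.exp_add, Real.exp_le_exp]
          have h1 := mul_le_mul_of_nonneg_right hτκε hn0
          have h2 := mul_le_mul_of_nonneg_right hζε hn0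
          linarith
  have h2 : Real.exp (-(ε / 8 * n)) ≤ (κ * ζ) ^ (r₀ + U.card) := by
    rw [← Real.exp_log hκζ0, ← Real.exp_nat_mul, Real.exp_le_exp]
    have h3 : ((r₀ + U.card : ℕ) : ℝ) ≤ 2 * η * n := by
      push_cast
      have : 0 ≤ s * n := by positivity
      linarith
    have h4 := mul_le_mul_of_nonneg_right h3 hl0.le
    have h5 := mul_le_mul_of_nonneg_right hηl hn0
    rw [show Real.log (κ * ζ) = -l by rw [hl, neg_neg]]
    nlinarith
  have h3 : Real.exp (-(ε / 8 * n)) ≤ 1 / 2 := by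
    have := mul_exp_neg_le hn₄; linarith
  have h4 : Real.exp (-(ε * n)) * Real.exp (ε / 4 * n) ≤
      1 / 2 * (κ * ζ) ^ (r₀ + U.card) := by
    calc _ ≤ Real.exp (-(ε / 8 * n)) * Real.exp (-(ε / 8 * n)) := by
          rw [← Real.exp_add, ← Real.exp_add, Real.exp_le_exp]
          have : 0 ≤ ε * n := by positivity
          linarith
      _ ≤ _ := mul_le_mul h3 h2 (Real.exp_pos _).le (by norm_num)
  refine le_of_mul_le_mul_right (h4.trans (hland.trans ?_)) (Real.exp_pos (ε / 4 * n))
  exact mul_le_mul_of_nonneg_left h1 (hq.prodPr_nonneg _)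

end

section

variable {n D : ℕ}

lemma bCap_eq_capOn (v : Fin n → Fin D → ℤ) (a b : Fin n → Bool) : bCap v a b = capOn v univ a b :=
  rfl

lemma selOn_and_eq_capOn (v : Fin n → Fin D → ℤ) (U : Finset (Fin n)) (x : Fin n → Bool × Bool)
    (d : Fin D) : selOn (fun j : Bool × Bool => j.1 && j.2) v U x d =
      capOn v U (fun i => (x i).1) (fun i => (x i).2) d := by
  simp [selOn, capOn]

lemma abs_capOn_le {R : Fin D → ℝ} {v : Fin n → Fin D → ℤ} (hv : ∀ i d, |(v i d : ℝ)| ≤ R d)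
    (U : Finset (Fin n)) (a b : Fin n → Bool) (d : Fin D) :
    |(capOn v U a b d : ℝ)| ≤ U.card * R d := by
  rw [capOn]
  push_cast
  refine (Finset.abs_sum_le_sum_abs _ _).trans ?_
  rw [← nsmul_eq_mul]
  refine Finset.sum_le_card_nsmul _ _ _ fun i _ => ?_
  split_ifs
  · exact hv i d
  · simpa using (abs_nonneg _).trans (hv i d)

/-- The parity character on `Bool × Bool`. -/
def parity (j : Bool × Bool) : ℝ := if j.1 = j.2 then 1 else -1

lemma prodPr_far_prod_le {q : Fin n → Bool × Bool → ℝ} (hq : IsWeights q) {p : Fin n → Bool → ℝ}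
    (hp : IsWeights p) (h₁ : ∀ i b, ∑ j : Bool × Bool, (if j.1 = b then q i j else 0) = p i b)
    (h₂ : ∀ i b, ∑ j : Bool × Bool, (if j.2 = b then q i j else 0) = p i b) {s : ℝ} (hs : 0 ≤ s)
    {A B : Set (Fin n → Bool)} (hA : Real.exp (-(s ^ 2 / 4 * n)) < prodPr p A)
    (hB : Real.exp (-(s ^ 2 / 4 * n)) < prodPr p B) :
    prodPr q {x | ∀ y ∈ {y : Fin n → Bool × Bool | (fun i => (y i).1) ∈ A ∧ (fun i => (y i).2) ∈ B},
      ((2 * ⌈2 * s * n⌉₊ : ℕ) : ℝ) ≤ hammingDist x y} ≤ 2 * Real.exp (-(s ^ 2 / 4 * n)) := by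
  set F : Set (Fin n → Bool) → Set (Fin n → Bool) := fun A =>
    {a | ∀ y ∈ A, 2 * s * n ≤ hammingDist a y} with hF
  have e₁ : prodPr q {x | (fun i => (x i).1) ∈ F A} = prodPr p (F A) := by
    rw [prodPr_comp q Prod.fst]
    exact congrArg (fun p => prodPr p (F A)) (funext fun i => funext fun b => h₁ i b)
  have e₂ : prodPr q {x | (fun i => (x i).2) ∈ F B} = prodPr p (F B) := by
    rw [prodPr_comp q Prod.snd]
    exact congrArg (fun p => prodPr p (F B)) (funext fun i => funext fun b => h₂ i b)
  refine (hq.prodPr_mono (T := {x | (fun i => (x i).1) ∈ F A} ∪ {x | (fun i => (x i).2) ∈ F B})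
    fun x hx => ?_).trans ((hq.prodPr_union_le _ _).trans ?_)
  · by_contra hcon
    rw [Set.mem_union, not_or] at hcon
    obtain ⟨hc1, hc2⟩ := hcon
    have hc1' : ¬ ∀ y ∈ A, 2 * s * n ≤ hammingDist (fun i => (x i).1) y := hc1
    have hc2' : ¬ ∀ y ∈ B, 2 * s * n ≤ hammingDist (fun i => (x i).2) y := hc2
    push Not at hc1' hc2'
    obtain ⟨y₁, hy₁, hd₁⟩ := hc1'
    obtain ⟨y₂, hy₂, hd₂⟩ := hc2'
    have h3 := hx (fun i => (y₁ i, y₂ i)) ⟨hy₁, hy₂⟩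
    have h4 : hammingDist x (fun i => (y₁ i, y₂ i)) ≤
        hammingDist (fun i => (x i).1) y₁ + hammingDist (fun i => (x i).2) y₂ := by
      refine le_trans (Finset.card_le_card ?_) (Finset.card_union_le _ _)
      intro i hi
      simp only [Finset.mem_filter, Finset.mem_union, mem_univ, true_and, Ne, Prod.ext_iff,
        not_and_or] at hi ⊢
      exact hi
    have h5 : 2 * ⌈2 * s * n⌉₊ ≤ hammingDist x (fun i => (y₁ i, y₂ i)) := by exact_mod_cast h3
    have h6 : (hammingDist (fun i => (x i).1) y₁ : ℝ) < ⌈2 * s * n⌉₊ := hd₁.trans_le (Nat.le_ceil _)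
    have h7 : (hammingDist (fun i => (x i).2) y₂ : ℝ) < ⌈2 * s * n⌉₊ := hd₂.trans_le (Nat.le_ceil _)
    norm_cast at h6 h7
    omega
  · rw [e₁, e₂]
    linarith [prodPr_far_le hp hs hA, prodPr_far_le hp hs hB]

set_option maxHeartbeats 1000000 in
/-- Every set of not too small measure contains many pairs with the typical intersection. -/
theorem exists_prodPr_pairs_ge (D C k : ℕ) {γ κ ε : ℝ} (hγ : 0 < γ) (hκ : 0 < κ) (hκ1 : κ ≤ 1)
    (hε : 0 < ε) : ∃ δ > 0, ∃ n₀ : ℕ, ∀ n : ℕ, n₀ ≤ n →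
      ∀ (R : Fin D → ℝ) (v : Fin n → Fin D → ℤ), Tame γ C k R v →
      ∀ (p : Fin n → Bool → ℝ) (q : Fin n → Bool × Bool → ℝ), IsWeights p → IsWeights q →
      (∀ i j, κ ≤ q i j) → (∀ i b, ∑ j : Bool × Bool, (if j.1 = b then q i j else 0) = p i b) →
      (∀ i b, ∑ j : Bool × Bool, (if j.2 = b then q i j else 0) = p i b) →
      ∀ w : Fin D → ℤ, (∀ d, ∑ i, q i (true, true) * v i d = w d) →
      ∀ A : Set (Fin n → Bool), Real.exp (-(δ * n)) ≤ prodPr p A →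
      Real.exp (-(ε * n)) ≤ prodPr q {x | (fun i => (x i).1) ∈ A ∧ (fun i => (x i).2) ∈ A ∧
        ∀ d, bCap v (fun i => (x i).1) (fun i => (x i).2) d = w d} := by
  have hsel : ∀ f : Bool × Bool → ℝ, selPr (fun j : Bool × Bool => j.1 && j.2) f = f (true, true) :=
    fun f => by simp [selPr, Fintype.sum_prod_type]
  obtain ⟨η, hη, hηγ, hη1, τ, hτ, hτκ, hland⟩ := landing_asymptotic
    (e := fun j : Bool × Bool => j.1 && j.2) (χ := parity)
    (fun j => by unfold parity; split_ifs <;> simp)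
    (by simp [parity, Fintype.sum_prod_type]) (by rw [hsel]; simp [parity]) D C k hγ hκ hκ1 hε
  set T := D * (2 * C + 1) with hT
  have hκk : 0 < κ ^ k := by positivity
  set C₀ : ℝ := 6 / κ ^ k with hC₀
  have hC₀0 : 0 < C₀ := by positivity
  set K : ℕ := ⌈4 * C₀ * T⌉₊ + 5 with hK
  have hK1 : 4 * C₀ * T + 4 ≤ K - 1 := by
    rw [hK]; push_cast
    linarith [Nat.le_ceil (4 * C₀ * T)]
  set c₁ : ℝ := η / (k * T * K + 1) with hc₁
  have hc₁0 : 0 < c₁ := by positivity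
  have hc₁η : c₁ ≤ η := div_le_self hη.le (by
    have : (0 : ℝ) ≤ k * T * K := by positivity
    linarith)
  have hc₁K : (k : ℝ) * T * K * c₁ ≤ η := by
    have h1 : (k * T * K + 1) * c₁ = η := by rw [hc₁]; field_simp
    linarith
  obtain ⟨n₀, hn₀⟩ := hland c₁ hc₁0 hc₁η
  set s : ℝ := c₁ / 50 with hs
  have hs0 : 0 < s := by positivity
  set β : ℝ := min (min 1 (1 / (2 * C₀))) (s ^ 2 / (64 * C₀ * (T + 1))) with hβ
  have hβ0 : 0 < β := by positivity
  have hβ1 : β ≤ 1 := (min_le_left _ _).trans (min_le_left _ _)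
  have hb2 : C₀ * β ≤ 1 / 2 := by
    have : β ≤ 1 / (2 * C₀) := (min_le_left _ _).trans (min_le_right _ _)
    rw [le_div_iff₀ (by positivity)] at this
    linarith
  have hbT : C₀ * β * T ≤ s ^ 2 / 64 := by
    have : β ≤ s ^ 2 / (64 * C₀ * (T + 1)) := min_le_right _ _
    rw [le_div_iff₀ (by positivity)] at this
    have h2 : 0 ≤ β * C₀ := by positivity
    linarith
  have hbeq : 6 * β / κ ^ k = C₀ * β := by rw [hC₀]; ring
  set δ : ℝ := min (β * c₁ / 4) (s ^ 2 / 32) with hδ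
  have hδ0 : 0 < δ := by positivity
  have hδ1 : δ ≤ β * c₁ / 4 := min_le_left _ _
  have hδ2 : δ ≤ s ^ 2 / 32 := min_le_right _ _
  obtain ⟨n₁, hn₁⟩ := exists_forall_le_mul hc₁0 2
  obtain ⟨n₂, hn₂⟩ := exists_forall_le_mul (show 0 < c₁ ^ 2 / 4 by positivity) 1
  obtain ⟨n₃, hn₃⟩ := exists_forall_le_mul (show 0 < s ^ 2 / 4 by positivity) 8
  refine ⟨δ, hδ0, n₀ + n₁ + n₂ + n₃, fun n hn R v hV p q hp hq hκq h₁ h₂ w hw A hA => ?_⟩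
  replace hn₁ := hn₁ n (by omega)
  replace hn₂ := hn₂ n (by omega)
  replace hn₃ := hn₃ n (by omega)
  have hnr0 : (0 : ℝ) ≤ n := Nat.cast_nonneg n
  have hR0 : ∀ d, 0 < R d := fun d => by linarith [hV.one_le d]
  set m := ⌊c₁ * n⌋₊ with hm
  have hm1 : (m : ℝ) ≤ c₁ * n := Nat.floor_le (by positivity)
  have hm2 : c₁ * n < m + 1 := Nat.lt_floor_add_one _
  have hm3 : c₁ * n / 2 ≤ m := by linarith
  have hmn : (m : ℝ) ≤ n := hm1.trans (by nlinarith)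
  have hmsq : n ≤ m ^ 2 := by
    have h1 : (n : ℝ) ≤ (m : ℝ) ^ 2 := by
      have h2 : (c₁ * n / 2) ^ 2 ≤ (m : ℝ) ^ 2 := pow_le_pow_left₀ (by positivity) hm3 2
      have h3 := mul_le_mul_of_nonneg_right hn₂ hnr0
      nlinarith
    exact_mod_cast h1
  set τs := Fin D × Fin (2 * C + 1)
  have hcardτ : Fintype.card τs = T := by simp [τs, hT]
  have hκp : ∀ i j, κ ≤ p i j := fun i b => by
    rw [← h₁ i b]
    refine (hκq i (b, b)).trans ?_
    have := Finset.single_le_sum (f := fun j : Bool × Bool => if j.1 = b then q i j else 0)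
      (fun j _ => by split_ifs; exacts [hq.nonneg _ _, le_rfl]) (mem_univ (b, b))
    simpa using this
  -- the blocks
  have hkTL : (k : ℝ) * (T * (K * m : ℕ)) ≤ η * n := by
    push_cast
    have h1 := mul_le_mul_of_nonneg_left hm1 (show (0 : ℝ) ≤ k * T * K by positivity)
    have h2 := mul_le_mul_of_nonneg_right hc₁K hnr0
    linarith
  obtain ⟨S, S', hS₁, hS₂⟩ := hV.gen.exists_blocks hR0
    ((univ : Finset τs) ×ˢ range (K * m)) (fun x => boxVec R m C x.1)
    (fun x d => abs_boxVec_le hR0 m C x.1 d) ∅ (by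
      rw [Finset.card_product, Finset.card_range, Finset.card_univ, hcardτ, Finset.card_empty]
      push_cast at hkTL ⊢
      have := mul_le_mul_of_nonneg_right hηγ hnr0
      have : 0 ≤ γ * n := by positivity
      linarith)
  have hmem : ∀ (t : τs), ∀ j < K * m, (t, j) ∈ (univ : Finset τs) ×ˢ range (K * m) :=
    fun t j hj => by simp [hj]
  have hφ : Real.exp (-(2 * δ * n)) ≤ prodPr p A * prodPr p A := by
    calc _ = Real.exp (-(δ * n)) * Real.exp (-(δ * n)) := by rw [← Real.exp_add]; ring_nf
      _ ≤ _ := mul_le_mul hA hA (Real.exp_pos _).le (hp.prodPr_nonneg _)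
  have hφ' : Real.exp (-(2 * (C₀ * β) * (m * T : ℕ)) - 2 * δ * n) ≤
      (1 - 6 * β / κ ^ k) ^ (m * Fintype.card τs) * (prodPr p A * prodPr p A) := by
    have h1 : Real.exp (-(2 * (C₀ * β) * (m * T : ℕ))) ≤ (1 - C₀ * β) ^ (m * T) :=
      exp_le_one_sub_pow (by positivity) hb2 (m * T)
    rw [sub_eq_add_neg, Real.exp_add, hbeq, hcardτ]
    exact mul_le_mul h1 hφ (Real.exp_pos _).le (h1.trans' (Real.exp_pos _).le)
  obtain ⟨A', B', U, c, hUsub, hR, hφ₂⟩ := reach_types (v := v) (A := A) (B := A) hp hκ hκ1 hκp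
    hβ0 (k := k) (by
      have : 6 * β / κ ^ k ≤ 1 := by rw [hbeq]; linarith
      rwa [div_le_one hκk] at this) (τ := τs) (L := K * m) (m := m)
    (S := fun t j => S (t, j)) (S' := fun t j => S' (t, j))
    (fun t j hj => (hS₁ _ (hmem t j hj)).2.2.1) (u := boxVec R m C)
    (fun t j hj => (hS₁ _ (hmem t j hj)).2.2.2)
    (fun t j hj t' j' hj' hne => hS₂ _ (hmem t j hj) _ (hmem t' j' hj') hne)
    (by
      have h1 := exp_half_le_one_add_pow hβ0.le hβ1 (K * m - m)
      refine lt_of_lt_of_le ?_ (mul_le_mul h1 hφ' (Real.exp_pos _).le (by positivity))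
      rw [← Real.exp_add, Real.one_lt_exp_iff]
      have hKm : ((K * m - m : ℕ) : ℝ) = (K - 1) * m := by
        rw [Nat.cast_sub (Nat.le_mul_of_pos_left _ (by omega))]
        push_cast; ring
      rw [hKm]
      push_cast
      have h2 := mul_le_mul_of_nonneg_left hK1 (show (0 : ℝ) ≤ β / 2 * m by positivity)
      have h3 := mul_le_mul_of_nonneg_right hδ1 hnr0
      have h4 := mul_le_mul_of_nonneg_left hm3 hβ0.le
      have h5 : 0 < β * (c₁ * n) := mul_pos hβ0 (by linarith)
      linarith)
  have hUcard : (U.card : ℝ) ≤ η * n := by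
    have h1 : U.card ≤ T * (K * m * k) := by
      calc U.card ≤ _ := Finset.card_le_card hUsub
        _ ≤ (univ : Finset τs).card * (K * m * k) := Finset.card_biUnion_le_card_mul _ _ _ fun t _ => by
          calc _ ≤ (range (K * m)).card * k := Finset.card_biUnion_le_card_mul _ _ _ fun j hj =>
                (hS₁ _ (hmem t j (Finset.mem_range.1 hj))).2.2.1
            _ = _ := by rw [Finset.card_range]
        _ = _ := by rw [Finset.card_univ, hcardτ]
    have h2 : (U.card : ℝ) ≤ T * (K * m * k) := by exact_mod_cast h1
    push_cast at hkTL
    linarith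
  have hlow : Real.exp (-(s ^ 2 / 4 * n)) < prodPr p A' * prodPr p B' := by
    refine lt_of_lt_of_le ?_ (hφ'.trans hφ₂)
    rw [Real.exp_lt_exp]
    push_cast
    have h1 := mul_le_mul_of_nonneg_right hbT (Nat.cast_nonneg (α := ℝ) m)
    have h2 := mul_le_mul_of_nonneg_left hmn (show 0 ≤ s ^ 2 / 64 by positivity)
    have h3 := mul_le_mul_of_nonneg_right hδ2 hnr0
    linarith
  have hA' : Real.exp (-(s ^ 2 / 4 * n)) < prodPr p A' :=
    hlow.trans_le (mul_le_of_le_one_right (hp.prodPr_nonneg _) (hp.prodPr_le_one _))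
  have hB' : Real.exp (-(s ^ 2 / 4 * n)) < prodPr p B' :=
    hlow.trans_le (mul_le_of_le_one_left (hp.prodPr_nonneg _) (hp.prodPr_le_one _))
  have hcR : ∀ d, |(c d : ℝ)| ≤ U.card * R d := by
    obtain ⟨a, ha⟩ := exists_mem_of_prodPr_pos ((Real.exp_pos _).trans hA')
    obtain ⟨b, hb⟩ := exists_mem_of_prodPr_pos ((Real.exp_pos _).trans hB')
    obtain ⟨a₁, -, b₁, -, -, hcap⟩ := hR a ha b hb c ⟨0, by simp, by simp⟩
    intro d
    rw [← hcap]
    exact abs_capOn_le hV.abs_le U a₁ b₁ d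
  have hfin := hn₀ n (by omega) R v hV q hq hκq w (by simpa only [hsel] using hw) U c
    {y | (fun i => (y i).1) ∈ A' ∧ (fun i => (y i).2) ∈ B'}
    {y | (fun i => (y i).1) ∈ A ∧ (fun i => (y i).2) ∈ A} (2 * ⌈2 * s * n⌉₊) hUcard hcR
    (by
      push_cast
      have := Nat.ceil_lt_add_one (show 0 ≤ 2 * s * n by positivity)
      linarith)
    (by
      rintro q' hq' ⟨t, -, ht⟩
      refine (prodPr_far_prod_le hq' hp (fun i b => ?_) (fun i b => ?_) hs0.le hA' hB').trans ?_
      · rw [← h₁ i b]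
        cases b <;> simp [Fintype.sum_prod_type, ht, parity] <;> ring
      · rw [← h₂ i b]
        cases b <;> simp [Fintype.sum_prod_type, ht, parity] <;> ring
      · have := mul_exp_neg_le hn₃
        linarith)
    (by
      intro x hx y hy
      obtain ⟨f, hf, hfy⟩ := exists_sum_boxVec hV.one_le hV.le_pow hmsq (fun d => y d - c d)
        (fun d => by have := (hy d).1; linarith) (fun d => by have := (hy d).2; linarith)
      obtain ⟨a₁, ha₁, b₁, hb₁, heq, hcap⟩ := hR _ hx.1 _ hx.2 y ⟨f, hf, by
        rw [← hfy]; funext d; simp⟩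
      refine ⟨fun i => (a₁ i, b₁ i), ⟨ha₁, hb₁⟩, fun i hi => ?_, fun d => ?_⟩
      · exact Prod.ext (heq i hi).1 (heq i hi).2
      · rw [selOn_and_eq_capOn, hcap])
  refine hfin.trans (hq.prodPr_mono ?_)
  rintro x ⟨hx, hd⟩
  refine ⟨hx.1, hx.2, fun d => ?_⟩
  rw [bCap_eq_capOn, ← selOn_and_eq_capOn, hd]

end

section Pattern

variable {n D : ℕ}

lemma abs_selOn_le {J : Type*} {R : Fin D → ℝ} {v : Fin n → Fin D → ℤ}
    (hv : ∀ i d, |(v i d : ℝ)| ≤ R d) (e : J → Bool) (U : Finset (Fin n)) (x : Fin n → J) (d : Fin D) :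
    |(selOn e v U x d : ℝ)| ≤ U.card * R d := by
  unfold selOn
  push_cast
  refine (Finset.abs_sum_le_sum_abs _ _).trans ?_
  refine (Finset.sum_le_card_nsmul _ _ (R d) fun i _ => ?_).trans (by rw [nsmul_eq_mul])
  split_ifs
  · exact hv i d
  · simpa using (abs_nonneg _).trans (hv i d)

/-- Setting a block `(s, s')` to the indicator of `s` rather than of `s'` shifts its contribution by `u`; running over
disjoint blocks, `f` counts the shifted blocks of every type. -/
lemma exists_selOn_blocks {τ : Type*} [Fintype τ] [DecidableEq τ] {v : Fin n → Fin D → ℤ}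
    (I : Finset (Fin n)) (pat : Fin n → Bool) {m : ℕ} {S S' : τ × ℕ → Finset (Fin n)}
    {u : τ → Fin D → ℤ}
    (h₁ : ∀ b ∈ (univ : Finset τ) ×ˢ range m, Disjoint (S b) (S' b) ∧ Disjoint (S b ∪ S' b) I ∧
      ∀ d, u b.1 d = ∑ i ∈ S b, v i d - ∑ i ∈ S' b, v i d)
    (h₂ : ∀ b ∈ (univ : Finset τ) ×ˢ range m, ∀ b' ∈ (univ : Finset τ) ×ˢ range m, b ≠ b' →
      Disjoint (S b ∪ S' b) (S b' ∪ S' b')) :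
    ∃ c : Fin D → ℤ, ∀ (x : Fin n → Bool) (f : τ → ℕ), (∀ t, f t ≤ m) → ∃ x' : Fin n → Bool,
      (∀ i ∈ I, x' i = pat i) ∧
      (∀ i ∉ I ∪ ((univ : Finset τ) ×ˢ range m).biUnion (fun b => S b ∪ S' b), x' i = x i) ∧
      ∀ d, selOn id v (I ∪ ((univ : Finset τ) ×ˢ range m).biUnion (fun b => S b ∪ S' b)) x' d =
        c d + ∑ t, (f t : ℤ) * u t d := by
  set B := (univ : Finset τ) ×ˢ range m with hB
  refine ⟨fun d => ∑ i ∈ I, (if pat i then v i d else 0) + ∑ b ∈ B, ∑ i ∈ S' b, v i d,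
    fun x f hf => ?_⟩
  set on : τ × ℕ → Finset (Fin n) := fun b => if b.2 < f b.1 then S b else S' b with hon
  have hsub : ∀ b, on b ⊆ S b ∪ S' b := fun b => by
    rw [hon]; dsimp only
    split_ifs
    exacts [subset_union_left, subset_union_right]
  have hdI : Disjoint I (B.biUnion fun b => S b ∪ S' b) := by
    rw [Finset.disjoint_biUnion_right]
    exact fun b hb => (h₁ b hb).2.1.symm
  set x' : Fin n → Bool := fun i => if i ∈ I then pat i else
    if i ∈ B.biUnion (fun b => S b ∪ S' b) then decide (i ∈ B.biUnion on) else x i with hx'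
  refine ⟨x', fun i hi => by simp only [hx', if_pos hi], fun i hi => ?_, fun d => ?_⟩
  · rw [Finset.mem_union, not_or] at hi
    simp only [hx', if_neg hi.1, if_neg hi.2]
  have hblock : ∀ b ∈ B, ∑ i ∈ S b ∪ S' b, (if x' i then v i d else 0) =
      ∑ i ∈ S' b, v i d + if b.2 < f b.1 then u b.1 d else 0 := by
    intro b hb
    have hval : ∀ i ∈ S b ∪ S' b, (if x' i then v i d else 0) = if i ∈ on b then v i d else 0 := by
      intro i hi
      have hiU : i ∈ B.biUnion (fun b => S b ∪ S' b) := Finset.mem_biUnion.2 ⟨b, hb, hi⟩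
      have hiI : i ∉ I := fun h => (Finset.disjoint_left.1 hdI h) hiU
      have : (i ∈ B.biUnion on) ↔ i ∈ on b := by
        rw [Finset.mem_biUnion]
        refine ⟨?_, fun h => ⟨b, hb, h⟩⟩
        rintro ⟨b', hb', h⟩
        by_cases hbb : b' = b
        · rwa [← hbb]
        · exact absurd hi (Finset.disjoint_left.1 (h₂ b' hb' b hb hbb) (hsub b' h))
      simp only [hx', if_neg hiI, if_pos hiU, decide_eq_true_eq, this]
    rw [Finset.sum_congr rfl hval, ← Finset.sum_filter, Finset.filter_mem_eq_inter,
      Finset.inter_eq_right.2 (hsub b)]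
    simp only [hon]
    split_ifs
    · rw [(h₁ b hb).2.2 d]; ring
    · ring
  unfold selOn
  simp only [id]
  rw [Finset.sum_union hdI, Finset.sum_biUnion (fun b hb b' hb' hne => h₂ b hb b' hb' hne),
    Finset.sum_congr rfl hblock, Finset.sum_add_distrib, ← add_assoc]
  congr 1
  · congr 1
    refine Finset.sum_congr rfl fun i hi => ?_
    simp only [hx', if_pos hi]
  · rw [hB, Finset.sum_product]
    refine Finset.sum_congr rfl fun t _ => ?_
    dsimp only
    rw [← Finset.sum_filter, Finset.sum_const, nsmul_eq_mul]
    congr 2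
    have : (range m).filter (fun j => j < f t) = range (f t) := by
      ext j; simp only [Finset.mem_filter, Finset.mem_range]
      exact ⟨fun h => h.2, fun h => ⟨h.trans_le (hf t), h⟩⟩
    rw [this, Finset.card_range]

theorem exists_prodPr_pattern_ge (D C k : ℕ) {γ κ ε : ℝ} (hγ : 0 < γ) (hκ : 0 < κ) (hκ1 : κ ≤ 1)
    (hε : 0 < ε) : ∃ η > 0, ∃ n₀ : ℕ, ∀ n : ℕ, n₀ ≤ n →
      ∀ (R : Fin D → ℝ) (v : Fin n → Fin D → ℤ), Tame γ C k R v →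
      ∀ p : Fin n → Bool → ℝ, IsWeights p → (∀ i j, κ ≤ p i j) →
      ∀ z : Fin D → ℤ, (∀ d, ∑ i, p i true * v i d = z d) →
      ∀ (I : Finset (Fin n)) (pat : Fin n → Bool), (I.card : ℝ) ≤ η * n →
      Real.exp (-(ε * n)) ≤ prodPr p {a | (∀ i ∈ I, a i = pat i) ∧ ∀ d, bEval v a d = z d} := by
  have hsel : ∀ f : Bool → ℝ, selPr (id : Bool → Bool) f = f true := fun f => by simp [selPr]
  obtain ⟨η, hη, hηγ, hη1, τ, hτ, hτκ, hland⟩ := landing_asymptotic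
    (e := (id : Bool → Bool)) (χ := fun b => if b then 1 else -1)
    (fun j => by split_ifs <;> simp) (by simp) (by rw [hsel]; simp) D C k hγ hκ hκ1 hε
  set T := D * (2 * C + 1) with hT
  set c₁ : ℝ := η / 2 / (k * T + 1) with hc₁
  have hc₁0 : 0 < c₁ := by positivity
  have hc₁η : c₁ ≤ η := (div_le_self (by positivity) (by
    have : (0 : ℝ) ≤ k * T := by positivity
    linarith)).trans (by linarith)
  have hc₁K : (k : ℝ) * T * c₁ ≤ η / 2 := by
    have h1 : (k * T + 1) * c₁ = η / 2 := by rw [hc₁]; field_simp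
    linarith
  obtain ⟨n₀, hn₀⟩ := hland c₁ hc₁0 hc₁η
  obtain ⟨n₁, hn₁⟩ := exists_forall_le_mul hc₁0 2
  obtain ⟨n₂, hn₂⟩ := exists_forall_le_mul (show 0 < c₁ ^ 2 / 4 by positivity) 1
  refine ⟨η / 2, by positivity, n₀ + n₁ + n₂, fun n hn R v hV p hp hκp z hz I pat hI => ?_⟩
  replace hn₁ := hn₁ n (by omega)
  replace hn₂ := hn₂ n (by omega)
  have hnr0 : (0 : ℝ) ≤ n := Nat.cast_nonneg n
  have hR0 : ∀ d, 0 < R d := fun d => by linarith [hV.one_le d]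
  set m := ⌊c₁ * n⌋₊ with hm
  have hm1 : (m : ℝ) ≤ c₁ * n := Nat.floor_le (by positivity)
  have hm2 : c₁ * n < m + 1 := Nat.lt_floor_add_one _
  have hm3 : c₁ * n / 2 ≤ m := by linarith
  have hmsq : n ≤ m ^ 2 := by
    have h1 : (n : ℝ) ≤ (m : ℝ) ^ 2 := by
      have h2 : (c₁ * n / 2) ^ 2 ≤ (m : ℝ) ^ 2 := pow_le_pow_left₀ (by positivity) hm3 2
      have h3 := mul_le_mul_of_nonneg_right hn₂ hnr0
      nlinarith
    exact_mod_cast h1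
  set τs := Fin D × Fin (2 * C + 1)
  have hcardτ : Fintype.card τs = T := by simp [τs, hT]
  have hkT : (k : ℝ) * (T * m : ℕ) ≤ η / 2 * n := by
    push_cast
    have h1 := mul_le_mul_of_nonneg_left hm1 (show (0 : ℝ) ≤ k * T by positivity)
    have h2 := mul_le_mul_of_nonneg_right hc₁K hnr0
    linarith
  have hBcard : ((univ : Finset τs) ×ˢ range m).card = T * m := by
    rw [Finset.card_product, Finset.card_range, Finset.card_univ, hcardτ]
  obtain ⟨S, S', hS₁, hS₂⟩ := hV.gen.exists_blocks hR0
    ((univ : Finset τs) ×ˢ range m) (fun x => boxVec R m C x.1)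
    (fun x d => abs_boxVec_le hR0 m C x.1 d) I (by
      rw [hBcard]
      have := mul_le_mul_of_nonneg_right hηγ hnr0
      have : 0 ≤ γ * n := by positivity
      linarith)
  obtain ⟨c, hc⟩ := exists_selOn_blocks (v := v) I pat (u := boxVec R m C)
    (fun b hb => ⟨(hS₁ b hb).1, (hS₁ b hb).2.1, (hS₁ b hb).2.2.2⟩) hS₂
  set U := I ∪ ((univ : Finset τs) ×ˢ range m).biUnion (fun b => S b ∪ S' b) with hU
  have hUcard : (U.card : ℝ) ≤ η * n := by
    have h1 : U.card ≤ I.card + T * m * k := by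
      refine (Finset.card_union_le _ _).trans (Nat.add_le_add_left ?_ _)
      rw [← hBcard]
      exact Finset.card_biUnion_le_card_mul _ _ _ fun b hb => (hS₁ b hb).2.2.1
    have h2 : (U.card : ℝ) ≤ I.card + T * m * k := by exact_mod_cast h1
    push_cast at hkT
    linarith
  have hcR : ∀ d, |(c d : ℝ)| ≤ U.card * R d := by
    intro d
    obtain ⟨x', -, -, hx'⟩ := hc (fun _ => true) (fun _ => 0) (fun _ => Nat.zero_le _)
    have := abs_selOn_le hV.abs_le id U x' d
    rw [hx' d] at this
    simpa using this
  have hfin := hn₀ n (by omega) R v hV p hp hκp z (by simpa only [hsel] using hz) U c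
    Set.univ {a | ∀ i ∈ I, a i = pat i} 1 hUcard hcR
    (by
      push_cast
      have : 0 ≤ 4 * (c₁ / 50) * n := by positivity
      linarith)
    (by
      rintro q' hq' -
      have : {x : Fin n → Bool | ∀ y ∈ Set.univ, ((1 : ℕ) : ℝ) ≤ hammingDist x y} = ∅ := by
        rw [Set.eq_empty_iff_forall_notMem]
        intro x hx
        have := (show ∀ y ∈ Set.univ, ((1 : ℕ) : ℝ) ≤ hammingDist x y from hx) x (Set.mem_univ x)
        norm_num at this
      rw [this, prodPr_empty]; norm_num)
    (by
      intro x hx y hy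
      obtain ⟨f, hf, hfy⟩ := exists_sum_boxVec hV.one_le hV.le_pow hmsq (fun d => y d - c d)
        (fun d => by have := (hy d).1; linarith) (fun d => by have := (hy d).2; linarith)
      obtain ⟨x', h1, h2, h3⟩ := hc x f hf
      refine ⟨x', h1, h2, fun d => ?_⟩
      rw [h3 d]
      have := congrFun hfy d
      simp only [Finset.sum_apply, Pi.smul_apply, smul_eq_mul] at this
      linarith)
  refine hfin.trans (hp.prodPr_mono ?_)
  rintro x ⟨hx, hd⟩
  exact ⟨hx, fun d => by rw [← hd d]; rfl⟩

end Pattern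

section Critical

variable {n : ℕ} {J E : Type*} [Fintype J] [Fintype E]

/-- The log-partition function of the exponential family with features `x`, tilted to mean `ζ`. -/
def logPart (x : Fin n → J → E → ℝ) (ζ y : E → ℝ) : ℝ :=
  ∑ i, Real.log (∑ j, Real.exp (∑ e, y e * x i j e)) - ∑ e, y e * ζ e

/-- The product measure of the exponential family with features `x` and parameter `y`. -/
def gibbs (x : Fin n → J → E → ℝ) (y : E → ℝ) (i : Fin n) (j : J) : ℝ :=
  Real.exp (∑ e, y e * x i j e) / ∑ j', Real.exp (∑ e, y e * x i j' e)

variable [Nonempty J]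

lemma sum_exp_pos (f : J → ℝ) : 0 < ∑ j, Real.exp (f j) :=
  Finset.sum_pos (fun _ _ => Real.exp_pos _) univ_nonempty

lemma isWeights_gibbs (x : Fin n → J → E → ℝ) (y : E → ℝ) : IsWeights (gibbs x y) where
  nonneg i j := div_nonneg (Real.exp_pos _).le (sum_exp_pos _).le
  sum_one i := by
    unfold gibbs
    rw [← Finset.sum_div, div_self (sum_exp_pos _).ne']

lemma prodWt_gibbs {x : Fin n → J → E → ℝ} {ζ y : E → ℝ} {a : Fin n → J}
    (ha : ∀ e, ∑ i, x i (a i) e = ζ e) : prodWt (gibbs x y) a = Real.exp (-logPart x ζ y) := by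
  have h1 : ∑ e, y e * ζ e = ∑ i, ∑ e, y e * x i (a i) e := by
    rw [Finset.sum_comm]
    exact Finset.sum_congr rfl fun e _ => by rw [← ha e, Finset.mul_sum]
  unfold prodWt logPart gibbs
  rw [h1, ← Finset.sum_sub_distrib, ← Finset.sum_neg_distrib, Real.exp_sum]
  refine Finset.prod_congr rfl fun i _ => ?_
  rw [neg_sub, Real.exp_sub, Real.exp_log (sum_exp_pos _)]

lemma le_gibbs {x : Fin n → J → E → ℝ} {y : E → ℝ} {M B : ℝ} (hM : 0 ≤ M)
    (hx : ∀ i j e, |x i j e| ≤ B) (hy : ∀ e, |y e| ≤ M) (i : Fin n) (j : J) :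
    Real.exp (-(2 * (Fintype.card E * (M * B)))) / Fintype.card J ≤ gibbs x y i j := by
  set L : ℝ := Fintype.card E * (M * B) with hL
  have hb : ∀ j, |∑ e, y e * x i j e| ≤ L := fun j => by
    refine (Finset.abs_sum_le_sum_abs _ _).trans ?_
    refine (Finset.sum_le_card_nsmul _ _ (M * B) fun e _ => ?_).trans (by
      rw [nsmul_eq_mul, Finset.card_univ])
    rw [abs_mul]
    exact mul_le_mul (hy e) (hx i j e) (abs_nonneg _) hM
  have hZ : ∑ j', Real.exp (∑ e, y e * x i j' e) ≤ Fintype.card J * Real.exp L := by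
    refine (Finset.sum_le_card_nsmul _ _ (Real.exp L) fun j _ => ?_).trans (by
      rw [nsmul_eq_mul, Finset.card_univ])
    exact Real.exp_le_exp.2 (abs_le.1 (hb j)).2
  have hJ : (0 : ℝ) < Fintype.card J := by exact_mod_cast Fintype.card_pos
  unfold gibbs
  rw [div_le_div_iff₀ hJ (sum_exp_pos _)]
  calc _ ≤ Real.exp (-(2 * L)) * (Fintype.card J * Real.exp L) :=
        mul_le_mul_of_nonneg_left hZ (Real.exp_pos _).le
    _ = Real.exp (-L) * Fintype.card J := by
        rw [show -L = -(2 * L) + L by ring, Real.exp_add]; ring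
    _ ≤ _ := mul_le_mul_of_nonneg_right (Real.exp_le_exp.2 (abs_le.1 (hb j)).1) hJ.le

lemma continuous_logPart (x : Fin n → J → E → ℝ) (ζ : E → ℝ) : Continuous (logPart x ζ) := by
  unfold logPart
  refine Continuous.sub (continuous_finsetSum _ fun i _ => Continuous.log ?_ fun y =>
    (sum_exp_pos _).ne') (by fun_prop)
  fun_prop

lemma hasDerivAt_logPart [DecidableEq E] (x : Fin n → J → E → ℝ) (ζ y : E → ℝ) (e : E) :
    HasDerivAt (fun t : ℝ => logPart x ζ (y + t • (Pi.single e 1 : E → ℝ)))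
      (∑ i, ∑ j, gibbs x y i j * x i j e - ζ e) 0 := by
  have hlin : ∀ (f : E → ℝ) (t : ℝ), ∑ e', (y + t • (Pi.single e 1 : E → ℝ)) e' * f e' =
      ∑ e', y e' * f e' + t * f e := fun f t => by
    simp [add_mul, Finset.sum_add_distrib, Pi.single_apply]
  have hl : ∀ c b : ℝ, HasDerivAt (fun t : ℝ => c + t * b) b 0 := fun c b => by
    simpa using ((hasDerivAt_id (0 : ℝ)).mul_const b).const_add c
  unfold logPart
  simp only [hlin]
  refine HasDerivAt.sub (HasDerivAt.fun_sum fun i _ => ?_) (hl _ _)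
  have h1 : HasDerivAt (fun t : ℝ => ∑ j, Real.exp (∑ e', y e' * x i j e' + t * x i j e))
      (∑ j, Real.exp (∑ e', y e' * x i j e') * x i j e) 0 := by
    refine HasDerivAt.fun_sum fun j _ => ?_
    have := (hl (∑ e', y e' * x i j e') (x i j e)).exp
    simpa using this
  have h2 := h1.log (by simpa using (sum_exp_pos fun j => ∑ e', y e' * x i j e').ne')
  have h3 : ∑ j, gibbs x y i j * x i j e =
      (∑ j, Real.exp (∑ e', y e' * x i j e') * x i j e) /
        ∑ j, Real.exp (∑ e', y e' * x i j e' + 0 * x i j e) := by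
    simp only [zero_mul, add_zero, gibbs, Finset.sum_div]
    exact Finset.sum_congr rfl fun j _ => by ring
  rw [h3]
  exact h2

/-- Either the exponential family attains the mean `ζ` at a bounded parameter, or some large tilt `y`
certifies that every configuration `a` has `⟨y, x(a)⟩` at most `⟨y, ζ⟩` up to an entropy term. -/
theorem exists_critical (x : Fin n → J → E → ℝ) (ζ : E → ℝ) {M B : ℝ} (hM : 0 < M)
    (hx : ∀ i j e, |x i j e| ≤ B) :
    (∃ y : E → ℝ, (∀ e, |y e| ≤ M) ∧ (∃ e, |y e| = M) ∧
      ∀ a : Fin n → J, ∑ i, ∑ e, y e * x i (a i) e ≤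
        ∑ e, y e * ζ e + n * Real.log (Fintype.card J)) ∨
    ∃ (q : Fin n → J → ℝ) (h : ℝ), IsWeights q ∧
      (∀ i j, Real.exp (-(2 * (Fintype.card E * (M * B)))) / Fintype.card J ≤ q i j) ∧
      (∀ e, ∑ i, ∑ j, q i j * x i j e = ζ e) ∧
      (∀ a, (∀ e, ∑ i, x i (a i) e = ζ e) → prodWt q a = Real.exp (-h)) ∧
      ∀ i j j', x i j = x i j' → q i j = q i j' := by
  classical
  obtain ⟨y, hyM, hy⟩ := (isCompact_closedBall (0 : E → ℝ) M).exists_isMinOn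
    ⟨0, Metric.mem_closedBall_self hM.le⟩ (continuous_logPart x ζ).continuousOn
  rw [mem_closedBall_zero_iff] at hyM
  have hye : ∀ e, |y e| ≤ M := fun e => (norm_le_pi_norm y e).trans hyM
  rcases hyM.lt_or_eq with hlt | heq
  · right
    refine ⟨gibbs x y, logPart x ζ y, isWeights_gibbs x y, le_gibbs hM.le hx hye, fun e => ?_,
      fun a ha => prodWt_gibbs ha, fun i j j' h => by unfold gibbs; rw [h]⟩
    have hloc : IsLocalMin (logPart x ζ) y :=
      hy.isLocalMin (Metric.closedBall_mem_nhds_of_mem (by simpa using hlt))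
    have hloc' : IsLocalMin (fun t : ℝ => logPart x ζ (y + t • (Pi.single e 1 : E → ℝ))) 0 := by
      have hcont : Filter.Tendsto (fun t : ℝ => y + t • (Pi.single e 1 : E → ℝ)) (nhds 0)
          (nhds y) := by
        have : Continuous (fun t : ℝ => y + t • (Pi.single e 1 : E → ℝ)) := by fun_prop
        simpa using this.tendsto 0
      have := hcont.eventually hloc
      refine this.mono fun t ht => ?_
      simpa using ht
    have := hloc'.hasDerivAt_eq_zero (hasDerivAt_logPart x ζ y e)
    linarith
  · left
    have hne : Nonempty E := by
      by_contra h
      rw [not_nonempty_iff] at h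
      have : ‖y‖ = 0 := by rw [Subsingleton.elim y 0, norm_zero]
      linarith
    refine ⟨y, hye, ?_, fun a => ?_⟩
    · obtain ⟨e, he⟩ := Finite.exists_max (fun e => |y e|)
      refine ⟨e, le_antisymm (hye e) ?_⟩
      rw [← heq]
      exact (pi_norm_le_iff_of_nonneg (abs_nonneg _)).2 he
    · have h0 : logPart x ζ y ≤ logPart x ζ 0 := hy (Metric.mem_closedBall_self hM.le)
      have h1 : logPart x ζ 0 = n * Real.log (Fintype.card J) := by simp [logPart]
      have h2 : ∑ i, ∑ e, y e * x i (a i) e ≤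
          ∑ i, Real.log (∑ j, Real.exp (∑ e, y e * x i j e)) := by
        refine Finset.sum_le_sum fun i _ => ?_
        rw [Real.le_log_iff_exp_le (sum_exp_pos _)]
        exact Finset.single_le_sum (f := fun j => Real.exp (∑ e, y e * x i j e))
          (fun j _ => (Real.exp_pos _).le) (mem_univ (a i))
      unfold logPart at h0 h1
      linarith

end Critical

section Generic

variable {n D : ℕ}

lemma abs_det_mul_le {A : Matrix (Fin D) (Fin D) ℝ} (hA : ∀ i j, |A i j| ≤ 1) {b : Fin D → ℝ} {g : ℝ}
    (hb : ∀ i, |∑ j, A i j * b j| ≤ g) (d : Fin D) : |A.det| * |b d| ≤ D * D.factorial * g := by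
  have hadj : ∀ i j, |A.adjugate i j| ≤ D.factorial := fun i j => by
    rw [Matrix.adjugate_apply]
    have := Matrix.det_le (A := A.updateRow j (Pi.single i 1)) (abv := AbsoluteValue.abs) (x := 1)
      (fun a c => by
        rw [Matrix.updateRow_apply]
        split_ifs
        · rw [Pi.single_apply]
          split_ifs <;> simp
        · exact hA a c)
    simpa using this
  have h1 : A.det * b d = ∑ i, A.adjugate d i * ∑ j, A i j * b j := by
    have h2 : A.adjugate.mulVec (A.mulVec b) = A.det • b := by
      rw [Matrix.mulVec_mulVec, Matrix.adjugate_mul, Matrix.smul_mulVec, Matrix.one_mulVec]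
    have := congrFun h2 d
    simp only [Matrix.mulVec, dotProduct, Pi.smul_apply, smul_eq_mul] at this
    exact this.symm
  rw [← abs_mul, h1]
  refine (Finset.abs_sum_le_sum_abs _ _).trans ?_
  refine (Finset.sum_le_card_nsmul _ _ (D.factorial * g) fun i _ => ?_).trans (by
    rw [nsmul_eq_mul, Finset.card_univ, Fintype.card_fin]; exact le_of_eq (by ring))
  rw [abs_mul]
  exact mul_le_mul (hadj d i) (hb i) (abs_nonneg _) (Nat.cast_nonneg _)

lemma RobustlyGeneric.card_small_le {γ' γ : ℝ} {R : Fin D → ℝ} {v : Fin n → Fin D → ℤ}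
    (hgen : RobustlyGeneric γ' γ R v) (hγ : 0 < γ) (hR : ∀ d, 0 < R d)
    (hv : ∀ i d, |(v i d : ℝ)| ≤ R d) {b : Fin D → ℝ} {N : ℝ} (hN : 0 < N) (hb : ∃ d, N ≤ |b d|) :
    ((univ.filter fun i => |∑ d, b d * (v i d / R d)| < γ / (D * D.factorial + 1) * N).card : ℝ) ≤
      γ' * n := by
  by_contra! h
  obtain ⟨d, hd⟩ := hb
  obtain ⟨e, -, he, hdet⟩ := hgen _ h
  set A : Matrix (Fin D) (Fin D) ℝ := Matrix.of fun i j => (v (e i) j / R j : ℝ) with hA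
  have hdA : γ ≤ |A.det| := by
    have h1 : (Matrix.of fun d d' : Fin D => ((v (e d) d' : ℝ))) =
        Matrix.of fun i j => R j * A i j := by
      ext i j
      simp only [hA, Matrix.of_apply]
      rw [mul_div_cancel₀ _ (hR j).ne']
    have hP : 0 < ∏ d, R d := Finset.prod_pos fun d _ => hR d
    rw [h1, Matrix.det_mul_row, abs_mul, abs_of_pos hP, mul_comm γ] at hdet
    exact le_of_mul_le_mul_left hdet hP
  have h2 := abs_det_mul_le (A := A) (b := b) (g := γ / (D * D.factorial + 1) * N) (fun i j => by
    simp only [hA, Matrix.of_apply]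
    rw [abs_div, abs_of_pos (hR j), div_le_one (hR j)]
    exact hv _ j) (fun i => by
      have := (Finset.mem_filter.1 (he i)).2
      simp only [hA, Matrix.of_apply]
      refine le_of_lt (lt_of_eq_of_lt ?_ this)
      congr 1
      exact Finset.sum_congr rfl fun j _ => mul_comm _ _) d
  have h3 : γ * N ≤ |A.det| * |b d| := mul_le_mul hdA hd hN.le (abs_nonneg _)
  have h4 : (D * D.factorial + 1) * (γ / (D * D.factorial + 1) * N) = γ * N := by
    field_simp
  have h5 : 0 < γ / (D * D.factorial + 1) * N := by positivity
  nlinarith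

lemma RobustlyGeneric.one_le {γ' γ : ℝ} {R : Fin D → ℝ} {v : Fin n → Fin D → ℤ}
    (hgen : RobustlyGeneric γ' γ R v) (hγ : 0 < γ) (hγ' : γ' < 1) (hn : 0 < n) (hR : ∀ d, 0 < R d)
    (hv : ∀ i d, |(v i d : ℝ)| ≤ R d) (d : Fin D) : 1 ≤ R d := by
  by_contra! h
  have hz : ∀ i, v i d = 0 := fun i => by
    have h1 : |(v i d : ℝ)| < 1 := (hv i d).trans_lt h
    rw [← Int.cast_abs] at h1
    exact Int.abs_lt_one_iff.1 (by exact_mod_cast h1)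
  obtain ⟨e, -, -, hdet⟩ := hgen univ (by
    have : (0 : ℝ) < n := by exact_mod_cast hn
    rw [Finset.card_univ, Fintype.card_fin]
    nlinarith)
  rw [Matrix.det_eq_zero_of_column_eq_zero d (fun i => by simp [hz]), abs_zero] at hdet
  have : 0 < γ * ∏ d, R d := mul_pos hγ (Finset.prod_pos fun d _ => hR d)
  linarith

end Generic

section Unbounded

variable {n D : ℕ}

lemma prodPr_eq_sum_toFinset {J : Type*} [Fintype J] (q : Fin n → J → ℝ) (S : Set (Fin n → J))
    [Fintype S] : prodPr q S = ∑ a ∈ S.toFinset, prodWt q a := by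
  classical
  unfold prodPr
  simp only [Set.indicator_apply]
  rw [← Finset.sum_filter]
  congr 1
  ext a
  simp

lemma prodPr_eq_ncard_mul {J : Type*} [Fintype J] {q : Fin n → J → ℝ} {S : Set (Fin n → J)} {c : ℝ}
    (h : ∀ a ∈ S, prodWt q a = c) : prodPr q S = S.ncard * c := by
  classical
  rw [prodPr_eq_sum_toFinset,
    Finset.sum_congr rfl (g := fun _ => c) (fun a ha => h a (Set.mem_toFinset.1 ha)),
    Finset.sum_const, nsmul_eq_mul, Set.ncard_eq_toFinset_card']

/-- Hamming balls of small relative radius have subexponential size. -/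
lemma exists_ncard_ball_le {ε : ℝ} (hε : 0 < ε) : ∃ ρ > 0, ∀ (n : ℕ) (y : Fin n → Bool),
    (({x | (hammingDist x y : ℝ) ≤ ρ * n} : Set (Fin n → Bool)).ncard : ℝ) ≤ Real.exp (ε * n) := by
  set z : ℝ := min (1 / 2) (ε / 4) with hz
  have hz0 : 0 < z := by positivity
  have hz1 : z ≤ 1 / 2 := min_le_left _ _
  have hzε : z ≤ ε / 4 := min_le_right _ _
  set l : ℝ := -Real.log z with hl
  have hl0 : 0 < l := neg_pos.2 (Real.log_neg hz0 (by linarith))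
  refine ⟨ε / 2 / l, by positivity, fun n y => ?_⟩
  set r := ⌊ε / 2 / l * n⌋₊ with hr
  have hr1 : (r : ℝ) ≤ ε / 2 / l * n := Nat.floor_le (by positivity)
  have h1 : ({x | (hammingDist x y : ℝ) ≤ ε / 2 / l * n} : Set (Fin n → Bool)) =
      ↑(univ.filter fun x : Fin n → Bool => hammingDist x y ≤ r) := by
    ext x
    simp only [Set.mem_ofPred_eq, Finset.coe_filter, Finset.mem_univ, true_and, hr]
    exact (Nat.le_floor_iff (by positivity)).symm
  rw [h1, Set.ncard_coe_finset]
  have h2 := card_ball_mul_pow_le y hz0 (by linarith) r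
  rw [Fintype.card_bool] at h2
  have h3 : (1 + ((2 : ℕ) : ℝ) * z) ^ n ≤ Real.exp (ε / 2 * n) := by
    refine (one_add_pow_le_exp (by positivity) n).trans (Real.exp_le_exp.2 ?_)
    refine mul_le_mul_of_nonneg_right ?_ (Nat.cast_nonneg n)
    push_cast; linarith
  have h4 : Real.exp (-(ε / 2 * n)) ≤ z ^ r := by
    have : z = Real.exp (-l) := by rw [hl, neg_neg, Real.exp_log hz0]
    rw [this, ← Real.exp_nat_mul, Real.exp_le_exp]
    have : (r : ℝ) * l ≤ ε / 2 / l * n * l := mul_le_mul_of_nonneg_right hr1 hl0.le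
    have : ε / 2 / l * n * l = ε / 2 * n := by field_simp
    linarith
  have h5 : ((univ.filter fun x : Fin n → Bool => hammingDist x y ≤ r).card : ℝ) *
      Real.exp (-(ε / 2 * n)) ≤ Real.exp (ε / 2 * n) :=
    (mul_le_mul_of_nonneg_left h4 (Nat.cast_nonneg _)).trans (h2.trans h3)
  rw [Real.exp_neg, ← div_eq_mul_inv, div_le_iff₀ (Real.exp_pos _), ← Real.exp_add] at h5
  exact h5.trans (le_of_eq (by ring_nf))

lemma one_sub_pow_le_exp {x : ℝ} (hx1 : x ≤ 1) (n : ℕ) : (1 - x) ^ n ≤ Real.exp (-(x * n)) := by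
  refine (pow_le_pow_left₀ (by linarith) (Real.one_sub_le_exp_neg x) n).trans (le_of_eq ?_)
  rw [← Real.exp_nat_mul]; ring_nf

lemma caseEmpty_of_exp_le {v : Fin n → Fin D → ℤ} {X B : Set (Fin n → Bool)} {w : Fin D → ℤ} {ε : ℝ}
    (hε1 : ε ≤ 1) (hBX : B ⊆ X) (hB : Real.exp (-(ε * n)) * X.ncard ≤ B.ncard)
    (h : ∀ a ∈ B, ∀ b ∈ B, ¬ ∀ d, bCap v a b d = w d) : CaseEmpty v X w ε := by
  refine ⟨B, hBX, ?_, ?_⟩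
  · have h1 : (1 - ε) ^ n * (X.ncard : ℝ) ≤ ((B.ncard : ℤ) : ℝ) := by
      rw [Int.cast_natCast]
      exact (mul_le_mul_of_nonneg_right (one_sub_pow_le_exp hε1 n) (Nat.cast_nonneg _)).trans hB
    calc _ ≤ ⌊((B.ncard : ℤ) : ℝ)⌋ := Int.floor_le_floor h1
      _ = _ := Int.floor_intCast _
  · rw [Set.eq_empty_iff_forall_notMem]
    rintro ⟨a, b⟩ ⟨ha, hb, hab⟩
    exact h a ha b hb hab

lemma caseEmpty_of_ncard_lt {v : Fin n → Fin D → ℤ} {X : Set (Fin n → Bool)} {w : Fin D → ℤ} {ε : ℝ}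
    (hε1 : ε ≤ 1) (hX : (X.ncard : ℝ) < Real.exp (ε * n)) : CaseEmpty v X w ε := by
  refine ⟨∅, Set.empty_subset _, ?_, ?_⟩
  · have h1 : (1 - ε) ^ n * (X.ncard : ℝ) < 1 := by
      calc _ ≤ Real.exp (-(ε * n)) * X.ncard :=
            mul_le_mul_of_nonneg_right (one_sub_pow_le_exp hε1 n) (Nat.cast_nonneg _)
        _ < Real.exp (-(ε * n)) * Real.exp (ε * n) := mul_lt_mul_of_pos_left hX (Real.exp_pos _)
        _ = 1 := by rw [← Real.exp_add]; simp
    rw [Set.ncard_empty]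
    have : ⌊(1 - ε) ^ n * (X.ncard : ℝ)⌋ < 1 := Int.floor_lt.2 (by exact_mod_cast h1)
    push_cast
    omega
  · rw [Set.eq_empty_iff_forall_notMem]
    rintro ⟨a, b⟩ ⟨ha, -⟩
    exact ha

lemma card_filter_mul_le {ι : Type*} {W : Finset ι} {f : ι → ℝ} {K B : ℝ} (hf : ∀ i ∈ W, 0 ≤ f i)
    (hB : ∑ i ∈ W, f i ≤ B) : ((W.filter fun i => K ≤ f i).card : ℝ) * K ≤ B := by
  refine le_trans ?_ ((Finset.sum_le_sum_of_subset_of_nonneg (Finset.filter_subset (fun i => K ≤ f i) W)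
    fun i hi _ => hf i hi).trans hB)
  rw [← nsmul_eq_mul]
  exact Finset.card_nsmul_le_sum _ _ _ fun i hi => (Finset.mem_filter.1 hi).2

/-- A product measure which is uniform on `X` and has the right mean. -/
structure Fits (κ h : ℝ) (v : Fin n → Fin D → ℤ) (z : Fin D → ℤ) (r : Fin n → Bool → ℝ) : Prop where
  weights : IsWeights r
  le : ∀ i j, κ ≤ r i j
  mean : ∀ d, ∑ i, r i true * v i d = z d
  wt : ∀ a, (∀ d, bEval v a d = z d) → prodWt r a = Real.exp (-h)

theorem caseEmpty_or_fits (D : ℕ) {ε : ℝ} (hε : 0 < ε) (hε1 : ε ≤ 1) :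
    ∃ θ > 0, ∀ γ γ' : ℝ, 0 < γ → γ' ≤ θ → ∃ κ > 0, κ ≤ 1 ∧ ∀ n > 0,
      ∀ (R : Fin D → ℝ) (v : Fin n → Fin D → ℤ), (∀ d, 0 < R d) → (∀ i d, |(v i d : ℝ)| ≤ R d) →
      RobustlyGeneric γ' γ R v → ∀ z w : Fin D → ℤ,
      CaseEmpty v {a | ∀ d, bEval v a d = z d} w ε ∨ ∃ h r, Fits κ h v z r := by
  obtain ⟨ρ, hρ, hball⟩ := exists_ncard_ball_le (half_pos hε)
  refine ⟨ρ / 2, by positivity, fun γ γ' hγ hγ' => ?_⟩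
  set c₀ : ℝ := γ / (D * D.factorial + 1) with hc₀
  have hc₀0 : 0 < c₀ := by positivity
  have hlog2 : 0 < Real.log 2 := Real.log_pos one_lt_two
  set M : ℝ := 2 * Real.log 2 / (c₀ * ρ) with hM
  have hM0 : 0 < M := by positivity
  have hcM : ρ / 2 * (c₀ * M) = Real.log 2 := by rw [hM]; field_simp
  refine ⟨Real.exp (-(2 * (Fintype.card (Fin D) * (M * 1)))) / Fintype.card Bool, by
    rw [Fintype.card_bool]; positivity, ?_, fun n hn R v hR hv hgen z w => ?_⟩
  · rw [Fintype.card_bool, div_le_one (by norm_num)]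
    refine (Real.exp_le_one_iff.2 ?_).trans (by norm_num)
    have : 0 ≤ 2 * ((Fintype.card (Fin D) : ℝ) * (M * 1)) := by positivity
    linarith
  have hn0 : (0 : ℝ) < n := by exact_mod_cast hn
  have hmean : ∀ a : Fin n → Bool, (∀ d, bEval v a d = z d) → ∀ d,
      ∑ i, (if a i then (v i d / R d : ℝ) else 0) = z d / R d := by
    intro a ha d
    rw [← ha d, bEval, Int.cast_sum, Finset.sum_div]
    exact Finset.sum_congr rfl fun i _ => by split_ifs <;> simp
  rcases exists_critical (fun (i : Fin n) (j : Bool) (d : Fin D) => if j then (v i d / R d : ℝ) else 0)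
    (fun d => z d / R d) hM0 (B := 1) (fun i j d => by
      split_ifs
      · rw [abs_div, abs_of_pos (hR d), div_le_one (hR d)]; exact hv i d
      · simp) with ⟨y, hyM, ⟨d₀, hd₀⟩, hy⟩ | ⟨q, h, hq, hκq, hq1, hq2, -⟩
  · left
    apply caseEmpty_of_ncard_lt hε1
    set s : Fin n → ℝ := fun i => ∑ d, y d * (v i d / R d) with hs
    set a₀ : Fin n → Bool := fun i => decide (0 < s i) with ha₀
    have hval : ∀ a : Fin n → Bool, ∑ i, ∑ d, y d * (if a i then (v i d / R d : ℝ) else 0) =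
        ∑ i, if a i then s i else 0 := fun a =>
      Finset.sum_congr rfl fun i _ => by split_ifs <;> simp [hs]
    refine lt_of_le_of_lt ?_ (Real.exp_lt_exp.2 (show ε / 2 * n < ε * n by nlinarith))
    refine le_trans ?_ (hball n a₀)
    refine Nat.cast_le.2 (Set.ncard_le_ncard ?_ (Set.toFinite _))
    intro a ha
    replace ha : ∀ d, bEval v a d = z d := ha
    show (hammingDist a a₀ : ℝ) ≤ ρ * n
    have h1 := hy a₀
    have h2 : ∑ d, y d * (z d / R d) = ∑ i, if a i then s i else 0 := by
      rw [← hval a, Finset.sum_comm]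
      exact Finset.sum_congr rfl fun d _ => by rw [← hmean a ha d, Finset.mul_sum]
    rw [hval, h2, Fintype.card_bool] at h1
    have h3 : ∑ i ∈ univ.filter (fun i => a i ≠ a₀ i), |s i| ≤ n * Real.log 2 := by
      rw [Finset.sum_filter]
      have : ∑ i, (if a i ≠ a₀ i then |s i| else 0) =
          ∑ i, (if a₀ i then s i else 0) - ∑ i, if a i then s i else 0 := by
        rw [← Finset.sum_sub_distrib]
        refine Finset.sum_congr rfl fun i _ => ?_
        by_cases hsi : 0 < s i
        · have : a₀ i = true := by simp [ha₀, hsi]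
          rw [this, abs_of_pos hsi]
          cases a i <;> simp
        · have : a₀ i = false := by simp [ha₀, hsi]
          rw [this, abs_of_nonpos (not_lt.1 hsi)]
          cases a i <;> simp
      rw [this]
      push_cast at h1
      linarith
    have h4 := card_filter_mul_le (K := c₀ * M) (fun i _ => abs_nonneg (s i)) h3
    have h5 := hgen.card_small_le hγ hR hv hM0 ⟨d₀, hd₀.ge⟩
    have h6 : (hammingDist a a₀ : ℝ) ≤
        ((univ.filter (fun i => a i ≠ a₀ i)).filter fun i => c₀ * M ≤ |s i|).card +
        (univ.filter fun i => |s i| < c₀ * M).card := by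
      have : hammingDist a a₀ ≤
        (((univ.filter (fun i => a i ≠ a₀ i)).filter fun i => c₀ * M ≤ |s i|) ∪
        (univ.filter fun i => |s i| < c₀ * M)).card := by
        unfold hammingDist
        refine Finset.card_le_card fun i hi => ?_
        simp only [Finset.mem_union, Finset.mem_filter, Finset.mem_univ, true_and] at hi ⊢
        rcases le_or_gt (c₀ * M) (|s i|) with h | h
        exacts [Or.inl ⟨hi, h⟩, Or.inr h]
      exact_mod_cast this.trans (Finset.card_union_le _ _)
    have h7 : (((univ.filter (fun i => a i ≠ a₀ i)).filter fun i => c₀ * M ≤ |s i|).card : ℝ) ≤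
        ρ / 2 * n := by
      have h8 : 0 < c₀ * M := by positivity
      refine le_of_mul_le_mul_right (h4.trans (le_of_eq ?_)) h8
      rw [← hcM]; ring
    have h9 : γ' * n ≤ ρ / 2 * n := mul_le_mul_of_nonneg_right hγ' hn0.le
    linarith
  · right
    refine ⟨h, q, hq, hκq, fun d => ?_, fun a ha => hq2 a fun d => hmean a ha d⟩
    have := hq1 d
    simp only [Fintype.sum_bool, if_true, Bool.false_eq_true, if_false, mul_zero, add_zero] at this
    rw [eq_div_iff (hR d).ne', Finset.sum_mul] at this
    rw [← this]
    refine Finset.sum_congr rfl fun i _ => ?_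
    rw [mul_assoc, div_mul_cancel₀ _ (hR d).ne']

end Unbounded

section UnboundedPairs

variable {n D : ℕ}

/-- A maximal separated subset of `X` is large. -/
lemma exists_separated {N ρ : ℝ} (hρ : 0 ≤ ρ) (X : Set (Fin n → Bool))
    (hN : ∀ y : Fin n → Bool, (({x | (hammingDist x y : ℝ) ≤ ρ} : Set (Fin n → Bool)).ncard : ℝ) ≤ N) :
    ∃ B ⊆ X, (∀ a ∈ B, ∀ b ∈ B, (hammingDist a b : ℝ) ≤ ρ → a = b) ∧ (X.ncard : ℝ) ≤ B.ncard * N := by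
  classical
  obtain ⟨B, ⟨hBX, hB⟩, hmax⟩ := Set.exists_max_image
    {B : Finset (Fin n → Bool) | (↑B ⊆ X) ∧ ∀ a ∈ B, ∀ b ∈ B, (hammingDist a b : ℝ) ≤ ρ → a = b}
    Finset.card (Set.toFinite _) ⟨∅, by simp, by simp⟩
  refine ⟨B, hBX, hB, ?_⟩
  have hcov : X.toFinset ⊆ B.biUnion fun b => univ.filter fun x => (hammingDist x b : ℝ) ≤ ρ ∨ x = b := by
    intro x hx
    rw [Set.mem_toFinset] at hx
    by_contra hnot
    simp only [Finset.mem_biUnion, Finset.mem_filter, Finset.mem_univ, true_and, not_exists, not_and,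
      not_or, not_le] at hnot
    have hxB : x ∉ B := fun h => (hnot x h).2 rfl
    have := hmax (insert x B) ⟨by
      rw [Finset.coe_insert]; exact Set.insert_subset hx hBX, by
      intro a ha b hb hab
      rcases Finset.mem_insert.1 ha with rfl | ha'
      · rcases Finset.mem_insert.1 hb with rfl | hb'
        · rfl
        · exact absurd hab (not_le.2 (hnot b hb').1)
      · rcases Finset.mem_insert.1 hb with rfl | hb'
        · rw [hammingDist_comm] at hab
          exact absurd hab (not_le.2 (hnot a ha').1)
        · exact hB a ha' b hb' hab⟩
    rw [Finset.card_insert_of_notMem hxB] at this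
    omega
  have hball : ∀ b ∈ B, ((univ.filter fun x => (hammingDist x b : ℝ) ≤ ρ ∨ x = b).card : ℝ) ≤ N := by
    intro b _
    refine le_trans (le_of_eq ?_) (hN b)
    rw [← Set.ncard_coe_finset]
    congr 2
    ext x
    simp only [Finset.coe_filter, Finset.mem_univ, true_and, Set.mem_ofPred_eq]
    refine ⟨?_, Or.inl⟩
    rintro (h | rfl)
    · exact h
    · simpa using hρ
  have h1 : (X.toFinset.card : ℝ) ≤ ∑ b ∈ B,
      ((univ.filter fun x => (hammingDist x b : ℝ) ≤ ρ ∨ x = b).card : ℝ) := by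
    exact_mod_cast (Finset.card_le_card hcov).trans Finset.card_biUnion_le
  rw [Set.ncard_eq_toFinset_card', Set.ncard_coe_finset]
  exact h1.trans ((Finset.sum_le_card_nsmul _ _ _ hball).trans (by rw [nsmul_eq_mul]))

/-- A product measure on pairs, symmetric in the two coordinates, which is uniform on the pairs over
`z` with intersection over `w`, and has the right means. -/
structure PairFits (κ h : ℝ) (v : Fin n → Fin D → ℤ) (z w : Fin D → ℤ)
    (q : Fin n → Bool × Bool → ℝ) : Prop where
  weights : IsWeights q
  le : ∀ i j, κ ≤ q i j
  symm : ∀ i, q i (true, false) = q i (false, true)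
  mean : ∀ d, ∑ i, (q i (true, true) + q i (true, false)) * v i d = z d
  mean_cap : ∀ d, ∑ i, q i (true, true) * v i d = w d
  wt : ∀ x : Fin n → Bool × Bool, (∀ d, bEval v (fun i => (x i).1) d = z d) →
    (∀ d, bEval v (fun i => (x i).2) d = z d) →
    (∀ d, bCap v (fun i => (x i).1) (fun i => (x i).2) d = w d) → prodWt q x = Real.exp (-h)

/-- The features of a pair: its sum and its intersection. -/
def pairFeat (x : Fin D → ℝ) (j : Bool × Bool) : Fin D ⊕ Fin D → ℝ :=
  Sum.elim (fun d => (if j.1 then x d else 0) + if j.2 then x d else 0)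
    (fun d => if j.1 ∧ j.2 then x d else 0)

/-- The value of a pair under a linear functional of its features. -/
def pairPay (s t : ℝ) (j : Bool × Bool) : ℝ :=
  (if j.1 then s else 0) + (if j.2 then s else 0) + if j.1 ∧ j.2 then t else 0

lemma sum_mul_pairFeat (y : Fin D ⊕ Fin D → ℝ) (x : Fin D → ℝ) (j : Bool × Bool) :
    ∑ e, y e * pairFeat x j e =
      pairPay (∑ d, y (Sum.inl d) * x d) (∑ d, y (Sum.inr d) * x d) j := by
  obtain ⟨a, b⟩ := j
  cases a <;> cases b <;> simp [pairFeat, pairPay, mul_add, Finset.sum_add_distrib]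

lemma abs_pairFeat_le {x : Fin D → ℝ} (hx : ∀ d, |x d| ≤ 1) (j : Bool × Bool) (e : Fin D ⊕ Fin D) :
    |pairFeat x j e| ≤ 2 := by
  obtain ⟨a, b⟩ := j
  rcases e with d | d <;> cases a <;> cases b <;> simp [pairFeat] <;>
    first
    | linarith [hx d]
    | exact (abs_add_le _ _).trans (by linarith [hx d])

/-- If a tilt penalises every pair over `z` with intersection over `w` by at most `B`, then few
coordinates carry a penalty of at least `K`. -/
lemma card_mul_le_of_pairPay {s t : Fin n → ℝ} {x : Fin n → Bool × Bool} {B K : ℝ}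
    (hx : ∀ x' : Fin n → Bool × Bool, ∑ i, pairPay (s i) (t i) (x' i) ≤ ∑ i, pairPay (s i) (t i) (x i) + B)
    (W : Finset (Fin n)) (j : Fin n → Bool × Bool)
    (hW : ∀ i ∈ W, K ≤ pairPay (s i) (t i) (j i) - pairPay (s i) (t i) (x i)) : W.card * K ≤ B := by
  have h1 := hx fun i => if i ∈ W then j i else x i
  have h2 : ∑ i, pairPay (s i) (t i) (if i ∈ W then j i else x i) - ∑ i, pairPay (s i) (t i) (x i) =
      ∑ i ∈ W, (pairPay (s i) (t i) (j i) - pairPay (s i) (t i) (x i)) := by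
    rw [← Finset.sum_sub_distrib, ← Finset.sum_subset (Finset.subset_univ W)]
    · exact Finset.sum_congr rfl fun i hi => by rw [if_pos hi]
    · intro i _ hi
      rw [if_neg hi, sub_self]
  have h3 := Finset.card_nsmul_le_sum _ _ _ hW
  rw [nsmul_eq_mul] at h3
  linarith

lemma mean_pairFeat {R : Fin D → ℝ} {v : Fin n → Fin D → ℤ} {z w : Fin D → ℤ}
    {x : Fin n → Bool × Bool} (h₁ : ∀ d, bEval v (fun i => (x i).1) d = z d)
    (h₂ : ∀ d, bEval v (fun i => (x i).2) d = z d)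
    (h₃ : ∀ d, bCap v (fun i => (x i).1) (fun i => (x i).2) d = w d) (e : Fin D ⊕ Fin D) :
    ∑ i, pairFeat (fun d => (v i d / R d : ℝ)) (x i) e =
      Sum.elim (fun d => (2 * z d / R d : ℝ)) (fun d => (w d / R d : ℝ)) e := by
  rcases e with d | d
  · simp only [pairFeat, Sum.elim_inl]
    rw [Finset.sum_add_distrib, two_mul, add_div]
    nth_rewrite 1 [← h₁ d]
    rw [← h₂ d]
    simp only [bEval, Int.cast_sum, Finset.sum_div]
    congr 1 <;> exact Finset.sum_congr rfl fun i _ => by split_ifs <;> simp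
  · simp only [pairFeat, Sum.elim_inr]
    rw [← h₃ d]
    simp only [bCap, Int.cast_sum, Finset.sum_div]
    exact Finset.sum_congr rfl fun i _ => by split_ifs <;> simp

/-- Fixing few coordinates keeps most of `X`. -/
lemma Fits.caseEmpty_of_pattern {κ h ε : ℝ} {v : Fin n → Fin D → ℤ} {z w : Fin D → ℤ}
    {r : Fin n → Bool → ℝ} (hr : Fits κ h v z r) (hε1 : ε ≤ 1) {I : Finset (Fin n)}
    {pat : Fin n → Bool}
    (hI : Real.exp (-(ε * n)) ≤ prodPr r {a | (∀ i ∈ I, a i = pat i) ∧ ∀ d, bEval v a d = z d})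
    (hp : ∀ x : Fin n → Bool × Bool, (∀ d, bEval v (fun i => (x i).1) d = z d) →
      (∀ d, bEval v (fun i => (x i).2) d = z d) →
      (∀ d, bCap v (fun i => (x i).1) (fun i => (x i).2) d = w d) →
      ¬ ∀ i ∈ I, x i = (pat i, pat i)) : CaseEmpty v {a | ∀ d, bEval v a d = z d} w ε := by
  have hpos := Real.exp_pos (-h)
  refine caseEmpty_of_exp_le hε1 (B := {a | (∀ i ∈ I, a i = pat i) ∧ ∀ d, bEval v a d = z d})
    (fun a ha => ha.2) ?_ ?_
  · rw [prodPr_eq_ncard_mul (c := Real.exp (-h)) fun a ha => hr.wt a ha.2] at hI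
    have h1 := hr.weights.prodPr_le_one {a | ∀ d, bEval v a d = z d}
    rw [prodPr_eq_ncard_mul (S := {a | ∀ d, bEval v a d = z d}) (c := Real.exp (-h))
      fun a ha => hr.wt a ha] at h1
    refine le_of_mul_le_mul_right ?_ hpos
    rw [mul_assoc]
    exact (mul_le_of_le_one_right (Real.exp_pos _).le h1).trans hI
  · rintro a ⟨ha, ha'⟩ b ⟨hb, hb'⟩ hab
    exact hp (fun i => (a i, b i)) ha' hb' hab fun i hi => Prod.ext (ha i hi) (hb i hi)

lemma bCap_self (v : Fin n → Fin D → ℤ) (a : Fin n → Bool) (d : Fin D) :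
    bCap v a a d = bEval v a d := by
  simp [bCap, bEval]

theorem caseEmpty_or_pairFits (D C k : ℕ) {ε : ℝ} (hε : 0 < ε) (hε1 : ε ≤ 1) :
    ∃ θ > 0, ∀ γ γ' κ₀ : ℝ, 0 < γ → γ' ≤ θ → 0 < κ₀ → κ₀ ≤ 1 → ∃ κ > 0, κ ≤ 1 ∧ ∃ n₀ : ℕ,
      ∀ n : ℕ, n₀ ≤ n → ∀ (R : Fin D → ℝ) (v : Fin n → Fin D → ℤ), Tame γ C k R v →
      RobustlyGeneric γ' γ R v → ∀ z w : Fin D → ℤ, z ≠ w → ∀ h r, Fits κ₀ h v z r →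
      CaseEmpty v {a | ∀ d, bEval v a d = z d} w ε ∨ ∃ h' q, PairFits κ h' v z w q := by
  obtain ⟨ρ, hρ, hball⟩ := exists_ncard_ball_le hε
  refine ⟨min (1 / 2) (ρ / 4), by positivity, fun γ γ' κ₀ hγ hγ' hκ₀ hκ₀1 => ?_⟩
  obtain ⟨η₀, hη₀, n₀, hpat⟩ := exists_prodPr_pattern_ge D C k hγ hκ₀ hκ₀1 hε
  set η : ℝ := min η₀ (min (1 / 2) (ρ / 4)) with hη
  have hη0 : 0 < η := by positivity
  have hηη₀ : η ≤ η₀ := min_le_left _ _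
  have hη2 : η ≤ 1 / 2 := (min_le_right _ _).trans (min_le_left _ _)
  have hηρ : η ≤ ρ / 4 := (min_le_right _ _).trans (min_le_right _ _)
  have hγ2 : γ' ≤ 1 / 2 := hγ'.trans (min_le_left _ _)
  have hγρ : γ' ≤ ρ / 4 := hγ'.trans (min_le_right _ _)
  set c₀ : ℝ := γ / (D * D.factorial + 1) with hc₀
  have hc₀0 : 0 < c₀ := by positivity
  set l : ℝ := Real.log 4 with hl
  have hl0 : 0 < l := Real.log_pos (by norm_num)
  set K : ℝ := 3 * l / η with hK
  have hK0 : 0 < K := by positivity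
  have hKη : η * K = 3 * l := by rw [hK]; field_simp
  set s₀ : ℝ := min (1 / 4) (c₀ / (2 * (D + 1))) with hs₀
  have hs₀0 : 0 < s₀ := by positivity
  have hs₀4 : s₀ ≤ 1 / 4 := min_le_left _ _
  have hs₀D : D * s₀ ≤ c₀ / 2 := by
    have : s₀ ≤ c₀ / (2 * (D + 1)) := min_le_right _ _
    rw [le_div_iff₀ (by positivity)] at this
    linarith
  set M : ℝ := K / (c₀ * s₀) with hM
  have hM0 : 0 < M := by positivity
  have hMK : c₀ * (s₀ * M) = K := by rw [hM]; field_simp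
  have hMK4 : K ≤ c₀ * M / 4 := by
    rw [← hMK]
    nlinarith [mul_pos hc₀0 hM0]
  obtain ⟨n₁, hn₁⟩ := exists_forall_le_mul hη0 2
  refine ⟨Real.exp (-(2 * (Fintype.card (Fin D ⊕ Fin D) * (M * 2)))) / Fintype.card (Bool × Bool), by
    have : (0 : ℝ) < Fintype.card (Bool × Bool) := by exact_mod_cast Fintype.card_pos
    positivity, ?_, n₀ + n₁, fun n hn R v hV hgen z w hzw h r hr => ?_⟩
  · rw [div_le_one (by exact_mod_cast Fintype.card_pos)]
    refine (Real.exp_le_one_iff.2 ?_).trans (by norm_num)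
    have : 0 ≤ 2 * ((Fintype.card (Fin D ⊕ Fin D) : ℝ) * (M * 2)) := by positivity
    linarith
  replace hn₁ := hn₁ n (by omega)
  have hn0 : (0 : ℝ) < n := pos_of_mul_pos_right (lt_of_lt_of_le two_pos hn₁) hη0.le
  have hR0 : ∀ d, 0 < R d := fun d => by linarith [hV.one_le d]
  have hx1 : ∀ i d, |(v i d / R d : ℝ)| ≤ 1 := fun i d => by
    rw [abs_div, abs_of_pos (hR0 d), div_le_one (hR0 d)]; exact hV.abs_le i d
  rcases exists_critical (fun (i : Fin n) (j : Bool × Bool) => pairFeat (fun d => (v i d / R d : ℝ)) j)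
    (Sum.elim (fun d => (2 * z d / R d : ℝ)) (fun d => (w d / R d : ℝ))) hM0 (B := 2)
    (fun i j e => abs_pairFeat_le (hx1 i) j e) with ⟨y, hyM, hyE, hy⟩ | ⟨q, h', hq, hκq, hq1, hq2, hq3⟩
  · left
    set s : Fin n → ℝ := fun i => ∑ d, y (Sum.inl d) * (v i d / R d) with hs
    set t : Fin n → ℝ := fun i => ∑ d, y (Sum.inr d) * (v i d / R d) with ht
    have hpen : ∀ x : Fin n → Bool × Bool, (∀ d, bEval v (fun i => (x i).1) d = z d) →
        (∀ d, bEval v (fun i => (x i).2) d = z d) →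
        (∀ d, bCap v (fun i => (x i).1) (fun i => (x i).2) d = w d) →
        ∀ x' : Fin n → Bool × Bool, ∑ i, pairPay (s i) (t i) (x' i) ≤
          ∑ i, pairPay (s i) (t i) (x i) + n * l := by
      intro x h₁ h₂ h₃ x'
      have h4 := hy x'
      have h5 : ∑ e, y e * Sum.elim (fun d => (2 * z d / R d : ℝ)) (fun d => (w d / R d : ℝ)) e =
          ∑ i, pairPay (s i) (t i) (x i) := by
        calc _ = ∑ e, y e * ∑ i, pairFeat (fun d => (v i d / R d : ℝ)) (x i) e :=
              Finset.sum_congr rfl fun e _ => by rw [mean_pairFeat h₁ h₂ h₃]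
          _ = ∑ i, ∑ e, y e * pairFeat (fun d => (v i d / R d : ℝ)) (x i) e := by
              rw [Finset.sum_comm]
              exact Finset.sum_congr rfl fun e _ => Finset.mul_sum _ _ _
          _ = _ := Finset.sum_congr rfl fun i _ => sum_mul_pairFeat _ _ _
      simp only [sum_mul_pairFeat] at h4
      rw [h5] at h4
      simpa [hl] using h4
    -- freezing `η n` coordinates to an expensive pattern
    have hfreeze : ∀ (J : Finset (Fin n)) (pat : Fin n → Bool), η * n ≤ J.card →
        (∀ i ∈ J, ∃ j, K ≤ pairPay (s i) (t i) j - pairPay (s i) (t i) (pat i, pat i)) →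
        CaseEmpty v {a | ∀ d, bEval v a d = z d} w ε := by
      intro J pat hJ hj
      obtain ⟨I, hIJ, hI⟩ := Finset.exists_subset_card_eq
        (show ⌊η * n⌋₊ ≤ J.card by exact_mod_cast (Nat.floor_le (by positivity)).trans hJ)
      refine hr.caseEmpty_of_pattern hε1 (I := I) (pat := pat)
        (hpat n (by omega) R v hV r hr.weights hr.le z hr.mean I pat ?_) fun x h₁ h₂ h₃ hxI => ?_
      · rw [hI]
        exact (Nat.floor_le (by positivity)).trans (mul_le_mul_of_nonneg_right hηη₀ hn0.le)
      · choose! j hj using hj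
        have h4 := card_mul_le_of_pairPay (hpen x h₁ h₂ h₃) I j (K := K) fun i hi => by
          rw [hxI i hi]; exact hj i (hIJ hi)
        rw [hI] at h4
        have h5 : η * n < ⌊η * n⌋₊ + 1 := Nat.lt_floor_add_one _
        have h6 : η * n / 2 ≤ ⌊η * n⌋₊ := by linarith
        have h7 := mul_le_mul_of_nonneg_right h6 hK0.le
        have h8 : η * n / 2 * K = 3 / 2 * (n * l) := by
          calc _ = η * K * n / 2 := by ring
            _ = _ := by rw [hKη]; ring
        have : 0 < n * l := mul_pos hn0 hl0
        linarith
    set g : Fin n → ℝ := fun i => ∑ d, (2 * y (Sum.inl d) + y (Sum.inr d)) * (v i d / R d) with hg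
    have hgst : ∀ i, g i = 2 * s i + t i := fun i => by
      simp only [hg, hs, ht, add_mul, Finset.sum_add_distrib, Finset.mul_sum, mul_assoc]
    have hcompl : ∀ P : Fin n → Prop, ∀ [DecidablePred P], ((univ.filter P).card : ℝ) ≤ γ' * n →
        η * n ≤ ((univ.filter fun i => ¬ P i).card : ℝ) := by
      intro P _ hP
      have h1 := Finset.card_filter_add_card_filter_not (s := (univ : Finset (Fin n))) P
      rw [Finset.card_univ, Fintype.card_fin] at h1
      have h2 : ((univ.filter P).card : ℝ) + (univ.filter fun i => ¬ P i).card = n := by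
        exact_mod_cast h1
      nlinarith
    by_cases hA : ∃ d, s₀ * M ≤ |2 * y (Sum.inl d) + y (Sum.inr d)|
    · have h1 := hgen.card_small_le hγ hR0 hV.abs_le (mul_pos hs₀0 hM0) hA
      refine hfreeze _ (fun i => decide (g i < 0)) (hcompl _ h1) fun i hi => ?_
      have hi' : K ≤ |g i| := by
        have := (Finset.mem_filter.1 hi).2
        rw [← hc₀, hMK] at this
        exact not_lt.1 this
      by_cases hgi : g i < 0
      · refine ⟨(false, false), ?_⟩
        rw [abs_of_neg hgi] at hi'
        have := hgst i
        simp [pairPay, hgi]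
        linarith
      · refine ⟨(true, true), ?_⟩
        rw [abs_of_nonneg (not_lt.1 hgi)] at hi'
        have := hgst i
        simp [pairPay, hgi]
        linarith
    · push Not at hA
      have hMs : s₀ * M ≤ M / 4 := by nlinarith
      have hB : ∃ d, M ≤ |y (Sum.inr d)| := by
        obtain ⟨d | d, hd⟩ := hyE
        · refine ⟨d, ?_⟩
          have h1 := hA d
          have h2 : |2 * y (Sum.inl d)| - |y (Sum.inr d)| ≤ |2 * y (Sum.inl d) + y (Sum.inr d)| := by
            have := abs_sub_abs_le_abs_sub (2 * y (Sum.inl d)) (-y (Sum.inr d))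
            rwa [abs_neg, sub_neg_eq_add] at this
          rw [abs_mul, hd, abs_two] at h2
          linarith
        · exact ⟨d, hd.ge⟩
      have hgle : ∀ i, |g i| ≤ c₀ * M / 2 := fun i => by
        refine (Finset.abs_sum_le_sum_abs _ _).trans ?_
        refine (Finset.sum_le_card_nsmul _ _ (s₀ * M) fun d _ => ?_).trans ?_
        · rw [abs_mul]
          exact (mul_le_of_le_one_right (abs_nonneg _) (hx1 i d)).trans (hA d).le
        · rw [nsmul_eq_mul, Finset.card_univ, Fintype.card_fin]
          nlinarith
      have h1 := hgen.card_small_le hγ hR0 hV.abs_le hM0 hB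
      rw [← hc₀] at h1
      by_cases hneg : η * n ≤ ((univ.filter fun i => t i ≤ -(c₀ * M)).card : ℝ)
      · refine hfreeze _ (fun _ => false) hneg fun i hi => ⟨(true, false), ?_⟩
        have h2 := (Finset.mem_filter.1 hi).2
        have h3 := (abs_le.1 (hgle i)).1
        have h4 := hgst i
        simp [pairPay]
        linarith
      · push Not at hneg
        obtain ⟨B, hBX, hBsep, hBcard⟩ := exists_separated (show 0 ≤ ρ * n by positivity)
          {a | ∀ d, bEval v a d = z d} (hball n)
        refine caseEmpty_of_exp_le hε1 hBX ?_ fun a ha b hb hab => ?_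
        · rw [Real.exp_neg, inv_mul_le_iff₀ (Real.exp_pos _), mul_comm]
          exact hBcard
        · have haz : ∀ d, bEval v a d = z d := hBX ha
          have hbz : ∀ d, bEval v b d = z d := hBX hb
          have hW := card_mul_le_of_pairPay (hpen (fun i => (a i, b i)) haz hbz hab)
            (univ.filter fun i => a i ≠ b i ∧ c₀ * M ≤ t i) (fun _ => (false, false)) (K := K)
            fun i hi => by
              obtain ⟨-, h2, h3⟩ := Finset.mem_filter.1 hi
              have h4 := (abs_le.1 (hgle i)).2
              have h5 := hgst i
              have h6 : pairPay (s i) (t i) (a i, b i) = s i := by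
                revert h2
                cases a i <;> cases b i <;> simp [pairPay]
              rw [h6]
              simp [pairPay]
              linarith
          have hW' : ((univ.filter fun i => a i ≠ b i ∧ c₀ * M ≤ t i).card : ℝ) ≤ η * n := by
            refine le_of_mul_le_mul_right (hW.trans ?_) hK0
            have h8 : η * n * K = 3 * (n * l) := by
              calc _ = η * K * n := by ring
                _ = _ := by rw [hKη]; ring
            have : 0 < n * l := mul_pos hn0 hl0
            linarith
          have hdist : (hammingDist a b : ℝ) ≤ ρ * n := by
            have h2 : hammingDist a b ≤ (((univ.filter fun i => a i ≠ b i ∧ c₀ * M ≤ t i) ∪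
                (univ.filter fun i => |t i| < c₀ * M)) ∪
                (univ.filter fun i => t i ≤ -(c₀ * M))).card := by
              unfold hammingDist
              refine Finset.card_le_card fun i hi => ?_
              simp only [Finset.mem_union, Finset.mem_filter, Finset.mem_univ, true_and] at hi ⊢
              rcases lt_or_ge (|t i|) (c₀ * M) with h | h
              · exact Or.inl (Or.inr h)
              · rcases le_abs.1 h with h | h
                · exact Or.inl (Or.inl ⟨hi, h⟩)
                · exact Or.inr (by linarith)
            have h3 : (hammingDist a b : ℝ) ≤
                (univ.filter fun i => a i ≠ b i ∧ c₀ * M ≤ t i).card +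
                (univ.filter fun i => |t i| < c₀ * M).card +
                (univ.filter fun i => t i ≤ -(c₀ * M)).card := by
              exact_mod_cast h2.trans ((Finset.card_union_le _ _).trans
                (Nat.add_le_add_right (Finset.card_union_le _ _) _))
            have h4 := mul_le_mul_of_nonneg_right hγρ hn0.le
            have h5 := mul_le_mul_of_nonneg_right hηρ hn0.le
            have h6 : 0 < ρ * n := by positivity
            linarith
          have := hBsep a ha b hb hdist
          subst this
          apply hzw
          funext d
          rw [← haz d, ← hab d, bCap_self]
  · right
    have hmulR : ∀ d, ∀ a : ℤ, (a / R d : ℝ) * R d = a := fun d a => div_mul_cancel₀ _ (hR0 d).ne'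
    have hsym : ∀ i, q i (true, false) = q i (false, true) := fun i => hq3 i _ _ (by
      funext e
      rcases e with d | d <;> simp [pairFeat])
    refine ⟨h', q, hq, hκq, hsym, fun d => ?_, fun d => ?_, fun x h₁ h₂ h₃ =>
      hq2 x (mean_pairFeat h₁ h₂ h₃)⟩
    · have h1 := hq1 (Sum.inl d)
      simp only [pairFeat, Sum.elim_inl, Fintype.sum_prod_type, Fintype.sum_bool, if_true,
        Bool.false_eq_true, if_false, add_zero, zero_add, mul_zero] at h1
      rw [eq_div_iff (hR0 d).ne', Finset.sum_mul] at h1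
      have h2 : ∀ i, (q i (true, true) * (v i d / R d + v i d / R d) + q i (true, false) * (v i d / R d) +
          q i (false, true) * (v i d / R d)) * R d =
          2 * ((q i (true, true) + q i (true, false)) * v i d) := fun i => by
        rw [← hsym i]
        have := hmulR d (v i d)
        linear_combination (2 * q i (true, true) + 2 * q i (true, false)) * this
      rw [Finset.sum_congr rfl fun i _ => h2 i, ← Finset.mul_sum] at h1
      linarith
    · have h1 := hq1 (Sum.inr d)
      simp only [pairFeat, Sum.elim_inr, Fintype.sum_prod_type, Fintype.sum_bool, and_self, if_true,
        Bool.false_eq_true, and_false, false_and, if_false, add_zero, mul_zero] at h1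
      rw [eq_div_iff (hR0 d).ne', Finset.sum_mul] at h1
      rw [← h1]
      exact Finset.sum_congr rfl fun i _ => by rw [mul_assoc, hmulR]

end UnboundedPairs

section Bounded

variable {n D : ℕ}

/-- The law of the first coordinate. -/
def margin (q : Fin n → Bool × Bool → ℝ) (i : Fin n) (b : Bool) : ℝ :=
  ∑ j : Bool × Bool, if j.1 = b then q i j else 0

lemma margin_eq (q : Fin n → Bool × Bool → ℝ) (i : Fin n) (b : Bool) :
    margin q i b = q i (b, true) + q i (b, false) := by
  cases b <;> simp [margin, Fintype.sum_prod_type]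

lemma margin_snd {q : Fin n → Bool × Bool → ℝ} (hs : ∀ i, q i (true, false) = q i (false, true))
    (i : Fin n) (b : Bool) : (∑ j : Bool × Bool, if j.2 = b then q i j else 0) = margin q i b := by
  rw [margin_eq]
  cases b <;> simp [Fintype.sum_prod_type, hs]

lemma isWeights_margin {q : Fin n → Bool × Bool → ℝ} (hq : IsWeights q) : IsWeights (margin q) where
  nonneg i b := by rw [margin_eq]; exact add_nonneg (hq.nonneg i _) (hq.nonneg i _)
  sum_one i := by
    have := hq.sum_one i
    simpa [margin_eq, Fintype.sum_prod_type] using this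

/-- The pairs in a set, as a set of vectors of pairs. -/
def zipSet (U : Set ((Fin n → Bool) × (Fin n → Bool))) : Set (Fin n → Bool × Bool) :=
  {x | ((fun i => (x i).1), (fun i => (x i).2)) ∈ U}

lemma ncard_zipSet (U : Set ((Fin n → Bool) × (Fin n → Bool))) : (zipSet U).ncard = U.ncard := by
  refine Set.ncard_preimage_of_injective_subset_range (f := fun x : Fin n → Bool × Bool =>
    ((fun i => (x i).1), (fun i => (x i).2))) ?_ ?_
  · intro x y h
    simp only [Prod.mk.injEq, funext_iff] at h
    funext i
    exact Prod.ext (h.1 i) (h.2 i)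
  · rintro ⟨a, b⟩ _
    exact ⟨fun i => (a i, b i), rfl⟩

lemma capPairs_mono {v : Fin n → Fin D → ℤ} {A B : Set (Fin n → Bool)} (h : A ⊆ B)
    (w : Fin D → ℤ) : capPairs v A A w ⊆ capPairs v B B w :=
  fun _ hx => ⟨h hx.1, h hx.2.1, hx.2.2⟩

lemma prodPr_zipSet_eq {κ h : ℝ} {v : Fin n → Fin D → ℤ} {z w : Fin D → ℤ}
    {q : Fin n → Bool × Bool → ℝ} (hq : PairFits κ h v z w q)
    {U : Set ((Fin n → Bool) × (Fin n → Bool))}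
    (hU : U ⊆ capPairs v {a | ∀ d, bEval v a d = z d} {a | ∀ d, bEval v a d = z d} w) :
    prodPr q (zipSet U) = U.ncard * Real.exp (-h) := by
  rw [prodPr_eq_ncard_mul (S := zipSet U) (c := Real.exp (-h)), ncard_zipSet]
  intro x hx
  obtain ⟨h1, h2, h3⟩ := hU hx
  exact hq.wt x h1 h2 h3

lemma prodPr_fst {q : Fin n → Bool × Bool → ℝ} (S : Set (Fin n → Bool)) :
    prodPr q {x | (fun i => (x i).1) ∈ S} = prodPr (margin q) S :=
  prodPr_comp q Prod.fst S

lemma prodPr_snd {q : Fin n → Bool × Bool → ℝ} (hs : ∀ i, q i (true, false) = q i (false, true))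
    (S : Set (Fin n → Bool)) :
    prodPr q {x | (fun i => (x i).2) ∈ S} = prodPr (margin q) S := by
  rw [prodPr_comp q Prod.snd S]
  congr 1
  funext i b
  exact margin_snd hs i b

lemma prodPr_zipSet_le {q : Fin n → Bool × Bool → ℝ} (hq : IsWeights q) (v : Fin n → Fin D → ℤ)
    (A : Set (Fin n → Bool)) (w : Fin D → ℤ) :
    prodPr q (zipSet (capPairs v A A w)) ≤ prodPr (margin q) A := by
  rw [← prodPr_fst]
  exact hq.prodPr_mono fun x hx => hx.1

lemma prodPr_zipSet_diff_le {q : Fin n → Bool × Bool → ℝ} (hq : IsWeights q)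
    (hs : ∀ i, q i (true, false) = q i (false, true)) (v : Fin n → Fin D → ℤ)
    (X T : Set (Fin n → Bool)) (w : Fin D → ℤ) :
    prodPr q (zipSet (capPairs v X X w \ capPairs v T T w)) ≤ 2 * prodPr (margin q) (X \ T) := by
  have h : zipSet (capPairs v X X w \ capPairs v T T w) ⊆
      {x | (fun i => (x i).1) ∈ X \ T} ∪ {x | (fun i => (x i).2) ∈ X \ T} := by
    rintro x ⟨⟨h1, h2, h3⟩, h4⟩
    by_cases h5 : (fun i => (x i).1) ∈ T
    · refine Or.inr ⟨h2, fun h6 => h4 ⟨h5, h6, h3⟩⟩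
    · exact Or.inl ⟨h1, h5⟩
  refine (hq.prodPr_mono h).trans ((hq.prodPr_union_le _ _).trans ?_)
  rw [prodPr_fst, prodPr_snd hs]
  linarith

lemma prodPr_le_ncard_mul {p : Fin n → Bool → ℝ} {S : Set (Fin n → Bool)} {c : ℝ}
    (h : ∀ a ∈ S, prodWt p a ≤ c) : prodPr p S ≤ S.ncard * c := by
  classical
  rw [prodPr_eq_sum_toFinset, Set.ncard_eq_toFinset_card']
  refine (Finset.sum_le_card_nsmul _ _ c fun a ha => h a (by simpa using ha)).trans ?_
  rw [nsmul_eq_mul]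

lemma ncard_mul_le_prodPr {p : Fin n → Bool → ℝ} {S : Set (Fin n → Bool)} {c : ℝ}
    (h : ∀ a ∈ S, c ≤ prodWt p a) : S.ncard * c ≤ prodPr p S := by
  classical
  rw [prodPr_eq_sum_toFinset, Set.ncard_eq_toFinset_card']
  refine le_trans ?_ (Finset.card_nsmul_le_sum _ _ c fun a ha => h a (by simpa using ha))
  rw [nsmul_eq_mul]

/-- If the weights on `S` are nearly equal, dense subsets of `S` have large measure. -/
lemma mul_prodPr_le_of_window {p : Fin n → Bool → ℝ} {S B : Set (Fin n → Bool)} {c K t : ℝ}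
    (hc : 0 ≤ c) (hK : 0 ≤ K) (ht : 0 ≤ t) (h : ∀ a ∈ S, c ≤ prodWt p a ∧ prodWt p a ≤ K * c)
    (hB : B ⊆ S) (hcard : t * S.ncard ≤ B.ncard) : t * prodPr p S ≤ K * prodPr p B := by
  calc t * prodPr p S ≤ t * (S.ncard * (K * c)) :=
        mul_le_mul_of_nonneg_left (prodPr_le_ncard_mul fun a ha => (h a ha).2) ht
    _ = K * (t * S.ncard * c) := by ring
    _ ≤ K * (B.ncard * c) := by gcongr
    _ ≤ _ := mul_le_mul_of_nonneg_left (ncard_mul_le_prodPr fun a ha => (h a (hB ha)).1) hK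

lemma prodWt_le_exp_mul {p r : Fin n → Bool → ℝ} {κ ξ : ℝ} (hκ : 0 < κ) (hp : IsWeights p)
    (hr : IsWeights r) (hκp : ∀ i j, κ ≤ p i j) (hd : ∑ i, |p i true - r i true| ≤ ξ)
    (a : Fin n → Bool) : prodWt r a ≤ Real.exp (ξ / κ) * prodWt p a := by
  have h1 : ∀ i b, r i b ≤ Real.exp (|p i true - r i true| / κ) * p i b := by
    intro i b
    have hb : |p i b - r i b| = |p i true - r i true| := by
      cases b
      · have e1 := hp.sum_one i
        have e2 := hr.sum_one i
        simp only [Fintype.sum_bool] at e1 e2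
        rw [show p i false - r i false = -(p i true - r i true) by linarith, abs_neg]
      · rfl
    have h2 := neg_abs_le (p i b - r i b)
    rw [hb] at h2
    set x := |p i true - r i true|
    have hx : 0 ≤ x := abs_nonneg _
    have h3 : x ≤ x / κ * p i b := by
      calc x = x / κ * κ := by field_simp
        _ ≤ _ := by gcongr; exact hκp i b
    have h4 := mul_le_mul_of_nonneg_right (Real.add_one_le_exp (x / κ)) (hp.nonneg i b)
    linarith
  calc prodWt r a ≤ ∏ i, Real.exp (|p i true - r i true| / κ) * p i (a i) :=
        Finset.prod_le_prod (fun i _ => hr.nonneg i _) fun i _ => h1 i _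
    _ = Real.exp (∑ i, |p i true - r i true| / κ) * prodWt p a := by
        rw [Finset.prod_mul_distrib, ← Real.exp_sum]; rfl
    _ ≤ _ := by
        refine mul_le_mul_of_nonneg_right (Real.exp_le_exp.2 ?_) (hp.prodWt_nonneg a)
        rw [← Finset.sum_div]
        gcongr

/-- If the marginal is far from the maximum entropy weights, a small subset of the solutions carries
nearly all the mass, with nearly constant weights. -/
lemma exists_concentrated {κ ξ s : ℝ} {p r : Fin n → Bool → ℝ} (hκ : 0 < κ)
    (hp : IsWeights p) (hr : IsWeights r) (hκp : ∀ i j, κ ≤ p i j) (hξ : 0 ≤ ξ) (hs : 0 ≤ s)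
    (hd : ξ * n ≤ ∑ i, |p i true - r i true|) (X : Set (Fin n → Bool)) :
    ∃ T ⊆ X, prodPr r T ≤ Real.exp (-(ξ ^ 2 / 16 * n)) ∧
      prodPr p (X \ T) ≤ Real.exp (-(ξ ^ 2 / 16 * n)) + 2 * Real.exp (-(s ^ 2 / 4 * n)) ∧
      ∃ c > 0, ∀ a ∈ T, c ≤ prodWt p a ∧
        prodWt p a ≤ Real.exp (2 * s * (1 - Real.log κ) * n) * c := by
  set sg : Fin n → ℝ := fun i => if r i true ≤ p i true then 1 else -1 with hsg
  set hf : Fin n → Bool → ℝ := fun i b => if b then sg i else 0 with hhf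
  set f : (Fin n → Bool) → ℝ := fun a => ∑ i, hf i (a i) with hfdef
  have hfL : HammingLipschitz f := by
    refine hammingLipschitz_sum fun i j j' => ?_
    rcases j with _ | _ <;> rcases j' with _ | _ <;> simp only [hhf, hsg] <;> split_ifs <;> norm_num
  have hEf : prodEx p f - prodEx r f = ∑ i, |p i true - r i true| := by
    rw [hfdef, prodEx_sum hp, prodEx_sum hr, ← Finset.sum_sub_distrib]
    refine Finset.sum_congr rfl fun i _ => ?_
    by_cases h : r i true ≤ p i true
    · rw [abs_of_nonneg (by linarith)]; simp [hhf, hsg, h]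
    · rw [abs_of_nonpos (by linarith)]; simp [hhf, hsg, h]; ring
  have hp1 : ∀ i j, p i j ≤ 1 := fun i j => by
    rw [← hp.sum_one i]
    exact Finset.single_le_sum (fun j _ => hp.nonneg i j) (Finset.mem_univ j)
  have hp0 : ∀ i j, 0 < p i j := fun i j => hκ.trans_le (hκp i j)
  set L : ℝ := 1 - Real.log κ with hL
  have hlog : ∀ i j, Real.log κ ≤ Real.log (p i j) ∧ Real.log (p i j) ≤ 0 := fun i j =>
    ⟨Real.log_le_log hκ (hκp i j), Real.log_nonpos (hp0 i j).le (hp1 i j)⟩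
  set hg : Fin n → Bool → ℝ := fun i b => Real.log (p i b) / L with hhg
  set g : (Fin n → Bool) → ℝ := fun a => ∑ i, hg i (a i) with hgdef
  rcases Nat.eq_zero_or_pos n with hn | hn
  · subst hn
    refine ⟨X, subset_rfl, ?_, ?_, 1, one_pos, fun a _ => ?_⟩
    · simpa using hr.prodPr_le_one X
    · simp only [sdiff_self, CharP.cast_eq_zero, mul_zero, neg_zero, Real.exp_zero]
      rw [Set.bot_eq_empty, prodPr_empty]; norm_num
    · simp [prodWt]
  have hL0 : 0 < L := by
    have := hlog ⟨0, hn⟩ true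
    rw [hL]; linarith [this.1, this.2]
  have hgL : HammingLipschitz g := by
    refine hammingLipschitz_sum fun i j j' => ?_
    have h1 := hlog i j
    have h2 := hlog i j'
    simp only [hhg]
    rw [← sub_div, abs_div, abs_of_pos hL0, div_le_one hL0, abs_le]
    constructor <;> rw [hL] <;> linarith [h1.1, h1.2, h2.1, h2.2]
  have hwt : ∀ a, prodWt p a = Real.exp (L * g a) := by
    intro a
    rw [hgdef, Finset.mul_sum, Real.exp_sum]
    refine Finset.prod_congr rfl fun i _ => ?_
    rw [hhg]
    simp only
    rw [mul_div_cancel₀ _ hL0.ne', Real.exp_log (hp0 i _)]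
  have htail : ∀ {x : ℝ}, (x / 2) ^ 2 / 4 = x ^ 2 / 16 := fun {x} => by ring
  set T : Set (Fin n → Bool) := {a | a ∈ X ∧ prodEx r f + ξ / 2 * n ≤ f a ∧ |g a - prodEx p g| < s * n}
    with hT
  refine ⟨T, fun a ha => ha.1, ?_, ?_, Real.exp (L * (prodEx p g - s * n)), Real.exp_pos _, ?_⟩
  · rw [← htail]
    exact (hr.prodPr_mono fun a ha => ha.2.1).trans
      (prodPr_upper_tail hr hfL (by positivity))
  · have hsub : X \ T ⊆ {a | f a ≤ prodEx p f - ξ / 2 * n} ∪ {a | s * n ≤ |g a - prodEx p g|} := by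
      rintro a ⟨haX, haT⟩
      by_cases h1 : |g a - prodEx p g| < s * n
      · left
        have h2 : ¬ prodEx r f + ξ / 2 * n ≤ f a := fun h2 => haT ⟨haX, h2, h1⟩
        show f a ≤ prodEx p f - ξ / 2 * n
        linarith
      · right
        exact not_lt.1 h1
    refine (hp.prodPr_mono hsub).trans ((hp.prodPr_union_le _ _).trans (add_le_add ?_ ?_))
    · rw [← htail]
      exact prodPr_lower_tail hp hfL (by positivity)
    · exact prodPr_dev_le hp hgL hs
  · intro a ha
    have h1 := abs_lt.1 ha.2.2
    rw [hwt, ← Real.exp_add, Real.exp_le_exp, Real.exp_le_exp]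
    constructor
    · exact mul_le_mul_of_nonneg_left (by linarith [h1.1]) hL0.le
    · have := mul_le_mul_of_nonneg_left h1.2.le hL0.le
      linarith

lemma cap_ge_of_le_margin {κ h δ ε : ℝ} {v : Fin n → Fin D → ℤ} {z w : Fin D → ℤ}
    {q : Fin n → Bool × Bool → ℝ} (hq : PairFits κ h v z w q) (hε1 : ε ≤ 1)
    (hcore : ∀ A : Set (Fin n → Bool), Real.exp (-(δ * n)) ≤ prodPr (margin q) A →
      Real.exp (-(ε * n)) ≤ prodPr q (zipSet (capPairs v A A w)))
    {A : Set (Fin n → Bool)} (hA : A ⊆ {a | ∀ d, bEval v a d = z d})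
    (hpA : Real.exp (-(δ * n)) ≤ prodPr (margin q) A) :
    (1 - ε) ^ n * ((capPairs v {a | ∀ d, bEval v a d = z d} {a | ∀ d, bEval v a d = z d} w).ncard : ℝ)
      ≤ ((capPairs v A A w).ncard : ℝ) := by
  have h1 := hcore A hpA
  have h2 := hq.weights.prodPr_le_one
    (zipSet (capPairs v {a | ∀ d, bEval v a d = z d} {a | ∀ d, bEval v a d = z d} w))
  rw [prodPr_zipSet_eq hq (capPairs_mono hA w)] at h1
  rw [prodPr_zipSet_eq hq subset_rfl] at h2
  refine le_of_mul_le_mul_right ?_ (Real.exp_pos (-h))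
  rw [mul_assoc]
  calc _ ≤ (1 - ε) ^ n * 1 := mul_le_mul_of_nonneg_left h2 (pow_nonneg (by linarith) n)
    _ ≤ Real.exp (-(ε * n)) := by rw [mul_one]; exact one_sub_pow_le_exp hε1 n
    _ ≤ _ := h1

lemma le_margin_of_caseFull {κ h δ ε : ℝ} {v : Fin n → Fin D → ℤ} {z w : Fin D → ℤ}
    {q : Fin n → Bool × Bool → ℝ} (hq : PairFits κ h v z w q)
    (hδ : (1 - δ) ^ n ≤ 1 / 2) (hε : 2 * Real.exp (-(ε * n)) ≤ 1)
    (hP : Real.exp (-(ε * n)) ≤ prodPr q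
      (zipSet (capPairs v {a | ∀ d, bEval v a d = z d} {a | ∀ d, bEval v a d = z d} w)))
    {B : Set (Fin n → Bool)} (hB : CaseFull v {a | ∀ d, bEval v a d = z d} w δ B) :
    Real.exp (-(2 * ε * n)) ≤ prodPr (margin q) B := by
  obtain ⟨hBX, -, hdiff⟩ := hB
  set X : Set (Fin n → Bool) := {a | ∀ d, bEval v a d = z d} with hX
  have h1 := Set.ncard_sdiff_add_ncard_of_subset (capPairs_mono (v := v) hBX w) (Set.toFinite _)
  have h1' : ((capPairs v X X w \ capPairs v B B w).ncard : ℝ) + (capPairs v B B w).ncard =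
      (capPairs v X X w).ncard := by exact_mod_cast h1
  have h2 : ((capPairs v X X w).ncard : ℝ) ≤ 2 * (capPairs v B B w).ncard := by
    have := mul_le_mul_of_nonneg_right hδ (Nat.cast_nonneg (α := ℝ) (capPairs v X X w).ncard)
    linarith
  rw [prodPr_zipSet_eq hq subset_rfl] at hP
  have h3 := prodPr_zipSet_le hq.weights v B w
  rw [prodPr_zipSet_eq hq (capPairs_mono hBX w)] at h3
  have h4 := mul_le_mul_of_nonneg_right h2 (Real.exp_pos (-h)).le
  have h5 : Real.exp (-(2 * ε * n)) = Real.exp (-(ε * n)) * Real.exp (-(ε * n)) := by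
    rw [← Real.exp_add]; congr 1; ring
  have h6 := mul_le_mul_of_nonneg_right hε (Real.exp_pos (-(ε * n))).le
  rw [h5]
  linarith

lemma cap_ge_of_window {κ h δc δ ε ε' c K : ℝ} {v : Fin n → Fin D → ℤ} {z w : Fin D → ℤ}
    {q : Fin n → Bool × Bool → ℝ} (hq : PairFits κ h v z w q) (hε1 : ε ≤ 1)
    (hcore : ∀ A : Set (Fin n → Bool), Real.exp (-(δc * n)) ≤ prodPr (margin q) A →
      Real.exp (-(ε * n)) ≤ prodPr q (zipSet (capPairs v A A w)))
    (hδ0 : 0 ≤ δ) (hδ1 : δ ≤ 1 / 2) (hδ : δ ≤ δc / 8) (hε' : ε' ≤ δc / 8) (hc : 0 ≤ c)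
    (hK0 : 0 ≤ K) (hK : K ≤ Real.exp (δc / 4 * n)) {S A : Set (Fin n → Bool)}
    (hS : S ⊆ {a | ∀ d, bEval v a d = z d})
    (hwin : ∀ a ∈ S, c ≤ prodWt (margin q) a ∧ prodWt (margin q) a ≤ K * c)
    (hSp : Real.exp (-(2 * ε' * n)) ≤ prodPr (margin q) S) (hA : A ⊆ S)
    (hcard : (1 - δ) ^ n * (S.ncard : ℝ) ≤ A.ncard) :
    (1 - ε) ^ n * ((capPairs v {a | ∀ d, bEval v a d = z d} {a | ∀ d, bEval v a d = z d} w).ncard : ℝ)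
      ≤ ((capPairs v A A w).ncard : ℝ) := by
  refine cap_ge_of_le_margin hq hε1 hcore (hA.trans hS) ?_
  have hn : (0 : ℝ) ≤ n := Nat.cast_nonneg n
  have ht := exp_le_one_sub_pow hδ0 hδ1 n
  have h1 := mul_prodPr_le_of_window hc hK0 (pow_nonneg (by linarith) n) hwin hA hcard
  have h2 : Real.exp (-(2 * δ * n)) * Real.exp (-(2 * ε' * n)) ≤
      (1 - δ) ^ n * prodPr (margin q) S :=
    mul_le_mul ht hSp (Real.exp_pos _).le (pow_nonneg (by linarith) n)
  have h3 := mul_le_mul_of_nonneg_right hK ((isWeights_margin hq.weights).prodPr_nonneg A)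
  refine le_of_mul_le_mul_left ?_ (Real.exp_pos (δc / 4 * n))
  refine le_trans ?_ (h2.trans (h1.trans h3))
  rw [← Real.exp_add, ← Real.exp_add, Real.exp_le_exp]
  have := mul_le_mul_of_nonneg_right hδ hn
  have := mul_le_mul_of_nonneg_right hε' hn
  have := mul_nonneg hδ0 hn
  linarith

theorem trichotomy_of_fits (D C k : ℕ) {γ κ ε : ℝ} (hγ : 0 < γ) (hκ : 0 < κ) (hκ1 : κ ≤ 1)
    (hε : 0 < ε) (hε1 : ε ≤ 1) : ∃ δ₀ > 0, ∀ δ : ℝ, 0 < δ → δ < δ₀ → ∃ n₀ : ℕ, ∀ n : ℕ, n₀ ≤ n →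
      ∀ (R : Fin D → ℝ) (v : Fin n → Fin D → ℤ), Tame γ C k R v →
      ∀ (z w : Fin D → ℤ) (h h' : ℝ) (r : Fin n → Bool → ℝ) (q : Fin n → Bool × Bool → ℝ),
      Fits κ h v z r → PairFits κ h' v z w q → ∀ X : Set (Fin n → Bool),
      X = {a | ∀ d, bEval v a d = z d} →
      ((∀ A : Set (Fin n → Bool), A ⊆ X → (1 - δ) ^ n * (X.ncard : ℝ) ≤ (A.ncard : ℝ) →
          (1 - ε) ^ n * ((capPairs v X X w).ncard : ℝ) ≤ ((capPairs v A A w).ncard : ℝ)) ∧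
        ∀ B, CaseFull v X w δ B → ∀ B' : Set (Fin n → Bool), B' ⊆ B →
          (1 - δ) ^ n * (B.ncard : ℝ) ≤ (B'.ncard : ℝ) →
          (1 - ε) ^ n * ((capPairs v X X w).ncard : ℝ) ≤ ((capPairs v B' B' w).ncard : ℝ)) ∨
      ∃ B, CaseFull v X w δ B ∧ ∀ B' : Set (Fin n → Bool), B' ⊆ B →
          (1 - δ) ^ n * (B.ncard : ℝ) ≤ (B'.ncard : ℝ) →
          (1 - ε) ^ n * ((capPairs v X X w).ncard : ℝ) ≤ ((capPairs v B' B' w).ncard : ℝ) := by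
  obtain ⟨δc, hδc, n₁, hcore⟩ := exists_prodPr_pairs_ge D C k hγ hκ hκ1 hε
  have hlogκ : Real.log κ ≤ 0 := Real.log_nonpos hκ.le hκ1
  set L : ℝ := 1 - Real.log κ with hL
  have hL1 : 1 ≤ L := by rw [hL]; linarith
  have hL0 : 0 < L := by linarith
  set ξ : ℝ := κ * δc / 8 with hξ
  have hξ0 : 0 < ξ := by positivity
  set s : ℝ := δc / (8 * L) with hs
  have hs0 : 0 < s := by positivity
  set c' : ℝ := min (ξ ^ 2 / 16) (s ^ 2 / 4) with hc'
  have hc'0 : 0 < c' := by positivity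
  have hc'1 : c' ≤ ξ ^ 2 / 16 := min_le_left _ _
  have hc'2 : c' ≤ s ^ 2 / 4 := min_le_right _ _
  set ε' : ℝ := min (δc / 8) (c' / 4) with hε'
  have hε'0 : 0 < ε' := by positivity
  have hε'1 : ε' ≤ δc / 8 := min_le_left _ _
  have hε'2 : ε' ≤ c' / 4 := min_le_right _ _
  obtain ⟨δ', hδ', n₂, hcore'⟩ := exists_prodPr_pairs_ge D C k hγ hκ hκ1 hε'0
  set η : ℝ := min δ' ε' with hη
  have hη0 : 0 < η := by positivity
  have hη1 : η ≤ δ' := min_le_left _ _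
  have hη2 : η ≤ ε' := min_le_right _ _
  obtain ⟨η₁, hη₁, n₃, hpat⟩ := exists_prodPr_pattern_ge D C k hγ hκ hκ1 hη0
  refine ⟨min (1 / 2) (min (δc / 8) (c' / 4)), by positivity, fun δ hδ hδlt => ?_⟩
  have hδ1 : δ ≤ 1 / 2 := hδlt.le.trans (min_le_left _ _)
  have hδ2 : δ ≤ δc / 8 := hδlt.le.trans ((min_le_right _ _).trans (min_le_left _ _))
  have hδ3 : δ ≤ c' / 4 := hδlt.le.trans ((min_le_right _ _).trans (min_le_right _ _))
  obtain ⟨n₄, hn₄⟩ := exists_forall_le_mul hδ 2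
  obtain ⟨n₅, hn₅⟩ := exists_forall_le_mul hε'0 2
  obtain ⟨n₆, hn₆⟩ := exists_forall_le_mul (show 0 < c' / 4 by positivity) 6
  refine ⟨n₁ + n₂ + n₃ + n₄ + n₅ + n₆, fun n hn R v hV z w h h' r q hr hq X hX => ?_⟩
  subst hX
  replace hcore := fun A hA => hcore n (by omega) R v hV (margin q) q (isWeights_margin hq.weights)
    hq.weights hq.le (fun _ _ => rfl) (margin_snd hq.symm) w hq.mean_cap A hA
  replace hcore' := fun A hA => hcore' n (by omega) R v hV (margin q) q (isWeights_margin hq.weights)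
    hq.weights hq.le (fun _ _ => rfl) (margin_snd hq.symm) w hq.mean_cap A hA
  have hpat' : ∀ p : Fin n → Bool → ℝ, IsWeights p → (∀ i j, κ ≤ p i j) →
      (∀ d, ∑ i, p i true * v i d = z d) →
      Real.exp (-(η * n)) ≤ prodPr p {a | ∀ d, bEval v a d = z d} := fun p hp hκp hz =>
    (hpat n (by omega) R v hV p hp hκp z hz ∅ (fun _ => true) (by
      rw [Finset.card_empty, Nat.cast_zero]; positivity)).trans
      (hp.prodPr_mono fun a ha => ha.2)
  replace hn₄ := hn₄ n (by omega)
  replace hn₅ := hn₅ n (by omega)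
  replace hn₆ := hn₆ n (by omega)
  have hn0 : (0 : ℝ) ≤ n := Nat.cast_nonneg n
  have hpw := isWeights_margin hq.weights
  have hκp : ∀ i b, κ ≤ margin q i b := fun i b => by
    rw [margin_eq]; linarith [hq.le i (b, true), hq.weights.nonneg i (b, false)]
  have hpz : ∀ d, ∑ i, margin q i true * v i d = z d := fun d => by
    simp only [margin_eq]; exact hq.mean d
  have hpX := hpat' _ hpw hκp hpz
  have hrX := hpat' _ hr.weights hr.le hr.mean
  have hqX := hcore' _ (hpX.trans' (Real.exp_le_exp.2 (by
    have := mul_le_mul_of_nonneg_right hη1 hn0; linarith)))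
  have hηε : Real.exp (-(ε' * n)) ≤ Real.exp (-(η * n)) := Real.exp_le_exp.2 (by
    have := mul_le_mul_of_nonneg_right hη2 hn0; linarith)
  have h2ε : 2 * Real.exp (-(ε' * n)) ≤ 1 := mul_exp_neg_le hn₅
  have hhalf : (1 - δ) ^ n ≤ 1 / 2 := by
    have h1 := mul_exp_neg_le hn₄
    have h2 := one_sub_pow_le_exp (show δ ≤ 1 by linarith) n
    linarith
  have hwindow := fun {c K : ℝ} (hc : 0 ≤ c) (hK0 : 0 ≤ K) (hK : K ≤ Real.exp (δc / 4 * n))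
    {S A : Set (Fin n → Bool)} => cap_ge_of_window (S := S) (A := A) hq hε1 hcore hδ.le hδ1 hδ2 hε'1
      hc hK0 hK
  have hfull := fun {B : Set (Fin n → Bool)} => le_margin_of_caseFull (B := B) (δ := δ) hq hhalf h2ε hqX
  have hpX2 : Real.exp (-(2 * ε' * n)) ≤ prodPr (margin q) {a | ∀ d, bEval v a d = z d} :=
    (hηε.trans hpX).trans' (Real.exp_le_exp.2 (by
      have := mul_nonneg hε'0.le hn0; linarith))
  set X : Set (Fin n → Bool) := {a | ∀ d, bEval v a d = z d} with hX
  rcases le_total (∑ i, |margin q i true - r i true|) (ξ * n) with hd | hd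
  · left
    have hd' : ∑ i, |r i true - margin q i true| ≤ ξ * n := by
      simpa only [abs_sub_comm] using hd
    have hξκ : ξ * n / κ = δc / 8 * n := by rw [hξ]; field_simp
    have hwin : ∀ a ∈ X, Real.exp (-h) * Real.exp (-(δc / 8 * n)) ≤ prodWt (margin q) a ∧
        prodWt (margin q) a ≤
          Real.exp (δc / 4 * n) * (Real.exp (-h) * Real.exp (-(δc / 8 * n))) := by
      intro a ha
      have h1 := prodWt_le_exp_mul hκ hpw hr.weights hκp hd a
      have h2 := prodWt_le_exp_mul hκ hr.weights hpw hr.le hd' a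
      rw [hr.wt a ha, hξκ] at h1 h2
      constructor
      · rw [Real.exp_neg (δc / 8 * n), ← div_eq_mul_inv, div_le_iff₀ (Real.exp_pos _)]
        linarith
      · refine h2.trans_eq ?_
        rw [← Real.exp_add, ← Real.exp_add, ← Real.exp_add]
        congr 1; ring
    refine ⟨fun A hA hcard => hwindow (by positivity) (Real.exp_pos _).le le_rfl subset_rfl hwin hpX2
      hA hcard, fun B hB B' hB' hcard => ?_⟩
    exact hwindow (by positivity) (Real.exp_pos _).le le_rfl hB.1 (fun a ha => hwin a (hB.1 ha))
      (hfull hB) hB' hcard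
  · right
    obtain ⟨T, hTX, hrT, hpT, c, hc, hwin⟩ :=
      exists_concentrated hκ hpw hr.weights hκp hξ0.le hs0.le hd X
    have hsL : 2 * s * L * n = δc / 4 * n := by rw [hs]; field_simp; ring
    rw [← hL, hsL] at hwin
    have hδε : Real.exp (-(3 * c' / 4 * n)) ≤ (1 - δ) ^ n * Real.exp (-(ε' * n)) := by
      refine le_trans ?_ (mul_le_mul_of_nonneg_right (exp_le_one_sub_pow hδ.le hδ1 n)
        (Real.exp_pos _).le)
      rw [← Real.exp_add, Real.exp_le_exp]
      have := mul_le_mul_of_nonneg_right hδ3 hn0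
      have := mul_le_mul_of_nonneg_right hε'2 hn0
      linarith
    have he1 : Real.exp (-(ξ ^ 2 / 16 * n)) ≤ Real.exp (-(c' * n)) := Real.exp_le_exp.2 (by
      have := mul_le_mul_of_nonneg_right hc'1 hn0; linarith)
    have he2 : Real.exp (-(s ^ 2 / 4 * n)) ≤ Real.exp (-(c' * n)) := Real.exp_le_exp.2 (by
      have := mul_le_mul_of_nonneg_right hc'2 hn0; linarith)
    have he3 : 6 * Real.exp (-(c' * n)) ≤ Real.exp (-(3 * c' / 4 * n)) := by
      have h1 := mul_le_mul_of_nonneg_right (mul_exp_neg_le hn₆) (Real.exp_pos (-(3 * c' / 4 * n))).le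
      rw [mul_assoc, ← Real.exp_add, one_mul] at h1
      refine le_of_eq_of_le ?_ h1
      congr 2; ring
    have hpow : 0 ≤ (1 - δ) ^ n := pow_nonneg (by linarith) n
    have hTfull : CaseFull v X w δ T := by
      refine ⟨hTX, ?_, ?_⟩
      · rw [prodPr_eq_ncard_mul (S := T) (fun a ha => hr.wt a (hTX ha))] at hrT
        rw [prodPr_eq_ncard_mul (S := X) (fun a ha => hr.wt a ha)] at hrX
        refine le_of_mul_le_mul_right ?_ (Real.exp_pos (-h))
        have h1 := mul_le_mul_of_nonneg_left (hηε.trans hrX) hpow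
        have h2 := Real.exp_pos (-(c' * n))
        linarith
      · have h0 := prodPr_zipSet_diff_le hq.weights hq.symm v X T w
        have h1 : Real.exp (-(ε' * n)) ≤ prodPr q (zipSet (capPairs v X X w)) := hqX
        rw [prodPr_zipSet_eq hq Set.sdiff_subset] at h0
        rw [prodPr_zipSet_eq hq subset_rfl] at h1
        refine le_of_mul_le_mul_right ?_ (Real.exp_pos (-h'))
        have h1 := mul_le_mul_of_nonneg_left h1 hpow
        linarith
    exact ⟨T, hTfull, fun B' hB' hcard => hwindow hc.le (Real.exp_pos _).le le_rfl hTX hwin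
      (hfull hTfull) hB' hcard⟩

end Bounded

/-- **Trichotomy theorem for vector-valued intersections.** -/
theorem trichotomy_theorem (D C k : ℕ) (ε : ℝ) (hε : ε ∈ Set.Ioo (0:ℝ) 1) :
    ∃ θ₁ > (0:ℝ), ∀ γ₂ ∈ Set.Ioo (0:ℝ) θ₁, ∀ γ₂' ∈ Set.Ioo (0:ℝ) θ₁,
    ∃ θ₂ > (0:ℝ), ∀ γ₁ ∈ Set.Ioo (0:ℝ) θ₂, ∀ γ₁' ∈ Set.Ioo (0:ℝ) θ₂,
    ∃ δ₀ > (0:ℝ), ∀ δ ∈ Set.Ioo (0:ℝ) δ₀,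
    ∃ n₀ : ℕ, ∀ n, n₀ ≤ n →
    ∀ R : Fin D → ℝ, (∀ d, 0 < R d) → (∀ d, R d ≤ (n : ℝ) ^ C) →
    ∀ v : Fin n → Fin D → ℤ,
      (∀ i, rnorm R (fun d => (v i d : ℝ)) ≤ 1) →
      RobustlyGeneric γ₁' γ₁ R v → RobustlyGenerating γ₁ R k v →
      RobustlyGeneric γ₂' γ₂ R v → RobustlyGenerating γ₂ R k v →
    ∀ z w : Fin D → ℤ, z ≠ w →
    ∀ X : Set (Fin n → Bool), X = {a | ∀ d, bEval v a d = z d} →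
      (((∀ A : Set (Fin n → Bool), A ⊆ X →
            (1 - δ) ^ n * (X.ncard : ℝ) ≤ (A.ncard : ℝ) →
            (1 - ε) ^ n * ((capPairs v X X w).ncard : ℝ) ≤
              ((capPairs v A A w).ncard : ℝ)) ∨
        (∃ B, CaseFull v X w δ B) ∨
        CaseEmpty v X w ε) ∧
       (((∃ B, CaseFull v X w δ B) ∧ ¬ CaseEmpty v X w ε) →
         ∃ B, CaseFull v X w δ B ∧
           ∀ B' : Set (Fin n → Bool), B' ⊆ B →
             (1 - δ) ^ n * (B.ncard : ℝ) ≤ (B'.ncard : ℝ) →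
             (1 - ε) ^ n * ((capPairs v X X w).ncard : ℝ) ≤
               ((capPairs v B' B' w).ncard : ℝ))) := by
  obtain ⟨hε0, hε1⟩ := hε
  obtain ⟨θ, hθ, hfits⟩ := caseEmpty_or_fits D hε0 hε1.le
  obtain ⟨θ', hθ', hpair⟩ := caseEmpty_or_pairFits D C k hε0 hε1.le
  refine ⟨min (min θ θ') (1 / 2), by positivity, fun γ hγ γ' hγ' => ⟨1, one_pos, ?_⟩⟩
  intro _ _ _ _
  have hγ'θ : γ' ≤ θ := hγ'.2.le.trans ((min_le_left _ _).trans (min_le_left _ _))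
  have hγ'θ' : γ' ≤ θ' := hγ'.2.le.trans ((min_le_left _ _).trans (min_le_right _ _))
  have hγ'1 : γ' < 1 := by linarith [hγ'.2.trans_le (min_le_right (min θ θ') (1 / 2))]
  obtain ⟨κ₀, hκ₀, hκ₀1, hfits⟩ := hfits γ γ' hγ.1 hγ'θ
  obtain ⟨κ, hκ, hκ1, n₁, hpair⟩ := hpair γ γ' κ₀ hγ.1 hγ'θ' hκ₀ hκ₀1
  obtain ⟨δ₀, hδ₀, htri⟩ := trichotomy_of_fits D C k hγ.1 (lt_min hκ₀ hκ)
    ((min_le_left κ₀ κ).trans hκ₀1) hε0 hε1.le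
  refine ⟨δ₀, hδ₀, fun δ hδ => ?_⟩
  obtain ⟨n₂, htri⟩ := htri δ hδ.1 hδ.2
  refine ⟨n₁ + n₂ + 1, fun n hn R hR hRC v hv _ _ hgeneric hgen z w hzw X hX => ?_⟩
  have hvR : ∀ i d, |(v i d : ℝ)| ≤ R d := fun i => (rnorm_le_one_iff hR _).1 (hv i)
  have hT : Tame γ C k R v :=
    ⟨fun d => hgeneric.one_le hγ.1 hγ'1 (by omega) hR hvR d, hRC, hvR, hgen⟩
  by_cases hE : CaseEmpty v X w ε
  · exact ⟨Or.inr (Or.inr hE), fun h => absurd hE h.2⟩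
  have hE' : ¬ CaseEmpty v {a | ∀ d, bEval v a d = z d} w ε := hX ▸ hE
  obtain ⟨h, r, hr⟩ := (hfits n (by omega) R v hR hvR hgeneric z w).resolve_left hE'
  obtain ⟨h', q, hq⟩ := (hpair n (by omega) R v hT hgeneric z w hzw h r hr).resolve_left hE'
  rcases htri n (by omega) R v hT z w h h' r q
      ⟨hr.weights, fun i j => (min_le_left _ _).trans (hr.le i j), hr.mean, hr.wt⟩
      ⟨hq.weights, fun i j => (min_le_right _ _).trans (hq.le i j), hq.symm, hq.mean, hq.mean_cap,
        hq.wt⟩ X hX with ⟨h1, h2⟩ | h1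
  · exact ⟨Or.inl h1, fun ⟨⟨B, hB⟩, _⟩ => ⟨B, hB, h2 B hB⟩⟩
  · obtain ⟨B, hB, hB'⟩ := h1
    exact ⟨Or.inr (Or.inl ⟨B, hB⟩), fun _ => ⟨B, hB, hB'⟩⟩
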